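/- The satisfiability problem for CPDL+ is decidable: there is an algorithm that, given a CPDL+ formula φ, decides whether there exists a Kripke structure K and a world w with K,w ⊨ φ. -/

import Mathlib

set_option linter.unusedVariables false

/-! ## Kripke structures -/

/-- A Kripke structure with worlds `W`, atomic propositions `P` and atomic programs `A`. -/
structure Kripke (W P A : Type) where
  rel : A → W → W → Prop
  val : P → W → Prop

/-! ## Syntax of `CPDL+` with loop and intersection (master language) -/

mutual
  /-- Formulas of loop/intersection CPDL+:  `p | ¬φ | φ∧φ | ⟨π⟩ | loop(π)`. -/
  inductive PDLFormula : Type where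
    | prop  : ℕ → PDLFormula
    | neg   : PDLFormula → PDLFormula
    | conj  : PDLFormula → PDLFormula → PDLFormula
    | diam  : PDLProgram → PDLFormula
    | floop : PDLProgram → PDLFormula
  /-- Programs: `ε | a | ā | π∪π | π∘π | π* | φ? | π∩π | C[x_s,x_t]`. -/
  inductive PDLProgram : Type where
    | eps    : PDLProgram
    | atom   : ℕ → PDLProgram
    | conv   : ℕ → PDLProgram
    | punion : PDLProgram → PDLProgram → PDLProgram
    | comp   : PDLProgram → PDLProgram → PDLProgram
    | star   : PDLProgram → PDLProgram
    | test   : PDLFormula → PDLProgram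
    | inter  : PDLProgram → PDLProgram → PDLProgram
    | cprog  : AtomList → ℕ → ℕ → PDLProgram
  /-- A finite list of atoms `π(x,y)` (a "conjunctive program body" `C`). -/
  inductive AtomList : Type where
    | nil   : AtomList
    | acons : PDLProgram → ℕ → ℕ → AtomList → AtomList
end

/-! ## Semantics -/

mutual
  /-- Satisfaction `⟦φ⟧_K ⊆ W`. -/
  def PDLFormula.sat {W : Type} (K : Kripke W ℕ ℕ) : PDLFormula → W → Prop
    | .prop p, w => K.val p w
    | .neg φ, w => ¬ PDLFormula.sat K φ w
    | .conj φ ψ, w => PDLFormula.sat K φ w ∧ PDLFormula.sat K ψ w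
    | .diam π, w => ∃ v, PDLProgram.rel K π w v
    | .floop π, w => PDLProgram.rel K π w w
  termination_by φ _ => sizeOf φ
  /-- Binary relation `⟦π⟧_K ⊆ W × W`. -/
  def PDLProgram.rel {W : Type} (K : Kripke W ℕ ℕ) : PDLProgram → W → W → Prop
    | .eps, u, v => u = v
    | .atom a, u, v => K.rel a u v
    | .conv a, u, v => K.rel a v u
    | .punion π ρ, u, v => PDLProgram.rel K π u v ∨ PDLProgram.rel K ρ u v
    | .comp π ρ, u, v => ∃ w, PDLProgram.rel K π u w ∧ PDLProgram.rel K ρ w v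
    | .star π, u, v => Relation.ReflTransGen (fun a b => PDLProgram.rel K π a b) u v
    | .test φ, u, v => u = v ∧ PDLFormula.sat K φ u
    | .inter π ρ, u, v => PDLProgram.rel K π u v ∧ PDLProgram.rel K ρ u v
    | .cprog C xs xt, u, v => ∃ f : ℕ → W, f xs = u ∧ f xt = v ∧ AtomList.sat K C f
  termination_by π _ _ => sizeOf π
  /-- `f` is a `C`-satisfying assignment. -/
  def AtomList.sat {W : Type} (K : Kripke W ℕ ℕ) : AtomList → (ℕ → W) → Prop
    | .nil, _ => True
    | .acons π x y C, f => PDLProgram.rel K π (f x) (f y) ∧ AtomList.sat K C f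
  termination_by C _ => sizeOf C
end

/-- Semantic equivalence of formulas (on every Kripke structure). -/
def FormEquiv (φ ψ : PDLFormula) : Prop :=
  ∀ (W : Type) (K : Kripke W ℕ ℕ) (w : W), φ.sat K w ↔ ψ.sat K w

/-- Semantic equivalence of programs (on every Kripke structure). -/
def ProgEquiv (π ρ : PDLProgram) : Prop :=
  ∀ (W : Type) (K : Kripke W ℕ ℕ) (u v : W), π.rel K u v ↔ ρ.rel K u v

/-! ## Graphs (undirected, possibly with self-loops), tree decompositions -/

/-- An undirected graph (self-loop edges are allowed; `adj` is intended symmetric). -/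
structure UGraph (V : Type) where
  verts : Set V
  adj : V → V → Prop

/-- Connectedness of a graph. -/
def UGraph.Connected {V : Type} (G : UGraph V) : Prop :=
  G.verts.Nonempty ∧ ∀ x ∈ G.verts, ∀ y ∈ G.verts, Relation.ReflTransGen G.adj x y

/-- Graph isomorphism (between graphs on possibly different vertex types). -/
def UGraph.Iso {V V' : Type} (G : UGraph V) (H : UGraph V') : Prop :=
  ∃ f : V → V', Set.BijOn f G.verts H.verts ∧
    ∀ x ∈ G.verts, ∀ y ∈ G.verts, (G.adj x y ↔ H.adj (f x) (f y))

/-- A tree decomposition of a (possibly infinite) graph. -/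
structure TreeDecomp {V : Type} (G : UGraph V) where
  ι : Type
  T : SimpleGraph ι
  isTree : T.IsTree
  bag : ι → Set V
  cov_vert : ∀ v ∈ G.verts, ∃ b, v ∈ bag b
  cov_edge : ∀ x y, G.adj x y → ∃ b, x ∈ bag b ∧ y ∈ bag b
  conn : ∀ (v : V) (b b' : ι), v ∈ bag b → v ∈ bag b' →
    Relation.ReflTransGen (fun c c' => T.Adj c c' ∧ v ∈ bag c ∧ v ∈ bag c') b b'

/-- The decomposition has width ≤ k (all bags have at most k+1 elements). -/
def TreeDecomp.WidthLE {V : Type} {G : UGraph V} (td : TreeDecomp G) (k : ℕ) : Prop :=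
  ∀ b, (td.bag b).Finite ∧ (td.bag b).ncard ≤ k + 1

/-- The graph has tree-width ≤ k. -/
def UGraph.TreewidthLE {V : Type} (G : UGraph V) (k : ℕ) : Prop :=
  ∃ td : TreeDecomp G, td.WidthLE k

/-- `TWₖ`: the class of finite graphs of tree-width at most `k`. -/
def TWClass (k : ℕ) : Set (UGraph ℕ) :=
  {G | G.verts.Finite ∧ G.TreewidthLE k}

/-! ## Underlying graphs of conjunctive programs, fragments -/

/-- The list of atoms `(π, x, y)` of `C`. -/
def AtomList.toList : AtomList → List (PDLProgram × ℕ × ℕ)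
  | .nil => []
  | .acons π x y C => (π, x, y) :: C.toList

/-- The variables occurring in `C`. -/
def AtomList.vars (C : AtomList) : Set ℕ :=
  {z | ∃ e ∈ C.toList, z = e.2.1 ∨ z = e.2.2}

/-- The underlying graph `G_C` of a set of atoms `C`. -/
def AtomList.graphC (C : AtomList) : UGraph ℕ where
  verts := C.vars
  adj x y := ∃ e ∈ C.toList, (x = e.2.1 ∧ y = e.2.2) ∨ (x = e.2.2 ∧ y = e.2.1)

/-- The underlying graph `G_{C[x_s,x_t]}`: `G_C` together with the edge `{x_s,x_t}`. -/
def cprogGraph (C : AtomList) (xs xt : ℕ) : UGraph ℕ where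
  verts := C.vars
  adj x y := C.graphC.adj x y ∨ (x = xs ∧ y = xt) ∨ (x = xt ∧ y = xs)

mutual
  /-- Syntactic fragment predicate: `L` allows `loop`, `I` allows `∩`, `N` allows `¬`,
  and every conjunctive program must be well-formed with underlying graph in
  (isomorphic to a member of) the class `𝒢`. -/
  def PDLFormula.OK (L I N : Bool) (𝒢 : Set (UGraph ℕ)) : PDLFormula → Prop
    | .prop _ => True
    | .neg φ => N = true ∧ PDLFormula.OK L I N 𝒢 φ
    | .conj φ ψ => PDLFormula.OK L I N 𝒢 φ ∧ PDLFormula.OK L I N 𝒢 ψ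
    | .diam π => PDLProgram.OK L I N 𝒢 π
    | .floop π => L = true ∧ PDLProgram.OK L I N 𝒢 π
  def PDLProgram.OK (L I N : Bool) (𝒢 : Set (UGraph ℕ)) : PDLProgram → Prop
    | .eps => True
    | .atom _ => True
    | .conv _ => True
    | .punion π ρ => PDLProgram.OK L I N 𝒢 π ∧ PDLProgram.OK L I N 𝒢 ρ
    | .comp π ρ => PDLProgram.OK L I N 𝒢 π ∧ PDLProgram.OK L I N 𝒢 ρ
    | .star π => PDLProgram.OK L I N 𝒢 π
    | .test φ => PDLFormula.OK L I N 𝒢 φ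
    | .inter π ρ => I = true ∧ PDLProgram.OK L I N 𝒢 π ∧ PDLProgram.OK L I N 𝒢 ρ
    | .cprog C xs xt =>
        xs ∈ C.vars ∧ xt ∈ C.vars ∧ (C.graphC).Connected ∧
        (∃ H ∈ 𝒢, (cprogGraph C xs xt).Iso H) ∧ AtomList.OK L I N 𝒢 C
  def AtomList.OK (L I N : Bool) (𝒢 : Set (UGraph ℕ)) : AtomList → Prop
    | .nil => True
    | .acons π _ _ C => PDLProgram.OK L I N 𝒢 π ∧ AtomList.OK L I N 𝒢 C
end

/-- The class of all graphs (no restriction on conjunctive programs). -/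
def FullClass : Set (UGraph ℕ) := Set.univ

/-- The single-vertex graph with a self-loop. -/
def loopGraph : UGraph ℕ := ⟨{0}, fun x y => x = 0 ∧ y = 0⟩

/-- The two-vertex graph with one edge. -/
def capGraph : UGraph ℕ := ⟨{0, 1}, fun x y => (x = 0 ∧ y = 1) ∨ (x = 1 ∧ y = 0)⟩

def GraphLoopClass : Set (UGraph ℕ) := {loopGraph}
def GraphCapClass : Set (UGraph ℕ) := {capGraph}

/-- `CPDL+` formulas: no loop, no intersection, arbitrary conjunctive programs. -/
def IsCPDLPlusFormula (φ : PDLFormula) : Prop := PDLFormula.OK false false true FullClass φ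
def IsCPDLPlusProgram (π : PDLProgram) : Prop := PDLProgram.OK false false true FullClass π
/-- `ICPDL+` formulas: intersection plus arbitrary conjunctive programs. -/
def IsICPDLPlusFormula (φ : PDLFormula) : Prop := PDLFormula.OK false true true FullClass φ
def IsICPDLPlusProgram (π : PDLProgram) : Prop := PDLProgram.OK false true true FullClass π
/-- `ICPDL` formulas: intersection, no conjunctive programs. -/
def IsICPDLFormula (φ : PDLFormula) : Prop := PDLFormula.OK false true true ∅ φ
def IsICPDLProgram (π : PDLProgram) : Prop := PDLProgram.OK false true true ∅ π

/-! ## Underlying graph / tree-width of Kripke structures -/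

/-- `u` is at distance ≤ 1 from `v` in (the underlying undirected graph of) `K`. -/
def Kripke.Near {W P A : Type} (K : Kripke W P A) (u v : W) : Prop :=
  u = v ∨ ∃ a, K.rel a u v ∨ K.rel a v u

/-- The underlying undirected graph of a Kripke structure. -/
def Kripke.graph {W P A : Type} (K : Kripke W P A) : UGraph W :=
  ⟨Set.univ, fun u v => ∃ a, K.rel a u v ∨ K.rel a v u⟩

/-- A Kripke structure has tree-width ≤ k. -/
def Kripke.TreewidthLE {W P A : Type} (K : Kripke W P A) (k : ℕ) : Prop :=
  K.graph.TreewidthLE k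

/-- Every world has finitely many neighbours at distance ≤ 1. -/
def Kripke.FiniteDegree {W P A : Type} (K : Kripke W P A) : Prop :=
  ∀ u : W, {v | K.Near u v}.Finite


mutual
  /-- A concrete (computable by construction) encoding of formulas into `ℕ`. -/
  def PDLFormula.enc : PDLFormula → ℕ
    | .prop p => Nat.pair 0 p
    | .neg φ => Nat.pair 1 φ.enc
    | .conj φ ψ => Nat.pair 2 (Nat.pair φ.enc ψ.enc)
    | .diam π => Nat.pair 3 π.enc
    | .floop π => Nat.pair 4 π.enc
  termination_by φ => sizeOf φ
  def PDLProgram.enc : PDLProgram → ℕ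
    | .eps => Nat.pair 5 0
    | .atom a => Nat.pair 6 a
    | .conv a => Nat.pair 7 a
    | .punion π ρ => Nat.pair 8 (Nat.pair π.enc ρ.enc)
    | .comp π ρ => Nat.pair 9 (Nat.pair π.enc ρ.enc)
    | .star π => Nat.pair 10 π.enc
    | .test φ => Nat.pair 11 φ.enc
    | .inter π ρ => Nat.pair 12 (Nat.pair π.enc ρ.enc)
    | .cprog C xs xt => Nat.pair 13 (Nat.pair C.enc (Nat.pair xs xt))
  termination_by π => sizeOf π
  def AtomList.enc : AtomList → ℕ
    | .nil => Nat.pair 14 0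
    | .acons π x y C => Nat.pair 15 (Nat.pair π.enc (Nat.pair x (Nat.pair y C.enc)))
  termination_by C => sizeOf C
end

set_option linter.unusedVariables false
set_option linter.unusedSimpArgs false

/-! ### Part A : reduced codes -/

/-- the two-point environment -/
def pe {V : Type} (u v : V) : ℕ → V := fun i => if i = 0 then u else v

theorem pe_comp {V V' : Type} (F : V → V') (u v : V) : (fun i => F (pe u v i)) = pe (F u) (F v) := by
  funext i; unfold pe; split <;> rfl
@[simp] theorem pe_zero {V : Type} (u v : V) : pe u v 0 = u := rfl
@[simp] theorem pe_one {V : Type} (u v : V) : pe u v 1 = v := rfl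
theorem pe_all {V : Type} {P : V → Prop} {u v : V} (hu : P u) (hv : P v) (i : ℕ) : P (pe u v i) := by
  unfold pe; split <;> assumption

/-- reduced codes -/
inductive Cd : Type where
  | bot : Cd
  | tr : Cd
  | ed : ℕ → Cd
  | lb : ℕ → Cd
  | or : Cd → Cd → Cd
  | star : Cd → Cd
  | cpr : Cd → ℕ → ℕ → Cd
  | cons : Cd → ℕ → ℕ → Cd → Cd

/-- semantics of codes relativised to `U` -/
def lsem {V : Type} (U : V → Prop) (M : Kripke V ℕ ℕ) : Cd → (ℕ → V) → Prop
  | .bot, _ => False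
  | .tr, _ => True
  | .ed a, e => M.rel a (e 0) (e 1)
  | .lb r, e => M.val r (e 0)
  | .or c d, e => lsem U M c e ∨ lsem U M d e
  | .star c, e => Relation.ReflTransGen (fun a b => U b ∧ lsem U M c (pe a b)) (e 0) (e 1)
  | .cpr C s t, e => ∃ f : ℕ → V, (∀ i, U (f i)) ∧ f s = e 0 ∧ f t = e 1 ∧ lsem U M C f
  | .cons c x y C, e => lsem U M c (pe (e x) (e y)) ∧ lsem U M C e

/-- all indices bounded by `N` -/
def Cd.bd (N : ℕ) : Cd → Prop
  | .bot => True
  | .tr => True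
  | .ed a => a ≤ N
  | .lb r => r ≤ N
  | .or c d => c.bd N ∧ d.bd N
  | .star c => c.bd N
  | .cpr C s t => C.bd N ∧ s ≤ N ∧ t ≤ N
  | .cons c x y C => c.bd N ∧ x ≤ N ∧ y ≤ N ∧ C.bd N

def Cd.size : Cd → ℕ
  | .bot => 1
  | .tr => 1
  | .ed _ => 1
  | .lb _ => 1
  | .or c d => c.size + d.size + 1
  | .star c => c.size + 1
  | .cpr C _ _ => C.size + 1
  | .cons c _ _ C => c.size + C.size + 1

theorem lsem_hom {V V' : Type} {U : V → Prop} {M : Kripke V ℕ ℕ} {U' : V' → Prop}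
    {M' : Kripke V' ℕ ℕ} {N : ℕ} (F : V → V') (hU : ∀ v, U v → U' (F v))
    (hr : ∀ a ≤ N, ∀ u v, U u → U v → M.rel a u v → M'.rel a (F u) (F v))
    (hv : ∀ a ≤ N, ∀ u, U u → M.val a u → M'.val a (F u)) :
    ∀ (c : Cd), c.bd N → ∀ (e : ℕ → V), (∀ i, U (e i)) → lsem U M c e →
      lsem U' M' c (fun i => F (e i)) := by
  intro c
  induction c with
  | bot => intro _ e _ h; exact h
  | tr => intro _ e _ h; trivial
  | ed a => intro hb e he h; exact hr a hb _ _ (he 0) (he 1) h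
  | lb r => intro hb e he h; exact hv r hb _ (he 0) h
  | or c d ihc ihd =>
    intro hb e he h
    exact h.imp (ihc hb.1 e he) (ihd hb.2 e he)
  | star c ih =>
    intro hb e he h
    have key : ∀ u v, U u → Relation.ReflTransGen (fun a b => U b ∧ lsem U M c (pe a b)) u v →
        U v ∧ Relation.ReflTransGen (fun a b => U' b ∧ lsem U' M' c (pe a b)) (F u) (F v) := by
      intro u v hu h
      induction h with
      | refl => exact ⟨hu, .refl⟩
      | tail _ h1 ih1 =>
        refine ⟨h1.1, ih1.2.tail ⟨hU _ h1.1, ?_⟩⟩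
        have := ih hb _ (pe_all ih1.1 h1.1) h1.2
        rwa [pe_comp] at this
    exact (key _ _ (he 0) h).2
  | cpr C s t ih =>
    rintro hb e he ⟨f, hf, h1, h2, h3⟩
    exact ⟨fun i => F (f i), fun i => hU _ (hf i), by simp [h1], by simp [h2], ih hb.1 f hf h3⟩
  | cons c x y C ihc ihC =>
    rintro hb e he ⟨h1, h2⟩
    refine ⟨?_, ihC hb.2.2.2 e he h2⟩
    have := ihc hb.1 _ (pe_all (he x) (he y)) h1
    rwa [pe_comp] at this

theorem lsem_congr_env {V : Type} {U : V → Prop} {M : Kripke V ℕ ℕ} {N : ℕ} (hN : 1 ≤ N) :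
    ∀ (c : Cd), c.bd N → ∀ (e e' : ℕ → V), (∀ i ≤ N, e i = e' i) → lsem U M c e →
      lsem U M c e' := by
  intro c
  induction c with
  | bot => intro _ e e' _ h; exact h
  | tr => intro _ e e' _ h; trivial
  | ed a => intro hb e e' he h; simpa only [lsem, ← he 0 (by omega), ← he 1 hN] using h
  | lb r => intro hb e e' he h; simpa only [lsem, ← he 0 (by omega), ← he 1 hN] using h
  | or c d ihc ihd =>
    intro hb e e' he h
    exact h.imp (ihc hb.1 e e' he) (ihd hb.2 e e' he)
  | star c ih => intro hb e e' he h; simpa only [lsem, ← he 0 (by omega), ← he 1 hN] using h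
  | cpr C s t ih => intro hb e e' he h; simpa only [lsem, ← he 0 (by omega), ← he 1 hN] using h
  | cons c x y C ihc ihC =>
    rintro hb e e' he ⟨h1, h2⟩
    refine ⟨?_, ihC hb.2.2.2 e e' he h2⟩
    rwa [← he x hb.2.1, ← he y hb.2.2.1]

/-- congruence in the structure (labels/relations bounded) -/
theorem lsem_congr {V : Type} {M M' : Kripke V ℕ ℕ} {N : ℕ}
    (hr : ∀ a ≤ N, ∀ u v, M.rel a u v ↔ M'.rel a u v)
    (hv : ∀ a ≤ N, ∀ u, M.val a u ↔ M'.val a u) (c : Cd) (hc : c.bd N) (e : ℕ → V) :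
    lsem (fun _ => True) M c e ↔ lsem (fun _ => True) M' c e :=
  ⟨lsem_hom (U := fun _ => True) (U' := fun _ => True) id (fun _ h => h)
      (fun a ha u v _ _ => (hr a ha u v).1) (fun a ha u _ => (hv a ha u).1) c hc e (fun _ => trivial),
   lsem_hom (U := fun _ => True) (U' := fun _ => True) id (fun _ h => h)
      (fun a ha u v _ _ => (hr a ha u v).2) (fun a ha u _ => (hv a ha u).2) c hc e (fun _ => trivial)⟩

theorem lsem_compact {V : Type} {M : Kripke V ℕ ℕ} {N : ℕ} (hN : 1 ≤ N) (ℓ : V → ℕ) :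
    ∀ (c : Cd), c.bd N → ∀ (e : ℕ → V), lsem (fun _ => True) M c e →
      ∃ d0, ∀ d, d0 ≤ d → lsem (fun v => ℓ v < d) M c e := by
  intro c
  induction c with
  | bot => intro _ e h; exact h.elim
  | tr => intro _ e h; exact ⟨0, fun _ _ => trivial⟩
  | ed a => intro _ e h; exact ⟨0, fun _ _ => h⟩
  | lb a => intro _ e h; exact ⟨0, fun _ _ => h⟩
  | or c d ihc ihd =>
    rintro hb e (h | h)
    · obtain ⟨d0, h0⟩ := ihc hb.1 e h
      exact ⟨d0, fun d hd => Or.inl (h0 d hd)⟩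
    · obtain ⟨d0, h0⟩ := ihd hb.2 e h
      exact ⟨d0, fun d hd => Or.inr (h0 d hd)⟩
  | star c ih =>
    intro hb e h
    simp only [lsem] at h ⊢
    generalize e 1 = z at h ⊢
    induction h with
    | refl => exact ⟨0, fun _ _ => .refl⟩
    | @tail b z _ h1 ih1 =>
      obtain ⟨d0, h0⟩ := ih1
      obtain ⟨d1, h2⟩ := ih hb _ h1.2
      refine ⟨max (max d0 d1) (ℓ z + 1), fun d hd => (h0 d (by omega)).tail ⟨by omega, h2 d (by omega)⟩⟩
  | cpr C s t ih =>
    rintro hb e ⟨f, hf, h1, h2, h3⟩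
    let f' : ℕ → V := fun i => if i ≤ N then f i else f 0
    have h4 : lsem (fun _ => True) M C f' :=
      lsem_congr_env hN C hb.1 f f' (fun i hi => by simp [f', hi]) h3
    obtain ⟨d0, h0⟩ := ih hb.1 f' h4
    refine ⟨max d0 ((Finset.range (N+1)).sup (fun i => ℓ (f i)) + 1), fun d hd =>
      ⟨f', ?_, ?_, ?_, h0 d (by omega)⟩⟩
    · intro i
      have key : ∀ i ≤ N, ℓ (f i) < d := by
        intro i hi
        have := Finset.le_sup (f := fun i => ℓ (f i)) (Finset.mem_range.2 (show i < N + 1 by omega))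

        omega
      by_cases hi : i ≤ N
      · simpa [f', hi] using key i hi
      · simpa [f', hi] using key 0 (by omega)
    · simp [f', hb.2.1, h1]
    · simp [f', hb.2.2, h2]
  | cons c x y C ihc ihC =>
    rintro hb e ⟨h1, h2⟩
    obtain ⟨d0, h0⟩ := ihc hb.1 _ h1
    obtain ⟨d1, h3⟩ := ihC hb.2.2.2 _ h2
    exact ⟨max d0 d1, fun d hd => ⟨h0 d (by omega), h3 d (by omega)⟩⟩

theorem snd_le (k : ℕ) : k.unpair.1 + k.unpair.2 ≤ k := by
  have := Nat.add_le_pair k.unpair.1 k.unpair.2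
  rwa [Nat.pair_unpair] at this

/-- decoding of numbers -/
def dec (k : ℕ) : Cd :=
  if h : k.unpair.1 < 5 then .bot else
  have h1 := snd_le k
  have h2 := snd_le k.unpair.2
  have h3 := snd_le k.unpair.2.unpair.2
  have h4 := snd_le k.unpair.2.unpair.2.unpair.2
  match k.unpair.1 with
  | 5 => .cpr .tr 0 0
  | 6 => .ed k.unpair.2
  | 7 => .cpr (.cons (.ed k.unpair.2) 1 0 .tr) 0 1
  | 8 => .or (dec k.unpair.2.unpair.1) (dec k.unpair.2.unpair.2)
  | 9 => .cpr (.cons (dec k.unpair.2.unpair.1) 0 2 (.cons (dec k.unpair.2.unpair.2) 2 1 .tr)) 0 1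
  | 10 => .star (dec k.unpair.2)
  | 11 => .cpr (.cons (.lb k.unpair.2) 0 0 .tr) 0 0
  | 12 => .cpr (.cons (dec k.unpair.2.unpair.1) 0 1 (.cons (dec k.unpair.2.unpair.2) 0 1 .tr)) 0 1
  | 13 => .cpr (dec k.unpair.2.unpair.1) k.unpair.2.unpair.2.unpair.1 k.unpair.2.unpair.2.unpair.2
  | 14 => .tr
  | 15 => .cons (dec k.unpair.2.unpair.1) k.unpair.2.unpair.2.unpair.1
      k.unpair.2.unpair.2.unpair.2.unpair.1 (dec k.unpair.2.unpair.2.unpair.2.unpair.2)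
  | _ => .bot
termination_by k
decreasing_by all_goals omega

theorem dec_bot {k : ℕ} (h : k.unpair.1 < 5 ∨ 15 < k.unpair.1) : dec k = .bot := by
  rw [dec]
  split
  · rfl
  · split <;> first | rfl | omega
theorem dec5 (r : ℕ) : dec (Nat.pair 5 r) = .cpr .tr 0 0 := by rw [dec]; simp
theorem dec6 (r : ℕ) : dec (Nat.pair 6 r) = .ed r := by rw [dec]; simp
theorem dec7 (r : ℕ) : dec (Nat.pair 7 r) = .cpr (.cons (.ed r) 1 0 .tr) 0 1 := by rw [dec]; simp
theorem dec8 (r s : ℕ) : dec (Nat.pair 8 (Nat.pair r s)) = .or (dec r) (dec s) := by rw [dec]; simp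
theorem dec9 (r s : ℕ) : dec (Nat.pair 9 (Nat.pair r s)) =
    .cpr (.cons (dec r) 0 2 (.cons (dec s) 2 1 .tr)) 0 1 := by rw [dec]; simp
theorem dec10 (r : ℕ) : dec (Nat.pair 10 r) = .star (dec r) := by rw [dec]; simp
theorem dec11 (r : ℕ) : dec (Nat.pair 11 r) = .cpr (.cons (.lb r) 0 0 .tr) 0 0 := by rw [dec]; simp
theorem dec12 (r s : ℕ) : dec (Nat.pair 12 (Nat.pair r s)) =
    .cpr (.cons (dec r) 0 1 (.cons (dec s) 0 1 .tr)) 0 1 := by rw [dec]; simp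
theorem dec13 (C s t : ℕ) : dec (Nat.pair 13 (Nat.pair C (Nat.pair s t))) = .cpr (dec C) s t := by
  rw [dec]; simp
theorem dec14 (r : ℕ) : dec (Nat.pair 14 r) = .tr := by rw [dec]; simp
theorem dec15 (c x y C : ℕ) :
    dec (Nat.pair 15 (Nat.pair c (Nat.pair x (Nat.pair y C)))) = .cons (dec c) x y (dec C) := by
  rw [dec]; simp

/-- code induction -/
theorem code_ind {P : ℕ → Prop} (h0 : ∀ k, (k.unpair.1 < 5 ∨ 15 < k.unpair.1) → P k)
    (h5 : ∀ r, P (Nat.pair 5 r)) (h6 : ∀ r, P (Nat.pair 6 r)) (h7 : ∀ r, P (Nat.pair 7 r))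
    (h8 : ∀ r s, P r → P s → P (Nat.pair 8 (Nat.pair r s)))
    (h9 : ∀ r s, P r → P s → P (Nat.pair 9 (Nat.pair r s)))
    (h10 : ∀ r, P r → P (Nat.pair 10 r)) (h11 : ∀ r, P (Nat.pair 11 r))
    (h12 : ∀ r s, P r → P s → P (Nat.pair 12 (Nat.pair r s)))
    (h13 : ∀ C s t, P C → P (Nat.pair 13 (Nat.pair C (Nat.pair s t))))
    (h14 : ∀ r, P (Nat.pair 14 r))
    (h15 : ∀ c x y C, P c → P C → P (Nat.pair 15 (Nat.pair c (Nat.pair x (Nat.pair y C)))))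
    (k : ℕ) : P k := by
  induction k using Nat.strong_induction_on with
  | _ k ih =>
    by_cases hk : k.unpair.1 < 5 ∨ 15 < k.unpair.1
    · exact h0 k hk
    have e1 := snd_le k
    have e2 := snd_le k.unpair.2
    have e3 := snd_le k.unpair.2.unpair.2
    have e4 := snd_le k.unpair.2.unpair.2.unpair.2
    have hp := Nat.pair_unpair k
    have hp2 := Nat.pair_unpair k.unpair.2
    have hp3 := Nat.pair_unpair k.unpair.2.unpair.2
    have hp4 := Nat.pair_unpair k.unpair.2.unpair.2.unpair.2
    have a1 : P k.unpair.2 := ih _ (by omega)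
    have a2 : P k.unpair.2.unpair.1 := ih _ (by omega)
    have a3 : P k.unpair.2.unpair.2 := ih _ (by omega)
    have a4 : P k.unpair.2.unpair.2.unpair.2.unpair.2 := ih _ (by omega)
    obtain h | h | h | h | h | h | h | h | h | h | h : k.unpair.1 = 5 ∨ k.unpair.1 = 6 ∨ k.unpair.1 = 7 ∨ k.unpair.1 = 8 ∨
      k.unpair.1 = 9 ∨ k.unpair.1 = 10 ∨ k.unpair.1 = 11 ∨ k.unpair.1 = 12 ∨ k.unpair.1 = 13 ∨
      k.unpair.1 = 14 ∨ k.unpair.1 = 15 := by omega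
    · rw [← hp, h]; exact h5 _
    · rw [← hp, h]; exact h6 _
    · rw [← hp, h]; exact h7 _
    · rw [← hp, h, ← hp2]; exact h8 _ _ a2 a3
    · rw [← hp, h, ← hp2]; exact h9 _ _ a2 a3
    · rw [← hp, h]; exact h10 _ a1
    · rw [← hp, h]; exact h11 _
    · rw [← hp, h, ← hp2]; exact h12 _ _ a2 a3
    · rw [← hp, h, ← hp2, ← hp3]; exact h13 _ _ _ a2
    · rw [← hp, h]; exact h14 _
    · rw [← hp, h, ← hp2, ← hp3, ← hp4]; exact h15 _ _ _ _ a2 a4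

theorem Cd.bd_mono {N N' : ℕ} (h : N ≤ N') : ∀ c : Cd, c.bd N → c.bd N' := by
  intro c
  induction c <;> simp only [Cd.bd] <;> intros <;> grind

theorem dec_bd (k : ℕ) : (dec k).bd (k + 2) := by
  induction k using code_ind with
  | h0 k h => rw [dec_bot h]; trivial
  | h5 r => rw [dec5]; simp [Cd.bd]
  | h6 r => have := Nat.add_le_pair 6 r; rw [dec6]; simp only [Cd.bd, true_and, and_true]; omega
  | h7 r => have := Nat.add_le_pair 7 r; rw [dec7]; simp only [Cd.bd, true_and, and_true]; omega
  | h8 r s hr hs =>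
    have := Nat.add_le_pair 8 (Nat.pair r s); have := Nat.add_le_pair r s
    rw [dec8]; exact ⟨Cd.bd_mono (by omega) _ hr, Cd.bd_mono (by omega) _ hs⟩
  | h9 r s hr hs =>
    have := Nat.add_le_pair 9 (Nat.pair r s); have := Nat.add_le_pair r s
    rw [dec9]
    have h1 := Cd.bd_mono (N' := Nat.pair 9 (Nat.pair r s) + 2) (by omega) _ hr
    have h2 := Cd.bd_mono (N' := Nat.pair 9 (Nat.pair r s) + 2) (by omega) _ hs
    simp only [Cd.bd, h1, h2, true_and, and_true]; omega
  | h10 r hr =>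
    have := Nat.add_le_pair 10 r
    rw [dec10]; exact Cd.bd_mono (by omega) _ hr
  | h11 r => have := Nat.add_le_pair 11 r; rw [dec11]; simp only [Cd.bd, true_and, and_true]; omega
  | h12 r s hr hs =>
    have := Nat.add_le_pair 12 (Nat.pair r s); have := Nat.add_le_pair r s
    rw [dec12]
    have h1 := Cd.bd_mono (N' := Nat.pair 12 (Nat.pair r s) + 2) (by omega) _ hr
    have h2 := Cd.bd_mono (N' := Nat.pair 12 (Nat.pair r s) + 2) (by omega) _ hs
    simp only [Cd.bd, h1, h2, true_and, and_true]; omega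
  | h13 C s t hC =>
    have := Nat.add_le_pair 13 (Nat.pair C (Nat.pair s t)); have := Nat.add_le_pair C (Nat.pair s t)
    have := Nat.add_le_pair s t
    rw [dec13]; exact ⟨Cd.bd_mono (by omega) _ hC, by omega, by omega⟩
  | h14 r => rw [dec14]; trivial
  | h15 c x y C hc hC =>
    have := Nat.add_le_pair 15 (Nat.pair c (Nat.pair x (Nat.pair y C)))
    have := Nat.add_le_pair c (Nat.pair x (Nat.pair y C))
    have := Nat.add_le_pair x (Nat.pair y C)
    have := Nat.add_le_pair y C
    rw [dec15]
    exact ⟨Cd.bd_mono (by omega) _ hc, by omega, by omega, Cd.bd_mono (by omega) _ hC⟩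

theorem dec_size (k : ℕ) : (dec k).size ≤ k + 1 := by
  induction k using code_ind with
  | h0 k h => rw [dec_bot h]; simp [Cd.size]
  | h5 r => have := Nat.add_le_pair 5 r; rw [dec5]; simp only [Cd.size]; omega
  | h6 r => rw [dec6]; simp [Cd.size]
  | h7 r => have := Nat.add_le_pair 7 r; rw [dec7]; simp only [Cd.size]; omega
  | h8 r s hr hs =>
    have := Nat.add_le_pair 8 (Nat.pair r s); have := Nat.add_le_pair r s
    rw [dec8]; simp only [Cd.size]; omega
  | h9 r s hr hs =>
    have := Nat.add_le_pair 9 (Nat.pair r s); have := Nat.add_le_pair r s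
    rw [dec9]; simp only [Cd.size]; omega
  | h10 r hr => have := Nat.add_le_pair 10 r; rw [dec10]; simp only [Cd.size]; omega
  | h11 r => have := Nat.add_le_pair 11 r; rw [dec11]; simp only [Cd.size]; omega
  | h12 r s hr hs =>
    have := Nat.add_le_pair 12 (Nat.pair r s); have := Nat.add_le_pair r s
    rw [dec12]; simp only [Cd.size]; omega
  | h13 C s t hC =>
    have := Nat.add_le_pair 13 (Nat.pair C (Nat.pair s t)); have := Nat.add_le_pair C (Nat.pair s t)
    rw [dec13]; simp only [Cd.size]; omega
  | h14 r => rw [dec14]; simp [Cd.size]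
  | h15 c x y C hc hC =>
    have := Nat.add_le_pair 15 (Nat.pair c (Nat.pair x (Nat.pair y C)))
    have := Nat.add_le_pair c (Nat.pair x (Nat.pair y C))
    have := Nat.add_le_pair x (Nat.pair y C)
    have := Nat.add_le_pair y C
    rw [dec15]; simp only [Cd.size]; omega

/-- consistency of the labels -/
def Good {V : Type} (n : ℕ) (M : Kripke V ℕ ℕ) : Prop :=
  (∀ k v, Nat.pair 1 k ≤ n → (M.val (Nat.pair 1 k) v ↔ ¬ M.val k v)) ∧
  (∀ k l v, Nat.pair 2 (Nat.pair k l) ≤ n →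
    (M.val (Nat.pair 2 (Nat.pair k l)) v ↔ (M.val k v ∧ M.val l v))) ∧
  (∀ k v, Nat.pair 3 k ≤ n →
    (M.val (Nat.pair 3 k) v ↔ ∃ y, lsem (fun _ => True) M (dec k) (pe v y))) ∧
  (∀ k v, Nat.pair 4 k ≤ n →
    (M.val (Nat.pair 4 k) v ↔ lsem (fun _ => True) M (dec k) (pe v v)))

section clauses
variable {V : Type} {U : V → Prop} {M : Kripke V ℕ ℕ} {e : ℕ → V}

theorem ls0 {k : ℕ} (h : k.unpair.1 < 5 ∨ 15 < k.unpair.1) : lsem U M (dec k) e ↔ False := by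
  rw [dec_bot h]; rfl
theorem ls5 (r : ℕ) (he : U (e 0)) : lsem U M (dec (Nat.pair 5 r)) e ↔ e 0 = e 1 := by
  rw [dec5]
  constructor
  · rintro ⟨f, _, h1, h2, _⟩; rw [← h1, ← h2]
  · intro h; exact ⟨fun _ => e 0, fun _ => he, rfl, h, trivial⟩
theorem ls6 (r : ℕ) : lsem U M (dec (Nat.pair 6 r)) e ↔ M.rel r (e 0) (e 1) := by
  rw [dec6]; rfl
theorem ls7 (r : ℕ) (he : ∀ i, U (e i)) :
    lsem U M (dec (Nat.pair 7 r)) e ↔ M.rel r (e 1) (e 0) := by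
  rw [dec7]
  constructor
  · rintro ⟨f, _, h1, h2, h3⟩; rw [← h1, ← h2]; exact h3.1
  · intro h; exact ⟨e, he, rfl, rfl, h, trivial⟩
theorem ls8 (r s : ℕ) : lsem U M (dec (Nat.pair 8 (Nat.pair r s))) e ↔
    (lsem U M (dec r) e ∨ lsem U M (dec s) e) := by
  rw [dec8]; rfl
theorem ls9 (r s : ℕ) (he : ∀ i, U (e i)) : lsem U M (dec (Nat.pair 9 (Nat.pair r s))) e ↔
    ∃ z, U z ∧ lsem U M (dec r) (pe (e 0) z) ∧ lsem U M (dec s) (pe z (e 1)) := by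
  rw [dec9]
  constructor
  · rintro ⟨f, hf, h1, h2, h3, h4, _⟩; exact ⟨f 2, hf 2, by rw [← h1]; exact h3, by rw [← h2]; exact h4⟩
  · rintro ⟨z, hz, h1, h2⟩
    refine ⟨fun i => if i = 2 then z else e i, fun i => ?_, rfl, rfl, h1, h2, trivial⟩
    dsimp only; split
    · exact hz
    · exact he i
theorem ls10 (r : ℕ) : lsem U M (dec (Nat.pair 10 r)) e ↔
    Relation.ReflTransGen (fun a b => U b ∧ lsem U M (dec r) (pe a b)) (e 0) (e 1) := by
  rw [dec10]; rfl
theorem ls11 (r : ℕ) (he : U (e 0)) : lsem U M (dec (Nat.pair 11 r)) e ↔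
    (e 0 = e 1 ∧ M.val r (e 0)) := by
  rw [dec11]
  constructor
  · rintro ⟨f, _, h1, h2, h3⟩; rw [← h1, ← h2]; exact ⟨rfl, h3.1⟩
  · rintro ⟨h, h'⟩; exact ⟨fun _ => e 0, fun _ => he, rfl, h, h', trivial⟩
theorem ls12 (r s : ℕ) (he : ∀ i, U (e i)) : lsem U M (dec (Nat.pair 12 (Nat.pair r s))) e ↔
    (lsem U M (dec r) (pe (e 0) (e 1)) ∧ lsem U M (dec s) (pe (e 0) (e 1))) := by
  rw [dec12]
  constructor
  · rintro ⟨f, hf, h1, h2, h3, h4, _⟩; rw [← h1, ← h2]; exact ⟨h3, h4⟩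
  · rintro ⟨h1, h2⟩
    exact ⟨e, he, rfl, rfl, h1, h2, trivial⟩
theorem ls13 (C s t : ℕ) : lsem U M (dec (Nat.pair 13 (Nat.pair C (Nat.pair s t)))) e ↔
    ∃ f : ℕ → V, (∀ i, U (f i)) ∧ f s = e 0 ∧ f t = e 1 ∧ lsem U M (dec C) f := by
  rw [dec13]; rfl
theorem ls14 (r : ℕ) : lsem U M (dec (Nat.pair 14 r)) e ↔ True := by
  rw [dec14]; rfl
theorem ls15 (c x y C : ℕ) :
    lsem U M (dec (Nat.pair 15 (Nat.pair c (Nat.pair x (Nat.pair y C))))) e ↔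
      (lsem U M (dec c) (pe (e x) (e y)) ∧ lsem U M (dec C) e) := by
  rw [dec15]; rfl
end clauses

theorem pe_eta {V : Type} (u v : V) : pe (pe u v 0) (pe u v 1) = pe u v := rfl

mutual
theorem satF {V : Type} {n : ℕ} {M : Kripke V ℕ ℕ} (hM : Good n M) : (φ : PDLFormula) → (v : V) →
    φ.enc ≤ n → (φ.sat ⟨M.rel, fun p => M.val (Nat.pair 0 p)⟩ v ↔ M.val φ.enc v)
  | .prop p, v, h => by simp [PDLFormula.sat, PDLFormula.enc]
  | .neg φ, v, h => by
    simp only [PDLFormula.sat, PDLFormula.enc] at h ⊢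
    have := Nat.add_le_pair 1 φ.enc
    rw [hM.1 _ _ h, satF hM φ v (by omega)]
  | .conj φ ψ, v, h => by
    simp only [PDLFormula.sat, PDLFormula.enc] at h ⊢
    have := Nat.add_le_pair 2 (Nat.pair φ.enc ψ.enc)
    have := Nat.add_le_pair φ.enc ψ.enc
    rw [hM.2.1 _ _ _ h, satF hM φ v (by omega), satF hM ψ v (by omega)]
  | .diam π, v, h => by
    simp only [PDLFormula.sat, PDLFormula.enc] at h ⊢
    have := Nat.add_le_pair 3 π.enc
    rw [hM.2.2.1 _ _ h]
    exact exists_congr fun y => satP hM π v y (by omega)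
  | .floop π, v, h => by
    simp only [PDLFormula.sat, PDLFormula.enc] at h ⊢
    have := Nat.add_le_pair 4 π.enc
    rw [hM.2.2.2 _ _ h]
    exact satP hM π v v (by omega)
termination_by φ _ _ => sizeOf φ
theorem satP {V : Type} {n : ℕ} {M : Kripke V ℕ ℕ} (hM : Good n M) : (π : PDLProgram) →
    (u v : V) → π.enc ≤ n → (π.rel ⟨M.rel, fun p => M.val (Nat.pair 0 p)⟩ u v ↔
      lsem (fun _ => True) M (dec π.enc) (pe u v))
  | .eps, u, v, h => by
    simp only [PDLProgram.rel, PDLProgram.enc]; rw [ls5 _ trivial]; rfl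
  | .atom a, u, v, h => by
    simp only [PDLProgram.rel, PDLProgram.enc]; rw [ls6]; rfl
  | .conv a, u, v, h => by
    simp only [PDLProgram.rel, PDLProgram.enc]; rw [ls7 _ (fun _ => trivial)]; rfl
  | .punion π ρ, u, v, h => by
    simp only [PDLProgram.rel, PDLProgram.enc] at h ⊢
    have := Nat.add_le_pair 8 (Nat.pair π.enc ρ.enc)
    have := Nat.add_le_pair π.enc ρ.enc
    rw [ls8, satP hM π u v (by omega), satP hM ρ u v (by omega)]
  | .comp π ρ, u, v, h => by
    simp only [PDLProgram.rel, PDLProgram.enc] at h ⊢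
    have := Nat.add_le_pair 9 (Nat.pair π.enc ρ.enc)
    have := Nat.add_le_pair π.enc ρ.enc
    rw [ls9 _ _ (fun _ => trivial)]
    refine exists_congr fun z => ?_
    rw [satP hM π u z (by omega), satP hM ρ z v (by omega)]
    simp
  | .star π, u, v, h => by
    simp only [PDLProgram.rel, PDLProgram.enc] at h ⊢
    have := Nat.add_le_pair 10 π.enc
    rw [ls10]
    have : (fun a b => PDLProgram.rel ⟨M.rel, fun p => M.val (Nat.pair 0 p)⟩ π a b) =
      (fun a b => True ∧ lsem (fun _ => True) M (dec π.enc) (pe a b)) := by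
      funext a b
      rw [satP hM π a b (by omega)]; simp
    rw [this]; rfl
  | .test φ, u, v, h => by
    simp only [PDLProgram.rel, PDLProgram.enc] at h ⊢
    have := Nat.add_le_pair 11 φ.enc
    rw [ls11 _ trivial, satF hM φ u (by omega)]; rfl
  | .inter π ρ, u, v, h => by
    simp only [PDLProgram.rel, PDLProgram.enc] at h ⊢
    have := Nat.add_le_pair 12 (Nat.pair π.enc ρ.enc)
    have := Nat.add_le_pair π.enc ρ.enc
    rw [ls12 _ _ (fun _ => trivial), satP hM π u v (by omega), satP hM ρ u v (by omega)]; rfl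
  | .cprog C s t, u, v, h => by
    simp only [PDLProgram.rel, PDLProgram.enc] at h ⊢
    have := Nat.add_le_pair 13 (Nat.pair C.enc (Nat.pair s t))
    have := Nat.add_le_pair C.enc (Nat.pair s t)
    rw [ls13]
    refine exists_congr fun f => ?_
    rw [satA hM C f (by omega)]; simp
termination_by π _ _ _ => sizeOf π
theorem satA {V : Type} {n : ℕ} {M : Kripke V ℕ ℕ} (hM : Good n M) : (C : AtomList) →
    (f : ℕ → V) → C.enc ≤ n → (C.sat ⟨M.rel, fun p => M.val (Nat.pair 0 p)⟩ f ↔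
      lsem (fun _ => True) M (dec C.enc) f)
  | .nil, f, h => by
    simp only [AtomList.sat, AtomList.enc]; rw [ls14]
  | .acons π x y C, f, h => by
    simp only [AtomList.sat, AtomList.enc] at h ⊢
    have := Nat.add_le_pair 15 (Nat.pair π.enc (Nat.pair x (Nat.pair y C.enc)))
    have := Nat.add_le_pair π.enc (Nat.pair x (Nat.pair y C.enc))
    have := Nat.add_le_pair x (Nat.pair y C.enc)
    have := Nat.add_le_pair y C.enc
    rw [ls15, satP hM π _ _ (by omega), satA hM C f (by omega)]
termination_by C _ _ => sizeOf C
end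

/-- one step of the canonical labelling -/
def vstep {V : Type} (K : Kripke V ℕ ℕ) (k : ℕ) (val : ℕ → V → Prop) (v : V) : Prop :=
  match k.unpair.1 with
  | 0 => K.val k.unpair.2 v
  | 1 => ¬ val k.unpair.2 v
  | 2 => val k.unpair.2.unpair.1 v ∧ val k.unpair.2.unpair.2 v
  | 3 => ∃ y, lsem (fun _ => True) ⟨K.rel, val⟩ (dec k.unpair.2) (pe v y)
  | 4 => lsem (fun _ => True) ⟨K.rel, val⟩ (dec k.unpair.2) (pe v v)
  | _ => False

def cval {V : Type} (K : Kripke V ℕ ℕ) (k : ℕ) (v : V) : Prop :=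
  vstep K k (fun j w => if h : j < k then cval K j w else False) v
termination_by k

theorem exists_good {V : Type} (K : Kripke V ℕ ℕ) : ∃ M : Kripke V ℕ ℕ, (∀ n, Good n M) ∧
    K = ⟨M.rel, fun p => M.val (Nat.pair 0 p)⟩ := by
  refine ⟨⟨K.rel, cval K⟩, fun n => ⟨?_, ?_, ?_, ?_⟩, ?_⟩
  · intro k v _
    have := Nat.add_le_pair 1 k
    have h : k < Nat.pair 1 k := by omega
    show cval K _ v ↔ _
    rw [cval]; simp [vstep, h]
  · intro k l v _
    have := Nat.add_le_pair 2 (Nat.pair k l)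
    have := Nat.add_le_pair k l
    have h : k < Nat.pair 2 (Nat.pair k l) := by omega
    have h' : l < Nat.pair 2 (Nat.pair k l) := by omega
    show cval K _ v ↔ _
    rw [cval]; simp [vstep, h, h']
  · intro k v _
    have := Nat.add_le_pair 3 k
    show cval K _ v ↔ _
    rw [cval]; simp only [vstep, Nat.unpair_pair]
    refine exists_congr fun y => lsem_congr (N := k + 2) ?_ (fun a ha u => ?_) _ (dec_bd k) _
    · intros; rfl
    have : a < Nat.pair 3 k := by omega
    simp [this]
  · intro k v _
    have := Nat.add_le_pair 4 k
    show cval K _ v ↔ _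
    rw [cval]; simp only [vstep, Nat.unpair_pair]
    refine lsem_congr (N := k + 2) ?_ (fun a ha u => ?_) _ (dec_bd k) _
    · intros; rfl
    have : a < Nat.pair 4 k := by omega
    simp [this]
  · cases K with
    | mk r v =>
      congr
      funext p w
      simp [cval, vstep]

theorem sat_iff_good (φ : PDLFormula) :
    (∃ (W : Type) (K : Kripke W ℕ ℕ) (w : W), φ.sat K w) ↔
    (∃ (W : Type) (M : Kripke W ℕ ℕ) (w : W), Good φ.enc M ∧ M.val φ.enc w) := by
  constructor
  · rintro ⟨W, K, w, h⟩
    obtain ⟨M, hM, hK⟩ := exists_good K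
    refine ⟨W, M, w, hM _, ?_⟩
    rw [hK] at h
    exact (satF (hM _) φ w le_rfl).1 h
  · rintro ⟨W, M, w, hM, h⟩
    exact ⟨W, _, w, (satF hM φ w le_rfl).2 h⟩

/-! ### Part B : forests and the structures they denote -/

structure Alph where
  peb : ℕ → ℕ
  lab : ℕ → ℕ → Prop
  inn : ℕ → ℕ → ℕ → Prop
  out : ℕ → ℕ → ℕ → Prop

abbrev Pos := List Bool

/-- strict ancestor (forest order) -/
def Anc : Pos → Pos → Prop
  | [], false :: _ => True
  | b :: p, b' :: q => b = b' ∧ Anc p q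
  | _, _ => False

@[simp] theorem anc_nil_right (p : Pos) : Anc p [] ↔ False := by cases p <;> simp [Anc]
@[simp] theorem anc_nil_false (q : Pos) : Anc [] (false :: q) ↔ True := by simp [Anc]
@[simp] theorem anc_nil_true (q : Pos) : Anc [] (true :: q) ↔ False := by simp [Anc]
@[simp] theorem anc_cons (b b' : Bool) (p q : Pos) : Anc (b :: p) (b' :: q) ↔ (b = b' ∧ Anc p q) := by
  simp [Anc]

/-- no ancestor-or-self of `q` carries pebble `t` -/
def NoP (A : Alph) (L : Pos → ℕ) (t : ℕ) (q : Pos) : Prop :=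
  ∀ p, (Anc p q ∨ p = q) → A.peb (L p) ≠ t

/-- `p` is visible from `q` -/
def Vis (A : Alph) (L : Pos → ℕ) (p q : Pos) : Prop :=
  p = q ∨ (Anc p q ∧ ∀ p', Anc p p' → (Anc p' q ∨ p' = q) → A.peb (L p') ≠ A.peb (L p))

def TM (A : Alph) (L : Pos → ℕ) : Kripke Pos ℕ ℕ where
  rel a p q := (Vis A L p q ∧ A.inn (L q) a (A.peb (L p))) ∨
    (Vis A L q p ∧ A.out (L p) a (A.peb (L q)))
  val k p := A.lab (L p) k

theorem nop_nil {A : Alph} {L : Pos → ℕ} {t : ℕ} : NoP A L t [] ↔ A.peb (L []) ≠ t := by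
  simp [NoP]
theorem nop_false {A : Alph} {L : Pos → ℕ} {t : ℕ} {q : Pos} :
    NoP A L t (false :: q) ↔ (A.peb (L []) ≠ t ∧ NoP A (fun p => L (false :: p)) t q) := by
  constructor
  · intro h
    refine ⟨h [] (by simp), fun p hp => h (false :: p) (by simpa using hp)⟩
  · rintro ⟨h1, h2⟩ p hp
    cases p with
    | nil => exact h1
    | cons b p => 
      have hb : b = false := by simp at hp; tauto
      subst hb
      exact h2 p (by simpa using hp)
theorem nop_true {A : Alph} {L : Pos → ℕ} {t : ℕ} {q : Pos} :
    NoP A L t (true :: q) ↔ NoP A (fun p => L (true :: p)) t q := by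
  constructor
  · intro h
    refine fun p hp => h (true :: p) (by simpa using hp)
  · rintro h2 p hp
    cases p with
    | nil => simp at hp
    | cons b p => 
      have hb : b = true := by simp at hp; tauto
      subst hb
      exact h2 p (by simpa using hp)

theorem vis_cons {A : Alph} {L : Pos → ℕ} {b b' : Bool} {p q : Pos} :
    Vis A L (b :: p) (b' :: q) ↔ (b = b' ∧ Vis A (fun p => L (b :: p)) p q) := by
  constructor
  · rintro (h | ⟨h1, h2⟩)
    · simp at h; exact ⟨h.1, Or.inl h.2⟩
    · simp at h1
      obtain ⟨rfl, h1⟩ := h1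
      exact ⟨rfl, Or.inr ⟨h1, fun p' h3 h4 => h2 (b :: p') (by simpa using h3) (by simpa using h4)⟩⟩
  · rintro ⟨rfl, h | ⟨h1, h2⟩⟩
    · left; rw [h]
    · right
      refine ⟨by simpa using h1, fun p' h3 h4 => ?_⟩
      cases p' with
      | nil => simp at h3
      | cons b' p' =>
        simp at h3
        obtain ⟨rfl, h3⟩ := h3
        exact h2 p' h3 (by simpa using h4)
theorem vis_nil_nil {A : Alph} {L : Pos → ℕ} : Vis A L [] [] := Or.inl rfl
theorem vis_cons_nil {A : Alph} {L : Pos → ℕ} {b : Bool} {p : Pos} : Vis A L (b :: p) [] ↔ False := by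
  simp [Vis]
theorem vis_nil_true {A : Alph} {L : Pos → ℕ} {q : Pos} : Vis A L [] (true :: q) ↔ False := by
  simp [Vis]
theorem vis_nil_false {A : Alph} {L : Pos → ℕ} {q : Pos} :
    Vis A L [] (false :: q) ↔ NoP A (fun p => L (false :: p)) (A.peb (L [])) q := by
  simp only [Vis, NoP, anc_nil_false, true_and]
  constructor
  · rintro (h | h) p hp
    · simp at h
    · exact h (false :: p) (by simp) (by simpa using hp)
  · intro h
    right
    intro p' h1 h2
    cases p' with
    | nil => simp at h1
    | cons b p' =>
      have hb : b = false := by simp at h2; tauto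
      subst hb
      exact h p' (by simpa using h2)

/-- finite forests -/
inductive Fo : Type where
  | nil : Fo
  | node : ℕ → Fo → Fo → Fo

def Fo.toFun : Fo → Pos → ℕ
  | .nil, _ => 0
  | .node s _ _, [] => s
  | .node _ a _, false :: p => a.toFun p
  | .node _ _ b, true :: p => b.toFun p

def Fo.depth : Fo → ℕ
  | .nil => 0
  | .node _ a b => max a.depth b.depth + 1

def Fo.app : Fo → Fo → Fo
  | .nil, g => g
  | .node s a b, g => .node s a (b.app g)

abbrev Fo.al (f : Fo) (p : Pos) : Prop := f.toFun p ≠ 0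

def Fol (E : ℕ → ℕ → Prop) : ℕ → Fo → Prop
  | _, .nil => True
  | s, .node s' a b => E s s' ∧ s' ≠ 0 ∧ Fol E s' a ∧ Fol E s b

theorem fun_node_nil (s : ℕ) (a b : Fo) : (Fo.node s a b).toFun [] = s := rfl
theorem fun_node_false (s : ℕ) (a b : Fo) :
    (fun p => (Fo.node s a b).toFun (false :: p)) = a.toFun := rfl
theorem fun_node_true (s : ℕ) (a b : Fo) :
    (fun p => (Fo.node s a b).toFun (true :: p)) = b.toFun := rfl

/-- pebble environments as relations -/
def upd {V : Type} (g : ℕ → V → Prop) (t : ℕ) (x : V) : ℕ → V → Prop :=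
  fun t' y => if t' = t then y = x else g t' y

def Emb (A : Alph) (N : ℕ) {V : Type} (U : V → Prop) (M : Kripke V ℕ ℕ) : (ℕ → V → Prop) → Fo → Prop
  | _, .nil => True
  | g, .node s a b => ∃ x, U x ∧ (∀ k ≤ N, (A.lab s k ↔ M.val k x)) ∧
      (∀ a ≤ N, ∀ t y, upd g (A.peb s) x t y → (A.inn s a t → M.rel a y x) ∧ (A.out s a t → M.rel a x y)) ∧
      Emb A N U M (upd g (A.peb s) x) a ∧ Emb A N U M g b

/-- homomorphism conclusion -/
def HomC (A : Alph) (N : ℕ) {V : Type} (U : V → Prop) (M : Kripke V ℕ ℕ) (g : ℕ → V → Prop) (f : Fo)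
    (F : Pos → V) : Prop :=
  (∀ p, f.al p → U (F p)) ∧ (∀ p, f.al p → ∀ k ≤ N, (A.lab (f.toFun p) k ↔ M.val k (F p))) ∧
  (∀ p q, f.al p → f.al q → ∀ a ≤ N, (TM A f.toFun).rel a p q → M.rel a (F p) (F q)) ∧
  (∀ t y q, g t y → f.al q → NoP A f.toFun t q → ∀ a ≤ N,
    (A.inn (f.toFun q) a t → M.rel a y (F q)) ∧ (A.out (f.toFun q) a t → M.rel a (F q) y))

theorem hom_node {A : Alph} {N : ℕ} {V : Type} {U : V → Prop} {M : Kripke V ℕ ℕ} {g : ℕ → V → Prop}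
    {s : ℕ} {a b : Fo} {x : V} {Fa Fb : Pos → V} (hx : U x) (hl : ∀ k ≤ N, (A.lab s k ↔ M.val k x))
    (he : ∀ a ≤ N, ∀ t y, upd g (A.peb s) x t y → (A.inn s a t → M.rel a y x) ∧ (A.out s a t → M.rel a x y))
    (ha : HomC A N U M (upd g (A.peb s) x) a Fa) (hb : HomC A N U M g b Fb) :
    HomC A N U M g (.node s a b) (fun p => match p with
      | [] => x | false :: p => Fa p | true :: p => Fb p) := by
  have hupd : upd g (A.peb s) x (A.peb s) x := by simp [upd]
  refine ⟨?_, ?_, ?_, ?_⟩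
  · rintro (_ | ⟨_ | _, p⟩) h
    · exact hx
    · exact ha.1 p h
    · exact hb.1 p h
  · rintro (_ | ⟨_ | _, p⟩) h
    · exact hl
    · exact ha.2.1 p h
    · exact hb.2.1 p h
  · rintro (_ | ⟨_ | _, p⟩) (_ | ⟨_ | _, q⟩) hp hq c hc h
    · rcases h with ⟨_, h⟩ | ⟨_, h⟩
      · exact (he c hc _ _ hupd).1 h
      · exact (he c hc _ _ hupd).2 h
    · rcases h with ⟨h1, h⟩ | ⟨h1, h⟩
      · exact (ha.2.2.2 _ _ q hupd hq (vis_nil_false.1 h1) c hc).1 h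
      · exact (vis_cons_nil.1 h1).elim
    · rcases h with ⟨h1, h⟩ | ⟨h1, h⟩
      · exact (vis_nil_true.1 h1).elim
      · exact (vis_cons_nil.1 h1).elim
    · rcases h with ⟨h1, h⟩ | ⟨h1, h⟩
      · exact (vis_cons_nil.1 h1).elim
      · exact (ha.2.2.2 _ _ p hupd hp (vis_nil_false.1 h1) c hc).2 h
    · refine ha.2.2.1 p q hp hq c hc ?_
      rcases h with ⟨h1, h⟩ | ⟨h1, h⟩
      · exact Or.inl ⟨(vis_cons.1 h1).2, h⟩
      · exact Or.inr ⟨(vis_cons.1 h1).2, h⟩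
    · rcases h with ⟨h1, h⟩ | ⟨h1, h⟩
      · exact absurd (vis_cons.1 h1).1 (by simp)
      · exact absurd (vis_cons.1 h1).1 (by simp)
    · rcases h with ⟨h1, h⟩ | ⟨h1, h⟩
      · exact (vis_cons_nil.1 h1).elim
      · exact (vis_nil_true.1 h1).elim
    · rcases h with ⟨h1, h⟩ | ⟨h1, h⟩
      · exact absurd (vis_cons.1 h1).1 (by simp)
      · exact absurd (vis_cons.1 h1).1 (by simp)
    · refine hb.2.2.1 p q hp hq c hc ?_
      rcases h with ⟨h1, h⟩ | ⟨h1, h⟩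
      · exact Or.inl ⟨(vis_cons.1 h1).2, h⟩
      · exact Or.inr ⟨(vis_cons.1 h1).2, h⟩
  · rintro t y (_ | ⟨_ | _, q⟩) hg hq hn c hc
    · refine he c hc t y ?_
      have : A.peb s ≠ t := nop_nil.1 hn
      simp only [upd]
      rw [if_neg (Ne.symm this)]; exact hg
    · obtain ⟨h1, h2⟩ := nop_false.1 hn
      refine ha.2.2.2 t y q ?_ hq h2 c hc
      have : A.peb s ≠ t := h1
      simp only [upd]
      rw [if_neg (Ne.symm this)]; exact hg
    · exact hb.2.2.2 t y q hg hq (nop_true.1 hn) c hc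

theorem emb_hom {A : Alph} {N : ℕ} {V : Type} [Nonempty V] {U : V → Prop} {M : Kripke V ℕ ℕ} :
    ∀ (f : Fo) (g : ℕ → V → Prop), Emb A N U M g f → ∃ F, HomC A N U M g f F := by
  intro f
  induction f with
  | nil =>
    intro g _
    refine ⟨fun _ => Classical.arbitrary V, ?_, ?_, ?_, ?_⟩
    · intro p h; exact absurd rfl h
    · intro p h; exact absurd rfl h
    · intro p q h; exact absurd rfl h
    · intro t y q _ h; exact absurd rfl h
  | node s a b iha ihb =>
    rintro g ⟨x, hx, hl, he, h1, h2⟩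
    obtain ⟨Fa, ha⟩ := iha _ h1
    obtain ⟨Fb, hb⟩ := ihb _ h2
    exact ⟨_, hom_node hx hl he ha hb⟩

theorem emb_app {A : Alph} {N : ℕ} {V : Type} {U : V → Prop} {M : Kripke V ℕ ℕ} {f1 f2 : Fo}
    {g : ℕ → V → Prop} : Emb A N U M g (f1.app f2) ↔ (Emb A N U M g f1 ∧ Emb A N U M g f2) := by
  induction f1 with
  | nil => simp [Fo.app, Emb]
  | node s a b iha ihb =>
    simp only [Fo.app, Emb, ihb]
    constructor
    · rintro ⟨x, h1, h2, h3, h4, h5, h6⟩; exact ⟨⟨x, h1, h2, h3, h4, h5⟩, h6⟩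
    · rintro ⟨⟨x, h1, h2, h3, h4, h5⟩, h6⟩; exact ⟨x, h1, h2, h3, h4, h5, h6⟩

/-- the `j`-th child position -/
def chp (p : Pos) (j : ℕ) : Pos := p ++ false :: List.replicate j true

theorem anc_rep (p : Pos) (j : ℕ) : ¬ Anc p (List.replicate j true) := by
  induction j generalizing p with
  | zero => simp
  | succ j ih =>
    cases p with
    | nil => simp [List.replicate_succ]
    | cons b p => simp [List.replicate_succ, ih]

theorem anc_chp {p' p : Pos} {j : ℕ} : Anc p' (chp p j) ↔ (p' = p ∨ Anc p' p) := by
  unfold chp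
  induction p generalizing p' with
  | nil => 
    cases p' with
    | nil => simp
    | cons b p' => simp [anc_rep]
  | cons b p ih =>
    cases p' with
    | nil => cases b <;> simp
    | cons b' p' => simp [ih]; tauto

theorem anc_irrefl (p : Pos) : ¬ Anc p p := by
  induction p with
  | nil => simp
  | cons b p ih => simp [ih]

/-- `f` is found among the children of `p` -/
def InF (L : Pos → ℕ) : Pos → Fo → Prop
  | _, .nil => True
  | p, .node s a b => s ≠ 0 ∧ (∃ j, L (chp p j) = s ∧ InF L (chp p j) a) ∧ InF L p b

theorem vis_child {A : Alph} {L : Pos → ℕ} {y p : Pos} {j : ℕ} (h : Vis A L y p)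
    (hne : A.peb (L y) ≠ A.peb (L (chp p j))) : Vis A L y (chp p j) := by
  right
  refine ⟨anc_chp.2 ?_, ?_⟩
  · rcases h with h | h
    · exact Or.inl h
    · exact Or.inr h.1
  · intro p' h1 h2
    rcases h2 with h2 | h2
    · rcases h with rfl | h
      · rcases anc_chp.1 h2 with rfl | h3
        · exact (anc_irrefl _ h1).elim
        · exact absurd h3 (by
            intro h3
            have anc_asymm : ∀ p q : Pos, Anc p q → ¬ Anc q p := by
              intro p
              induction p with
              | nil => intro q h; simp
              | cons b p ih =>
                intro q h h'
                cases q with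
                | nil => simp at h
                | cons b' q => simp at h h'; exact ih q h.2 h'.2
            exact anc_asymm _ _ h1 h3)
      · refine h.2 p' h1 ?_
        rcases anc_chp.1 h2 with rfl | h3
        · exact Or.inr rfl
        · exact Or.inl h3
    · rw [h2]; exact hne.symm

theorem in_emb {A : Alph} {N : ℕ} {L : Pos → ℕ} : ∀ (f : Fo) (p : Pos) (g : ℕ → Pos → Prop),
    (∀ t y, g t y → A.peb (L y) = t ∧ Vis A L y p) → InF L p f →
    Emb A N (fun p => L p ≠ 0) (TM A L) g f := by
  intro f
  induction f with
  | nil => intros; trivial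
  | node s a b iha ihb =>
    rintro p g hg ⟨hs, ⟨j, hj, h1⟩, h2⟩
    have hup : ∀ t y, upd g (A.peb s) (chp p j) t y → A.peb (L y) = t ∧ Vis A L y (chp p j) := by
      intro t y h
      simp only [upd] at h
      split_ifs at h with ht
      · subst h; rw [hj]; exact ⟨ht.symm, Or.inl rfl⟩
      · obtain ⟨h3, h4⟩ := hg t y h
        refine ⟨h3, vis_child h4 ?_⟩
        rw [h3, hj]; exact ht
    refine ⟨chp p j, by show L _ ≠ 0; rw [hj]; exact hs, ?_, ?_, iha _ _ hup h1, ihb _ _ hg h2⟩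
    · intro k _; simp only [TM, hj]
    · intro c hc t y hy
      obtain ⟨h3, h4⟩ := hup t y hy
      constructor
      · intro h; left; refine ⟨h4, ?_⟩; rw [hj, h3]; exact h
      · intro h; right; refine ⟨h4, ?_⟩; rw [hj, h3]; exact h

theorem self_in {L : Pos → ℕ} {E : ℕ → ℕ → Prop} : ∀ (f : Fo) (p : Pos) (j s : ℕ), Fol E s f →
    (∀ r, L (p ++ false :: (List.replicate j true ++ r)) = f.toFun r) → InF L p f := by
  intro f
  induction f with
  | nil => intros; trivial
  | node s a b iha ihb =>
    rintro p j s0 ⟨_, hs, h1, h2⟩ hr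
    refine ⟨hs, ⟨j, ?_, ?_⟩, ?_⟩
    · simpa [chp, Fo.toFun] using hr []
    · refine iha _ 0 _ h1 fun r => ?_
      simpa [chp, Fo.toFun] using hr (false :: r)
    · refine ihb _ (j+1) _ h2 fun r => ?_
      have := hr (true :: r)
      rw [List.replicate_succ']
      simpa [Fo.toFun] using this

/-! ### Part C : recognizability -/

def run {D : Type} (nl : D) (δ : ℕ → (ℕ → Prop) → Prop → D → D → D) :
    Fo → (ℕ → Pos → Prop) → (Pos → Prop) → D
  | .nil, _, _ => nl
  | .node s a b, m, T => δ s (fun i => m i []) (T [])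
      (run nl δ a (fun i p => m i (false :: p)) (fun p => T (false :: p)))
      (run nl δ b (fun i p => m i (true :: p)) (fun p => T (true :: p)))

def EP (N : ℕ) (Q : Fo → (ℕ → Pos) → (Pos → Prop) → Prop) : Prop :=
  ∃ (D : Type) (_ : Finite D) (nl : D) (δ : ℕ → (ℕ → Prop) → Prop → D → D → D) (acc : D → Prop),
    Nat.card D ≤ N ∧ ∀ f e T, (∀ i, f.al (e i)) → (Q f e T ↔ acc (run nl δ f (fun i p => e i = p) T))

/-- closed version -/
def EPc (N : ℕ) (Q : Fo → Prop) : Prop :=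
  ∃ (D : Type) (_ : Finite D) (nl : D) (δ : ℕ → D → D → D) (acc : D → Prop),
    Nat.card D ≤ N ∧ ∀ f, (Q f ↔ acc (run nl (fun s _ _ => δ s) f (fun _ _ => False) (fun _ => False)))

theorem EP.mono {N N' : ℕ} {Q} (h : EP N Q) (hN : N ≤ N') : EP N' Q := by
  obtain ⟨D, i, nl, δ, acc, hc, hQ⟩ := h
  exact ⟨D, i, nl, δ, acc, hc.trans hN, hQ⟩

theorem EP.congr {N : ℕ} {Q Q'} (h : EP N Q) (hQ : ∀ f e T, (∀ i, f.al (e i)) → (Q' f e T ↔ Q f e T)) :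
    EP N Q' := by
  obtain ⟨D, i, nl, δ, acc, hc, hQ'⟩ := h
  exact ⟨D, i, nl, δ, acc, hc, fun f e T he => (hQ f e T he).trans (hQ' f e T he)⟩

theorem EP.not {N : ℕ} {Q} (h : EP N Q) : EP N (fun f e T => ¬ Q f e T) := by
  obtain ⟨D, i, nl, δ, acc, hc, hQ⟩ := h
  exact ⟨D, i, nl, δ, fun d => ¬ acc d, hc, fun f e T he => not_congr (hQ f e T he)⟩

def dProd {D D' : Type} (δ : ℕ → (ℕ → Prop) → Prop → D → D → D) (δ' : ℕ → (ℕ → Prop) → Prop → D' → D' → D') :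
    ℕ → (ℕ → Prop) → Prop → D × D' → D × D' → D × D' :=
  fun s μ t x y => (δ s μ t x.1 y.1, δ' s μ t x.2 y.2)

theorem run_prod {D D' : Type} (nl : D) (δ) (nl' : D') (δ') (f : Fo) : ∀ m T,
    run (nl, nl') (dProd δ δ') f m T =
      (run nl δ f m T, run nl' δ' f m T) := by
  induction f with
  | nil => intro m T; rfl
  | node s a b iha ihb => intro m T; simp only [run, iha, ihb, dProd]

theorem EP.and {N N' : ℕ} {Q Q'} (h : EP N Q) (h' : EP N' Q') :
    EP (N * N') (fun f e T => Q f e T ∧ Q' f e T) := by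
  obtain ⟨D, i, nl, δ, acc, hc, hQ⟩ := h
  obtain ⟨D', i', nl', δ', acc', hc', hQ'⟩ := h'
  refine ⟨D × D', inferInstance, (nl, nl'), dProd δ δ', fun d => acc d.1 ∧ acc' d.2, ?_, fun f e T he => ?_⟩
  rotate_left 1
  · rw [run_prod nl δ nl' δ']; exact and_congr (hQ f e T he) (hQ' f e T he)
  · rw [Nat.card_prod]; exact Nat.mul_le_mul hc hc'

theorem EP.or {N N' : ℕ} {Q Q'} (h : EP N Q) (h' : EP N' Q') :
    EP (N * N') (fun f e T => Q f e T ∨ Q' f e T) :=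
  (h.not.and h'.not).not.congr (fun f e T _ => by tauto)

theorem EP.const (P : Prop) : EP 1 (fun _ _ _ => P) :=
  ⟨Unit, inferInstance, (), fun _ _ _ _ _ => (), fun _ => P, by simp, fun _ _ _ _ => Iff.rfl⟩

def dRen {D : Type} (ρ : ℕ → ℕ) (δ : ℕ → (ℕ → Prop) → Prop → D → D → D) :
    ℕ → (ℕ → Prop) → Prop → D → D → D := fun s μ t x y => δ s (fun i => μ (ρ i)) t x y

theorem run_ren {D : Type} (nl : D) (δ) (ρ : ℕ → ℕ) (f : Fo) : ∀ m T,
    run nl (dRen ρ δ) f m T =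
      run nl δ f (fun i => m (ρ i)) T := by
  induction f with
  | nil => intro m T; rfl
  | node s a b iha ihb => intro m T; simp only [run, iha, ihb, dRen]

theorem EP.ren {N : ℕ} {Q} (h : EP N Q) (ρ : ℕ → ℕ) : EP N (fun f e T => Q f (fun i => e (ρ i)) T) := by
  obtain ⟨D, i, nl, δ, acc, hc, hQ⟩ := h
  refine ⟨D, i, nl, dRen ρ δ, acc, hc, fun f e T he => ?_⟩
  rw [run_ren nl δ ρ]; exact hQ f _ T (fun i => he _)

def dLoc (γ : ℕ → (ℕ → Prop) → Prop → Prop) : ℕ → (ℕ → Prop) → Prop → Prop → Prop → Prop :=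
  fun s μ t x y => (s ≠ 0 ∧ γ s μ t) ∨ x ∨ y

theorem run_loc (γ : ℕ → (ℕ → Prop) → Prop → Prop) (f : Fo) : ∀ m T,
    run False (dLoc γ) f m T =
      ∃ p, f.al p ∧ γ (f.toFun p) (fun i => m i p) (T p) := by
  induction f with
  | nil => intro m T; simp [run, Fo.al, Fo.toFun]
  | node s a b iha ihb =>
    intro m T; simp only [run, iha, ihb, dLoc]
    apply propext
    constructor
    · rintro (h | ⟨p, h⟩ | ⟨p, h⟩)
      · exact ⟨[], h⟩
      · exact ⟨false :: p, h⟩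
      · exact ⟨true :: p, h⟩
    · rintro ⟨_ | ⟨_ | _, p⟩, h⟩
      · exact Or.inl h
      · exact Or.inr (Or.inl ⟨p, h⟩)
      · exact Or.inr (Or.inr ⟨p, h⟩)

theorem EP.loc (γ : ℕ → (ℕ → Prop) → Prop → Prop) :
    EP 2 (fun f e T => ∃ p, f.al p ∧ γ (f.toFun p) (fun i => e i = p) (T p)) := by
  refine ⟨Prop, inferInstance, False, dLoc γ, id, by simp, fun f e T he => ?_⟩
  rw [run_loc γ]; rfl

theorem EP.nodeP (i : ℕ) (β : ℕ → Prop → Prop) : EP 2 (fun f e T => β (f.toFun (e i)) (T (e i))) :=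
  (EP.loc (fun s μ t => μ i ∧ β s t)).congr (fun f e T he => by
    constructor
    · intro h; exact ⟨e i, he i, rfl, h⟩
    · rintro ⟨p, _, rfl, h⟩; exact h)

theorem EP.eqP (i j : ℕ) : EP 2 (fun f e T => e i = e j) :=
  (EP.loc (fun s μ t => μ i ∧ μ j)).congr (fun f e T he => by
    constructor
    · intro h; exact ⟨e i, he i, rfl, h.symm⟩
    · rintro ⟨p, _, rfl, h⟩; exact h.symm)

theorem EP.rootP (i : ℕ) : EP 2 (fun f e T => e i = []) := by
  refine ⟨Prop, inferInstance, False, fun s μ t x y => μ i, id, by simp, fun f e T he => ?_⟩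
  cases f with
  | nil => exact absurd rfl (he 0)
  | node s a b => rfl

def dVis (A : Alph) (m : ℕ) (hm : ∀ s, A.peb s < m) (β : ℕ → ℕ → Prop) (i j : ℕ) :
    ℕ → (ℕ → Prop) → Prop → Prop × (Fin m → Prop) → Prop × (Fin m → Prop) → Prop × (Fin m → Prop) :=
  fun s μ t x y =>
      ((s ≠ 0 ∧ μ i ∧ ((μ j ∧ β s (A.peb s)) ∨ x.2 ⟨A.peb s, hm s⟩)) ∨ x.1 ∨ y.1,
       fun u => (s ≠ 0 ∧ μ j ∧ A.peb s ≠ u ∧ β s u) ∨ (x.2 u ∧ A.peb s ≠ u) ∨ y.2 u)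

theorem run_vis (A : Alph) (m : ℕ) (hm : ∀ s, A.peb s < m) (β : ℕ → ℕ → Prop) (i j : ℕ) (f : Fo) : ∀ μ T,
    run (D := Prop × (Fin m → Prop)) (False, fun _ => False) (dVis A m hm β i j) f μ T =
    ((∃ p q, f.al p ∧ f.al q ∧ μ i p ∧ μ j q ∧ Vis A f.toFun p q ∧ β (f.toFun q) (A.peb (f.toFun p))),
     fun u : Fin m => ∃ q, f.al q ∧ μ j q ∧ NoP A f.toFun u q ∧ β (f.toFun q) u) := by
  induction f with
  | nil => intro m T; simp [run, Fo.al, Fo.toFun]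
  | node s a b iha ihb =>
    intro μ T; simp only [run, iha, ihb, dVis]
    refine Prod.ext ?_ ?_
    · apply propext
      constructor
      · rintro (⟨hs, h1, ⟨h2, h3⟩ | ⟨q, h2, h3, h4, h5⟩⟩ | ⟨p, q, h1, h2, h3, h4, h5, h6⟩ | ⟨p, q, h1, h2, h3, h4, h5, h6⟩)
        · exact ⟨[], [], hs, hs, h1, h2, vis_nil_nil, h3⟩
        · exact ⟨[], false :: q, hs, h2, h1, h3, vis_nil_false.2 h4, h5⟩
        · exact ⟨false :: p, false :: q, h1, h2, h3, h4, vis_cons.2 ⟨rfl, h5⟩, h6⟩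
        · exact ⟨true :: p, true :: q, h1, h2, h3, h4, vis_cons.2 ⟨rfl, h5⟩, h6⟩
      · rintro ⟨_ | ⟨b1, p⟩, _ | ⟨b2, q⟩, h1, h2, h3, h4, h5, h6⟩
        · exact Or.inl ⟨h1, h3, Or.inl ⟨h4, h6⟩⟩
        · cases b2
          · exact Or.inl ⟨h1, h3, Or.inr ⟨q, h2, h4, vis_nil_false.1 h5, h6⟩⟩
          · exact (vis_nil_true.1 h5).elim
        · exact (vis_cons_nil.1 h5).elim
        · obtain ⟨rfl, h7⟩ := vis_cons.1 h5
          cases b1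
          · exact Or.inr (Or.inl ⟨p, q, h1, h2, h3, h4, h7, h6⟩)
          · exact Or.inr (Or.inr ⟨p, q, h1, h2, h3, h4, h7, h6⟩)
    · funext u
      apply propext
      constructor
      · rintro (⟨hs, h1, h2, h3⟩ | ⟨⟨q, h1, h2, h3, h4⟩, h5⟩ | ⟨q, h1, h2, h3, h4⟩)
        · exact ⟨[], hs, h1, nop_nil.2 h2, h3⟩
        · exact ⟨false :: q, h1, h2, nop_false.2 ⟨h5, h3⟩, h4⟩
        · exact ⟨true :: q, h1, h2, nop_true.2 h3, h4⟩
      · rintro ⟨_ | ⟨_ | _, q⟩, h1, h2, h3, h4⟩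
        · exact Or.inl ⟨h1, h2, nop_nil.1 h3, h4⟩
        · exact Or.inr (Or.inl ⟨⟨q, h1, h2, (nop_false.1 h3).2, h4⟩, (nop_false.1 h3).1⟩)
        · exact Or.inr (Or.inr ⟨q, h1, h2, nop_true.1 h3, h4⟩)

theorem EP.vis (A : Alph) (m : ℕ) (hm : ∀ s, A.peb s < m) (β : ℕ → ℕ → Prop) (i j : ℕ) :
    EP (2 ^ (m + 1)) (fun f e T => Vis A f.toFun (e i) (e j) ∧ β (f.toFun (e j)) (A.peb (f.toFun (e i)))) := by
  refine ⟨Prop × (Fin m → Prop), inferInstance, (False, fun _ => False), dVis A m hm β i j, fun d => d.1, ?_,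
    fun f e T he => ?_⟩
  rotate_left 1
  · rw [run_vis A m hm β i j]
    constructor
    · intro h; exact ⟨e i, e j, he i, he j, rfl, rfl, h⟩
    · rintro ⟨p, q, h1, h2, rfl, rfl, h⟩; exact h
  · simp [Nat.card_prod, Nat.card_fun, pow_succ, mul_comm]

/-- marks with the variables of `S` replaced -/
def offm (S : ℕ → Prop) (μ : ℕ → Prop) : ℕ → Prop := fun i => ¬ S i ∧ μ i
def onm (S : ℕ → Prop) (μ : ℕ → Prop) : ℕ → Prop := fun i => S i ∨ μ i

def dExE {D : Type} (δ : ℕ → (ℕ → Prop) → Prop → D → D → D) (S : ℕ → Prop) :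
    ℕ → (ℕ → Prop) → Prop → D × Set D → D × Set D → D × Set D :=
  fun s μ t x y => (δ s (offm S μ) t x.1 y.1,
      {d | (s ≠ 0 ∧ d = δ s (onm S μ) t x.1 y.1) ∨ (∃ z ∈ x.2, d = δ s (offm S μ) t z y.1) ∨
        (∃ z ∈ y.2, d = δ s (offm S μ) t x.1 z)})

theorem run_exE {D : Type} (nl : D) (δ : ℕ → (ℕ → Prop) → Prop → D → D → D) (S : ℕ → Prop) (f : Fo) : ∀ m T,
    run (D := D × Set D) (nl, ∅) (dExE δ S) f m T =
    (run nl δ f (fun i p => ¬ S i ∧ m i p) T,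
     {d | ∃ p, f.al p ∧ d = run nl δ f (fun i q => (S i ∧ p = q) ∨ (¬ S i ∧ m i q)) T}) := by
  induction f with
  | nil => intro m T; simp [run, Fo.al, Fo.toFun]
  | node s a b iha ihb =>
    intro m T; simp only [run, iha, ihb, dExE]
    refine Prod.ext rfl ?_
    ext d
    simp only [Set.mem_ofPred_eq]
    have e1 : (fun i => (S i ∧ ([] : Pos) = []) ∨ (¬ S i ∧ m i [])) = onm S (fun i => m i []) := by
      funext i; unfold onm; apply propext; tauto
    have e2 : ∀ (b : Bool) (p : Pos), (fun i => (S i ∧ (b :: p : Pos) = []) ∨ (¬ S i ∧ m i [])) =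
        offm S (fun i => m i []) := by
      intro b p; funext i; unfold offm; apply propext; simp
    have e3 : ∀ (b : Bool), (fun i (q : Pos) => (S i ∧ [] = b :: q) ∨ (¬ S i ∧ m i (b :: q))) =
        (fun i q => ¬ S i ∧ m i (b :: q)) := by
      intro b; funext i q; apply propext; simp
    constructor
    · rintro (⟨hs, rfl⟩ | ⟨z, ⟨p, hp, rfl⟩, rfl⟩ | ⟨z, ⟨p, hp, rfl⟩, rfl⟩)
      · refine ⟨[], hs, ?_⟩
        rw [e1, e3, e3]
      · refine ⟨false :: p, hp, ?_⟩
        rw [e2]; simp [offm]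
      · refine ⟨true :: p, hp, ?_⟩
        rw [e2]; simp [offm]
    · rintro ⟨_ | ⟨_ | _, p⟩, hp, rfl⟩
      · left
        refine ⟨hp, ?_⟩
        rw [e1, e3, e3]
      · right; left
        refine ⟨_, ⟨p, hp, rfl⟩, ?_⟩
        rw [e2]; simp [offm]
      · right; right
        refine ⟨_, ⟨p, hp, rfl⟩, ?_⟩
        rw [e2]; simp [offm]

theorem card_exE {D : Type} [Finite D] {N : ℕ} (h : Nat.card D ≤ N) : Nat.card (D × Set D) ≤ N * 2 ^ N := by
  rw [Nat.card_prod]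
  refine Nat.mul_le_mul h ?_
  have : Nat.card (Set D) = 2 ^ Nat.card D := by
    rw [show Set D = (D → Prop) from rfl, Nat.card_fun]; simp
  rw [this]; exact Nat.pow_le_pow_right (by norm_num) h

theorem EP.exE {N : ℕ} {Q} (h : EP N Q) (i : ℕ) :
    EP (N * 2 ^ N) (fun f e T => ∃ p, f.al p ∧ Q f (Function.update e i p) T) := by
  obtain ⟨D, fin, nl, δ, acc, hc, hQ⟩ := h
  refine ⟨D × Set D, inferInstance, (nl, ∅), dExE δ (fun k => k = i), fun d => ∃ x ∈ d.2, acc x, card_exE hc, fun f e T he => ?_⟩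
  rw [run_exE nl δ (fun k => k = i)]
  have e1 : ∀ p : Pos, (fun k q => ((k = i) ∧ p = q) ∨ (¬ (k = i) ∧ e k = q)) =
      (fun k q => Function.update e i p k = q) := by
    intro p; funext k q
    by_cases hk : k = i
    · subst hk; simp
    · simp [hk]
  constructor
  · rintro ⟨p, hp, h⟩
    refine ⟨_, ⟨p, hp, rfl⟩, ?_⟩
    rw [e1]
    refine (hQ f _ T ?_).1 h
    intro k
    by_cases hk : k = i
    · subst hk; simpa using hp
    · simpa [hk] using he k
  · rintro ⟨_, ⟨p, hp, rfl⟩, h⟩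
    rw [e1] at h
    refine ⟨p, hp, (hQ f _ T ?_).2 h⟩
    intro k
    by_cases hk : k = i
    · subst hk; simpa using hp
    · simpa [hk] using he k

theorem run_clo {D : Type} (nl : D) (δ : ℕ → (ℕ → Prop) → Prop → D → D → D) (f : Fo) :
    run nl (fun s _ _ => δ s (fun _ => False) False) f (fun _ _ => False) (fun _ => False) =
    run nl δ f (fun _ _ => False) (fun _ => False) := by
  induction f with
  | nil => rfl
  | node s a b iha ihb => simp only [run, iha, ihb]

theorem EP.exC {N : ℕ} {Q} (h : EP N Q) :
    EPc (N * 2 ^ N) (fun f => ∃ p, f.al p ∧ Q f (fun _ => p) (fun _ => False)) := by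
  obtain ⟨D, fin, nl, δ, acc, hc, hQ⟩ := h
  refine ⟨D × Set D, inferInstance, (nl, ∅), fun s => dExE δ (fun k => True) s (fun _ => False) False, fun d => ∃ x ∈ d.2, acc x, card_exE hc, fun f => ?_⟩
  · rw [run_clo (nl, ∅), run_exE nl δ (fun k => True)]
    have e1 : ∀ p : Pos, (fun (k : ℕ) q => (True ∧ p = q) ∨ (¬ True ∧ False)) =
        (fun k q => p = q) := by
      intro p; funext k q
      simp
    constructor
    · rintro ⟨p, hp, h⟩
      refine ⟨_, ⟨p, hp, rfl⟩, ?_⟩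
      rw [e1]
      exact (hQ f _ _ (fun _ => hp)).1 h
    · rintro ⟨_, ⟨p, hp, rfl⟩, h⟩
      rw [e1] at h
      exact ⟨p, hp, (hQ f _ _ (fun _ => hp)).2 h⟩

def dExT {D : Type} (δ : ℕ → (ℕ → Prop) → Prop → D → D → D) :
    ℕ → (ℕ → Prop) → Prop → Set D → Set D → Set D :=
  fun s μ t X Y => {d | ∃ t', ∃ x ∈ X, ∃ y ∈ Y, d = δ s μ t' x y}

theorem run_exT {D : Type} (nl : D) (δ : ℕ → (ℕ → Prop) → Prop → D → D → D) (f : Fo) : ∀ m T,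
    run (D := Set D) {nl} (dExT δ) f m T =
    {d | ∃ T' : Pos → Prop, d = run nl δ f m T'} := by
  induction f with
  | nil => intro m T; ext d; simp [run]
  | node s a b iha ihb =>
    intro m T; simp only [run, iha, ihb, dExT]
    ext d
    simp only [Set.mem_ofPred_eq]
    constructor
    · rintro ⟨t', _, ⟨T1, rfl⟩, _, ⟨T2, rfl⟩, rfl⟩
      exact ⟨fun p => match p with | [] => t' | false :: p => T1 p | true :: p => T2 p, rfl⟩
    · rintro ⟨T', rfl⟩
      exact ⟨_, _, ⟨_, rfl⟩, _, ⟨_, rfl⟩, rfl⟩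

theorem EP.exT {N : ℕ} {Q} (h : EP N Q) : EP (2 ^ N) (fun f e T => ∃ T', Q f e T') := by
  obtain ⟨D, fin, nl, δ, acc, hc, hQ⟩ := h
  refine ⟨Set D, inferInstance, {nl}, dExT δ, fun d => ∃ x ∈ d, acc x, ?_, fun f e T he => ?_⟩
  rotate_left 1
  · rw [run_exT nl δ]
    constructor
    · rintro ⟨T', h⟩
      exact ⟨_, ⟨T', rfl⟩, (hQ f e T' he).1 h⟩
    · rintro ⟨_, ⟨T', rfl⟩, h⟩
      exact ⟨T', (hQ f e T' he).2 h⟩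
  · have : Nat.card (Set D) = 2 ^ Nat.card D := by
      rw [show Set D = (D → Prop) from rfl, Nat.card_fun]; simp
    rw [this]; exact Nat.pow_le_pow_right (by norm_num) hc

def lev (B : ℕ) : ℕ → ℕ
  | 0 => B
  | j+1 => lev B j * 2 ^ lev B j

theorem lev_pos {B : ℕ} (hB : 1 ≤ B) (j : ℕ) : 1 ≤ lev B j := by
  induction j with
  | zero => exact hB
  | succ j ih => exact Nat.mul_pos ih (Nat.two_pow_pos _)

theorem lev_mono {B : ℕ} (hB : 1 ≤ B) {i j : ℕ} (h : i ≤ j) : lev B i ≤ lev B j := by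
  induction h with
  | refl => exact le_rfl
  | step _ ih => exact ih.trans (Nat.le_mul_of_pos_right _ (Nat.two_pow_pos _))

theorem lev_mul {B : ℕ} (hB : 1 ≤ B) {i j k : ℕ} (hi : i + 1 ≤ k) (hj : j + 1 ≤ k) : lev B i * lev B j ≤ lev B k := by
  obtain ⟨k, rfl⟩ : ∃ l, k = l + 1 := ⟨k - 1, by omega⟩
  exact Nat.mul_le_mul (lev_mono hB (by omega)) ((lev_mono hB (by omega)).trans Nat.lt_two_pow_self.le)

theorem lev_pow {B : ℕ} (hB : 1 ≤ B) (j : ℕ) : 2 ^ lev B j ≤ lev B (j+1) :=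
  Nat.le_mul_of_pos_left _ (lev_pos hB j)

theorem EP.andL {B : ℕ} (hB : 2 ≤ B) {Q Q'} {i j k : ℕ} (h : EP (lev B i) Q) (h' : EP (lev B j) Q') (hi : i + 1 ≤ k) (hj : j + 1 ≤ k) :
    EP (lev B k) (fun f e T => Q f e T ∧ Q' f e T) := (h.and h').mono (lev_mul (by omega) hi hj)

theorem EP.orL {B : ℕ} (hB : 2 ≤ B) {Q Q'} {i j k : ℕ} (h : EP (lev B i) Q) (h' : EP (lev B j) Q') (hi : i + 1 ≤ k) (hj : j + 1 ≤ k) :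
    EP (lev B k) (fun f e T => Q f e T ∨ Q' f e T) := (h.or h').mono (lev_mul (by omega) hi hj)

theorem EP.exN {B : ℕ} {Q} {l : ℕ} (h : EP (lev B l) Q) (k : ℕ) :
    EP (lev B (l+k)) (fun f e T => ∃ p : ℕ → Pos, (∀ i, f.al (p i)) ∧
      Q f (fun i => if 2 ≤ i ∧ i < 2 + k then p i else e i) T) := by
  induction k with
  | zero =>
    refine h.congr fun f e T he => ?_
    have : ∀ p : ℕ → Pos, (fun i => if 2 ≤ i ∧ i < 2 + 0 then p i else e i) = e := by
      intro p; funext i; rw [if_neg (by omega)]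
    simp only [this]
    exact ⟨fun ⟨p, _, h⟩ => h, fun h => ⟨e, he, h⟩⟩
  | succ k ih =>
    refine (ih.exE (2+k)).congr fun f e T he => ?_
    constructor
    · rintro ⟨p, hp, h⟩
      refine ⟨p (2+k), hp _, p, hp, ?_⟩
      convert h using 2 with i
      by_cases h1 : i = 2 + k
      · subst h1; simp
      · rw [Function.update_of_ne h1]
        have : (2 ≤ i ∧ i < 2 + k) ↔ (2 ≤ i ∧ i < 2 + (k+1)) := by omega
        simp only [this]
    · rintro ⟨q, hq, p, hp, h⟩
      refine ⟨Function.update p (2+k) q, ?_, ?_⟩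
      · intro i
        by_cases h1 : i = 2 + k
        · subst h1; simpa using hq
        · simpa [h1] using hp i
      · convert h using 2 with i
        by_cases h1 : i = 2 + k
        · subst h1; simp
        · rw [Function.update_of_ne h1, Function.update_of_ne h1]
          have : (2 ≤ i ∧ i < 2 + k) ↔ (2 ≤ i ∧ i < 2 + (k+1)) := by omega
          simp only [this]

theorem rtg_closed {V : Type} {R : V → V → Prop} {x y : V} :
    Relation.ReflTransGen R x y ↔ ¬ ∃ T : V → Prop, (T x ∧ ¬ T y) ∧ ¬ ∃ a b, T a ∧ ¬ T b ∧ R a b := by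
  constructor
  · rintro h ⟨T, ⟨hx, hy⟩, hc⟩
    refine hy ?_
    clear hy
    induction h with
    | refl => exact hx
    | tail _ h ih => 
      by_contra hn
      exact hc ⟨_, _, ih, hn, h⟩
  · intro h
    by_contra hn
    refine h ⟨Relation.ReflTransGen R x, ⟨.refl, hn⟩, ?_⟩
    rintro ⟨a, b, h1, h2, h3⟩
    exact h2 (h1.tail h3)

theorem rtg_al {V : Type} {U : V → Prop} {R : V → V → Prop} {x y : V} (hx : U x) :
    Relation.ReflTransGen (fun a b => U b ∧ R a b) x y ↔
    Relation.ReflTransGen (fun a b => U a ∧ U b ∧ R a b) x y := by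
  constructor
  · intro h
    have : U y ∧ Relation.ReflTransGen (fun a b => U a ∧ U b ∧ R a b) x y := by
      induction h with
      | refl => exact ⟨hx, .refl⟩
      | tail _ h ih => exact ⟨h.1, ih.2.tail ⟨ih.1, h⟩⟩
    exact this.2
  · intro h
    refine Relation.ReflTransGen.mono ?_ _ _ h
    intro a b h; exact h.2

theorem epLsem (A : Alph) (m : ℕ) (hm : ∀ s, A.peb s < m) {N : ℕ} (hN : 1 ≤ N) (c : Cd) (hc : c.bd N) :
    EP (lev (2 ^ (m+1)) ((N+20) * c.size)) (fun f e T => lsem f.al (TM A f.toFun) c e) := by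
  have hB : 2 ≤ 2 ^ (m+1) := by rw [pow_succ]; have := Nat.two_pow_pos m; omega
  have hB1 : 1 ≤ 2 ^ (m+1) := by omega
  have two : ∀ {Q} j, EP 2 Q → EP (lev (2 ^ (m+1)) j) Q := fun j h =>
    h.mono (hB.trans (lev_mono hB1 (Nat.zero_le j)))
  have one : ∀ {Q} j, EP 1 Q → EP (lev (2 ^ (m+1)) j) Q := fun j h => h.mono (lev_pos hB1 j)
  induction c with
  | bot => exact one _ (EP.const False)
  | tr => exact one _ (EP.const True)
  | ed a =>
    have h1 := EP.vis A m hm (fun s t => A.inn s a t) 0 1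
    have h2 := EP.vis A m hm (fun s t => A.out s a t) 1 0
    exact EP.orL (i := 0) (j := 0) hB h1 h2 (by simp [Cd.size]) (by simp [Cd.size])
  | lb r => exact two _ (EP.nodeP 0 (fun s _ => A.lab s r))
  | or c d ihc ihd => exact EP.orL hB (ihc hc.1) (ihd hc.2) (by simp only [Cd.size]; nlinarith) (by simp only [Cd.size]; nlinarith)
  | star c ih =>
    have h1 := (ih hc).ren (pe 2 3)
    generalize hl : (N+20) * c.size = l at h1
    have h2 := EP.andL (k := l+1) hB (two l ((EP.nodeP 3 (fun _ t => t)).not)) h1 le_rfl le_rfl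
    have h3 := EP.andL (k := l+2) hB (two l (EP.nodeP 2 (fun _ t => t))) h2 (by omega) le_rfl
    have h4 : EP (lev (2 ^ (m+1)) (l+4)) _ := (h3.exE 3).exE 2
    have h5 := EP.andL (k := l+1) hB (two l ((EP.nodeP 0 (fun _ t => t)))) (two l ((EP.nodeP 1 (fun _ t => t)).not)) le_rfl le_rfl
    have h6 := EP.andL (k := l+5) hB h5 h4.not (by omega) (by omega)
    have h7 := (h6.exT.mono (lev_pow hB1 _)).not
    refine (h7.mono (lev_mono hB1 ?_)).congr fun f e T he => ?_
    · simp only [Cd.size]; rw [mul_add, hl]; omega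
    · simp only [_root_.lsem]
      rw [rtg_al (he 0), rtg_closed]
      refine not_congr (exists_congr fun T => and_congr Iff.rfl (not_congr ?_))
      have key : ∀ a b : Pos, (fun i => Function.update (Function.update e 2 a) 3 b (pe 2 3 i)) = pe a b := by
        intro a b; rw [pe_comp]; simp
      have k2 : ∀ a b : Pos, Function.update (Function.update e 2 a) 3 b 2 = a := by intro a b; simp
      have k3 : ∀ a b : Pos, Function.update (Function.update e 2 a) 3 b 3 = b := by intro a b; simp
      simp only [key, k2, k3]
      constructor
      · rintro ⟨a, b, h1, h2, h3, h4, h5⟩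
        exact ⟨a, h3, b, h4, h1, h2, h5⟩
      · rintro ⟨a, ha, b, hb, h1, h2, h3⟩
        exact ⟨a, b, h1, h2, ha, hb, h3⟩
  | cpr C s t ih =>
    have h1 := (ih hc.1).ren (fun i => i + 2)
    generalize hl : (N+20) * C.size = l at h1
    have h2 := EP.andL (k := l+1) hB (two l (EP.eqP (s+2) 0)) (two l (EP.eqP (t+2) 1)) le_rfl le_rfl
    have h3 := EP.andL (k := l+2) hB h2 h1 le_rfl (by omega)
    have h4 := EP.exN h3 (N+1)
    refine (h4.mono (lev_mono hB1 ?_)).congr fun f e T he => ?_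
    · simp only [Cd.size]; rw [mul_add, hl]; omega
    · simp only [_root_.lsem]
      have hs := hc.2.1
      have ht := hc.2.2
      have e1 : ∀ p : ℕ → Pos, (if 2 ≤ s + 2 ∧ s + 2 < 2 + (N+1) then p (s+2) else e (s+2)) = p (s+2) := fun p => if_pos (by omega)
      have e2 : ∀ p : ℕ → Pos, (if 2 ≤ t + 2 ∧ t + 2 < 2 + (N+1) then p (t+2) else e (t+2)) = p (t+2) := fun p => if_pos (by omega)
      have e3 : ∀ p : ℕ → Pos, (if 2 ≤ 0 ∧ 0 < 2 + (N+1) then p 0 else e 0) = e 0 := fun p => if_neg (by omega)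
      have e4 : ∀ p : ℕ → Pos, (if 2 ≤ 1 ∧ 1 < 2 + (N+1) then p 1 else e 1) = e 1 := fun p => if_neg (by omega)
      have e5 : ∀ p : ℕ → Pos, _ := fun p => lsem_congr_env (U := f.al) (M := TM A f.toFun) hN C hc.1 (fun i => if 2 ≤ i + 2 ∧ i + 2 < 2 + (N+1) then p (i+2) else e (i+2)) (fun i => p (i+2)) (fun i hi => if_pos (by omega))
      have e6 : ∀ p : ℕ → Pos, _ := fun p => lsem_congr_env (U := f.al) (M := TM A f.toFun) hN C hc.1 (fun i => p (i+2)) (fun i => if 2 ≤ i + 2 ∧ i + 2 < 2 + (N+1) then p (i+2) else e (i+2)) (fun i hi => (if_pos (by omega)).symm)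
      constructor
      · rintro ⟨p, hp, h1, h2, h3⟩
        refine ⟨fun i => p (i-2), fun i => hp _, ⟨?_, ?_⟩, ?_⟩
        · exact (e1 (fun i => p (i-2))).trans (h1.trans (e3 (fun i => p (i-2))).symm)
        · exact (e2 (fun i => p (i-2))).trans (h2.trans (e4 (fun i => p (i-2))).symm)
        · exact e6 (fun i => p (i-2)) h3
      · rintro ⟨p, hp, ⟨h1, h2⟩, h3⟩
        exact ⟨fun i => p (i+2), fun i => hp _, (e1 p).symm.trans (h1.trans (e3 p)), (e2 p).symm.trans (h2.trans (e4 p)), e5 p h3⟩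
  | cons c x y C ihc ihC =>
    refine EP.congr (EP.andL (k := (N+20) * (Cd.cons c x y C).size) hB ((ihc hc.1).ren (pe x y)) (ihC hc.2.2.2) (by simp only [Cd.size]; nlinarith) (by simp only [Cd.size]; nlinarith)) fun f e T he => ?_
    simp only [_root_.lsem]
    rw [pe_comp]

def crun {D : Type} (nl : D) (δ : ℕ → D → D → D) : Fo → D
  | .nil => nl
  | .node s a b => δ s (crun nl δ a) (crun nl δ b)

/-- recognizable by an automaton with at most `N` states -/
def Rec (N : ℕ) (Q : Fo → Prop) : Prop :=
  ∃ (D : Type) (_ : Finite D) (nl : D) (δ : ℕ → D → D → D) (acc : D → Prop),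
    Nat.card D ≤ N ∧ ∀ f, (Q f ↔ acc (crun nl δ f))

theorem run_crun {D : Type} (nl : D) (δ : ℕ → D → D → D) (f : Fo) :
    run nl (fun s _ _ => δ s) f (fun _ _ => False) (fun _ => False) = crun nl δ f := by
  induction f with
  | nil => rfl
  | node s a b iha ihb => simp only [run, iha, ihb, crun]

theorem EPc.rec {N N' : ℕ} {Q Q' : Fo → Prop} (h : EPc N Q) (hN : N ≤ N') (hQ : ∀ f, Q' f ↔ Q f) : Rec N' Q' := by
  obtain ⟨D, i, nl, δ, acc, hc, hQ'⟩ := h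
  refine ⟨D, i, nl, δ, acc, hc.trans hN, fun f => ?_⟩
  rw [← run_crun]; exact (hQ f).trans (hQ' f)

abbrev lse (A : Alph) (f : Fo) (k : ℕ) (x y : Pos) : Prop := lsem f.al (TM A f.toFun) (dec k) (pe x y)

def Viol (A : Alph) (n : ℕ) (f : Fo) : Prop :=
  ∃ x, f.al x ∧ ∃ k ≤ n, (Nat.pair 3 k ≤ n ∧ (∃ y, f.al y ∧ lse A f k x y) ∧ ¬ A.lab (f.toFun x) (Nat.pair 3 k)) ∨
    (Nat.pair 4 k ≤ n ∧ lse A f k x x ∧ ¬ A.lab (f.toFun x) (Nat.pair 4 k))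

def Wit3 (A : Alph) (k : ℕ) (f : Fo) : Prop := f.al [] ∧ ∃ y, f.al y ∧ lse A f k [] y
def Wit4 (A : Alph) (k : ℕ) (f : Fo) : Prop := f.al [] ∧ lse A f k [] []

def WW (m n : ℕ) : ℕ := lev (2 ^ (m+1)) ((n+22) * (n+1) + n + 10)

section
variable (A : Alph) (m : ℕ) (hm : ∀ s, A.peb s < m) (n : ℕ)

theorem ep_k {k : ℕ} (hm : ∀ s, A.peb s < m) (hk : k ≤ n) :
    EP (lev (2 ^ (m+1)) ((n+22) * (n+1))) (fun f e T => lsem f.al (TM A f.toFun) (dec k) e) := by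
  have h := epLsem A m hm (N := n + 2) (by omega) (dec k) (Cd.bd_mono (by omega) _ (dec_bd k))
  refine h.mono (lev_mono (Nat.one_le_two_pow) ?_)
  refine Nat.mul_le_mul (by omega) ((dec_size k).trans (by omega))

theorem ep_k2 {k : ℕ} (hm : ∀ s, A.peb s < m) (hk : k ≤ n) :
    EP (lev (2 ^ (m+1)) ((n+22) * (n+1)+1)) (fun f e T => ∃ y, f.al y ∧ lse A f k (e 0) y) := by
  refine (((ep_k A m n hm hk).ren (pe 0 1)).exE 1).congr fun f e T he => ?_
  refine exists_congr fun y => and_congr Iff.rfl ?_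
  show _ ↔ lsem _ _ _ (fun i => (Function.update e 1 y) (pe 0 1 i))
  rw [pe_comp]; simp

theorem ep_k1 {k : ℕ} (hm : ∀ s, A.peb s < m) (hk : k ≤ n) :
    EP (lev (2 ^ (m+1)) ((n+22) * (n+1))) (fun f e T => lse A f k (e 0) (e 0)) := by
  refine (((ep_k A m n hm hk).ren (pe 0 0))).congr fun f e T he => ?_
  show _ ↔ lsem _ _ _ (fun i => e (pe 0 0 i))
  rw [pe_comp]

theorem two_le_B : 2 ≤ 2 ^ (m+1) := by rw [pow_succ]; have := Nat.two_pow_pos m; omega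

theorem ep_two {Q} (j : ℕ) (h : EP 2 Q) : EP (lev (2 ^ (m+1)) j) Q :=
    h.mono ((two_le_B m).trans (lev_mono Nat.one_le_two_pow (Nat.zero_le j)))
theorem ep_one {Q} (j : ℕ) (h : EP 1 Q) : EP (lev (2 ^ (m+1)) j) Q := h.mono (lev_pos Nat.one_le_two_pow j)

theorem rec_wit3 {k : ℕ} (hm : ∀ s, A.peb s < m) (hk : k ≤ n) : Rec (WW m n) (Wit3 A k) := by
  have h1 := ep_k2 A m n hm hk
  have h2 := EP.andL (k := (n+22)*(n+1)+2) (two_le_B m) (ep_two m ((n+22)*(n+1)) (EP.rootP 0)) h1 (by omega) (by omega)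
  refine EPc.rec h2.exC (N' := WW m n) (lev_mono (i := (n+22)*(n+1)+2+1) Nat.one_le_two_pow (by omega)) fun f => ?_
  constructor
  · rintro ⟨h1, h2⟩; exact ⟨[], h1, rfl, h2⟩
  · rintro ⟨p, h1, rfl, h2⟩; exact ⟨h1, h2⟩

theorem rec_wit4 {k : ℕ} (hm : ∀ s, A.peb s < m) (hk : k ≤ n) : Rec (WW m n) (Wit4 A k) := by
  have h1 := ep_k1 A m n hm hk
  have h2 := EP.andL (k := (n+22)*(n+1)+2) (two_le_B m) (ep_two m ((n+22)*(n+1)) (EP.rootP 0)) h1 (by omega) (by omega)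
  refine EPc.rec h2.exC (N' := WW m n) (lev_mono (i := (n+22)*(n+1)+2+1) Nat.one_le_two_pow (by omega)) fun f => ?_
  constructor
  · rintro ⟨h1, h2⟩; exact ⟨[], h1, rfl, h2⟩
  · rintro ⟨p, h1, rfl, h2⟩; exact ⟨h1, h2⟩

theorem rec_viol (hm : ∀ s, A.peb s < m) : Rec (WW m n) (Viol A n) := by
  have hB := two_le_B m
  generalize hl : (n+22)*(n+1) = l
  have h0 : ∀ k ≤ n, EP (lev (2 ^ (m+1)) (l+4)) (fun f e T =>
     (Nat.pair 3 k ≤ n ∧ (∃ y, f.al y ∧ lse A f k (e 0) y) ∧ ¬ A.lab (f.toFun (e 0)) (Nat.pair 3 k)) ∨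
    (Nat.pair 4 k ≤ n ∧ lse A f k (e 0) (e 0) ∧ ¬ A.lab (f.toFun (e 0)) (Nat.pair 4 k))) := by
    intro k hk
    have h1 := ep_k1 A m n hm hk
    have h2 := ep_k2 A m n hm hk
    rw [hl] at h1 h2
    have h3 := EP.andL (k := l+2) hB h2 (ep_two m (l+1) (EP.nodeP 0 (fun s _ => A.lab s (Nat.pair 3 k))).not) (by omega) (by omega)
    have h4 := EP.andL (k := l+3) hB (ep_one m l (EP.const (Nat.pair 3 k ≤ n))) h3 (by omega) (by omega)
    have h5 := EP.andL (k := l+2) hB h1 (ep_two m l (EP.nodeP 0 (fun s _ => A.lab s (Nat.pair 4 k))).not) (by omega) (by omega)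
    have h6 := EP.andL (k := l+3) hB (ep_one m l (EP.const (Nat.pair 4 k ≤ n))) h5 (by omega) (by omega)
    exact EP.orL (k := l+4) hB h4 h6 (by omega) (by omega)
  have h1 : ∀ K ≤ n + 1, EP (lev (2 ^ (m+1)) (l+4+K)) (fun f e T => ∃ k < K,
     ((Nat.pair 3 k ≤ n ∧ (∃ y, f.al y ∧ lse A f k (e 0) y) ∧ ¬ A.lab (f.toFun (e 0)) (Nat.pair 3 k)) ∨
    (Nat.pair 4 k ≤ n ∧ lse A f k (e 0) (e 0) ∧ ¬ A.lab (f.toFun (e 0)) (Nat.pair 4 k)))) := by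
    intro K
    induction K with
    | zero => intro _; exact (ep_one m _ (EP.const False)).congr fun f e T he => by simp
    | succ K ih =>
      intro hK
      refine (EP.orL (k := l+4+(K+1)) hB (ih (by omega)) (h0 K (by omega)) (by omega) (by omega)).congr fun f e T he => ?_
      constructor
      · rintro ⟨k, hk, h⟩
        rcases Nat.lt_succ_iff_lt_or_eq.1 hk with h' | rfl
        · exact Or.inl ⟨k, h', h⟩
        · exact Or.inr h
      · rintro (⟨k, hk, h⟩ | h)
        · exact ⟨k, by omega, h⟩
        · exact ⟨K, by omega, h⟩
  refine EPc.rec (h1 (n+1) le_rfl).exC (N' := WW m n) ?_ fun f => ?_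
  · unfold WW; rw [hl]; exact (lev_mono (i := l+4+(n+1)+1) Nat.one_le_two_pow (by omega))
  · refine exists_congr fun x => and_congr Iff.rfl (exists_congr fun k => and_congr (by omega) Iff.rfl)
end

theorem pump {D : Type} [Finite D] (nl : D) (δ : ℕ → D → D → D) (E : ℕ → ℕ → Prop) (N0 : ℕ)
    (hE : ∀ a b, E a b → b < N0) (s : ℕ) (hs : s < N0) (f : Fo) (hf : Fol E s f) :
    ∃ f', Fol E s f' ∧ crun nl δ f' = crun nl δ f ∧ f'.depth ≤ N0 * Nat.card D := by
  classical
  let R : ℕ → Set (Fin N0 × D) := fun d => {x | ∃ f, Fol E x.1 f ∧ crun nl δ f = x.2 ∧ f.depth ≤ d}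
  have mem : ∀ d x, x ∈ R d ↔ ∃ f, Fol E x.1 f ∧ crun nl δ f = x.2 ∧ f.depth ≤ d := fun d x => Iff.rfl
  have mono : Monotone R := by
    intro d d' hd x hx
    obtain ⟨f, h1, h2, h3⟩ := hx
    exact ⟨f, h1, h2, h3.trans hd⟩
  have step : ∀ d, R d = R (d+1) → R (d+1) = R (d+2) := by
    intro d h
    apply Set.Subset.antisymm (mono (by omega))
    rintro ⟨x, q⟩ ⟨f, h1, h2, h3⟩
    cases f with
    | nil => exact ⟨.nil, h1, h2, by simp [Fo.depth]⟩
    | node s' a b =>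
      obtain ⟨g1, g2, g3, g4⟩ := h1
      simp only [Fo.depth] at h3
      have ha : ((⟨s', hE _ _ g1⟩, crun nl δ a) : Fin N0 × D) ∈ R (d+1) := ⟨a, g3, rfl, by omega⟩
      have hb : ((x, crun nl δ b) : Fin N0 × D) ∈ R (d+1) := ⟨b, g4, rfl, by omega⟩
      rw [← h] at ha hb
      obtain ⟨a', a1, a2, a3⟩ := ha
      obtain ⟨b', b1, b2, b3⟩ := hb
      refine ⟨.node s' a' b', ⟨g1, g2, a1, b1⟩, ?_, ?_⟩
      · rw [← h2]; simp only [crun]; rw [a2, b2]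
      · simp only [Fo.depth]; omega
  have hst := Nat.stabilises_of_monotone (f := fun d => (R d).ncard) (b := N0 * Nat.card D) (n := max (N0 * Nat.card D) f.depth)
    (fun d d' hd => Set.ncard_le_ncard (mono hd) (Set.toFinite _))
    (fun d => by
      refine (Set.ncard_le_card _).trans ?_
      rw [Nat.card_prod]; simp)
    (fun d h => by
      have h1 : R d = R (d+1) := Set.eq_of_subset_of_ncard_le (mono (by omega)) h.symm.le (Set.toFinite _)
      show (R (d+1)).ncard = (R (d+2)).ncard
      rw [step d h1]) (le_max_left _ _)
  have heq : R (N0 * Nat.card D) = R (max (N0 * Nat.card D) f.depth) :=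
    Set.eq_of_subset_of_ncard_le (mono (le_max_left _ _)) hst.le (Set.toFinite _)
  have : ((⟨s, hs⟩, crun nl δ f) : Fin N0 × D) ∈ R (max (N0 * Nat.card D) f.depth) := ⟨f, hf, rfl, le_max_right _ _⟩
  rw [← heq] at this
  exact this

def LabOK (A : Alph) (n s : ℕ) : Prop :=
  (∀ k, Nat.pair 1 k ≤ n → (A.lab s (Nat.pair 1 k) ↔ ¬ A.lab s k)) ∧
  (∀ k l, Nat.pair 2 (Nat.pair k l) ≤ n → (A.lab s (Nat.pair 2 (Nat.pair k l)) ↔ (A.lab s k ∧ A.lab s l)))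

def CritE (A : Alph) (n N0 d : ℕ) (E : ℕ → ℕ → Prop) : Prop :=
  (∀ a b, E a b → a < N0 ∧ b < N0 ∧ b ≠ 0) ∧ (∃ s, E 0 s ∧ A.lab s n) ∧
  (∀ a s, E a s → (∃ s', E s s') ∧ LabOK A n s ∧ ∀ k ≤ n,
    (Nat.pair 3 k ≤ n → A.lab s (Nat.pair 3 k) → ∃ f : Fo, f.depth ≤ d ∧ Fol E s f ∧ Wit3 A k (.node s f .nil)) ∧
    (Nat.pair 4 k ≤ n → A.lab s (Nat.pair 4 k) → ∃ f : Fo, f.depth ≤ d ∧ Fol E s f ∧ Wit4 A k (.node s f .nil))) ∧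
  (∀ f : Fo, f.depth ≤ d → Fol E 0 f → ¬ Viol A n f)

noncomputable def chE (E : ℕ → ℕ → Prop) (s j : ℕ) : ℕ := by
  classical exact if E s j then j else Classical.epsilon (E s)

theorem chE_self {E : ℕ → ℕ → Prop} {s j : ℕ} (h : E s j) : chE E s j = j := by
  unfold chE; rw [if_pos h]
theorem chE_E {E : ℕ → ℕ → Prop} {s : ℕ} (h : ∃ j, E s j) (j : ℕ) : E s (chE E s j) := by
  unfold chE; split_ifs with h'
  · exact h'
  · exact Classical.epsilon_spec h

def KT (ch : ℕ → ℕ → ℕ) : Pos → ℕ → ℕ → ℕ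
  | [], s, c => ch s c
  | false :: p, s, c => KT ch p (ch s c) 0
  | true :: p, s, c => KT ch p s (c+1)

theorem KT_rep (ch : ℕ → ℕ → ℕ) (j : ℕ) : ∀ s c, KT ch (List.replicate j true) s c = ch s (c + j) := by
  induction j with
  | zero => intros; rfl
  | succ j ih => intro s c; simp only [List.replicate_succ, KT, ih]; congr 1; omega

theorem KT_chp (ch : ℕ → ℕ → ℕ) (p : Pos) (j : ℕ) : ∀ s c, KT ch (chp p j) s c = ch (KT ch p s c) j := by
  unfold chp
  induction p with
  | nil =>
    intro s c
    simp only [List.nil_append, KT]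
    rw [KT_rep]; simp
  | cons b p ih => intro s c; cases b <;> simp only [List.cons_append, KT, ih]

theorem KT_ok {E : ℕ → ℕ → Prop} (hE : ∀ a s, E a s → ∃ s', E s s') (p : Pos) : ∀ s c, (∃ s', E s s') →
    ∃ a, E a (KT (chE E) p s c) := by
  induction p with
  | nil => intro s c h; exact ⟨s, chE_E h c⟩
  | cons b p ih =>
    intro s c h
    cases b
    · exact ih _ _ (hE _ _ (chE_E h c))
    · exact ih _ _ h

def trunc (ch : ℕ → ℕ → ℕ) : ℕ → ℕ → ℕ → Fo
  | 0, _, _ => .nil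
  | d+1, s, c => .node (ch s c) (trunc ch d (ch s c) 0) (trunc ch d s (c+1))

theorem trunc_fun (ch : ℕ → ℕ → ℕ) (d : ℕ) : ∀ s c p, (trunc ch d s c).toFun p =
    if p.length < d then KT ch p s c else 0 := by
  induction d with
  | zero => intro s c p; simp [trunc, Fo.toFun]
  | succ d ih =>
    intro s c p
    rcases p with _ | ⟨_ | _, p⟩
    · simp [trunc, Fo.toFun, KT]
    · simp [trunc, Fo.toFun, KT, ih]
    · simp [trunc, Fo.toFun, KT, ih]

theorem trunc_fol {E : ℕ → ℕ → Prop} (hE : ∀ a s, E a s → ∃ s', E s s') (h0 : ∀ a s, E a s → s ≠ 0) (d : ℕ) :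
    ∀ s c, (∃ s', E s s') → Fol E s (trunc (chE E) d s c) := by
  induction d with
  | zero => intros; trivial
  | succ d ih =>
    intro s c h
    have := chE_E h c
    exact ⟨this, h0 _ _ this, ih _ _ (hE _ _ this), ih _ _ h⟩

theorem anc_len : ∀ (p q : Pos), Anc p q → p.length < q.length := by
  intro p
  induction p with
  | nil => intro q h; cases q <;> simp at *
  | cons b p ih =>
    intro q h
    cases q with
    | nil => simp at h
    | cons b' q => simp at h; have := ih q h.2; simp; exact this

theorem vis_congr {A : Alph} {L L' : Pos → ℕ} {p q : Pos} (h : ∀ r : Pos, r.length ≤ q.length → L r = L' r)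
    (hv : Vis A L p q) : Vis A L' p q := by
  rcases hv with rfl | ⟨h1, h2⟩
  · exact Or.inl rfl
  · refine Or.inr ⟨h1, fun p' h3 h4 => ?_⟩
    rw [← h p (anc_len _ _ h1).le, ← h p']
    · exact h2 p' h3 h4
    · rcases h4 with h4 | rfl
      · exact (anc_len _ _ h4).le
      · exact le_rfl

theorem fol_inf {E : ℕ → ℕ → Prop} {s0 c0 : ℕ} : ∀ (f : Fo) (p : Pos),
    Fol E (KT (chE E) p s0 c0) f → InF (fun p => KT (chE E) p s0 c0) p f := by
  intro f
  induction f with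
  | nil => intros; trivial
  | node s a b iha ihb =>
    rintro p ⟨h1, h2, h3, h4⟩
    have hj : KT (chE E) (chp p s) s0 c0 = s := by rw [KT_chp, chE_self h1]
    exact ⟨h2, ⟨s, hj, iha _ (by rw [hj]; exact h3)⟩, ihb _ h4⟩

theorem homc_nil {A : Alph} {N : ℕ} {V : Type} {U : V → Prop} {M : Kripke V ℕ ℕ} {g : ℕ → V → Prop} {F : Pos → V} :
    HomC A N U M g .nil F := by
  refine ⟨?_, ?_, ?_, ?_⟩
  · intro p h; exact absurd rfl h
  · intro p h; exact absurd rfl h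
  · intro p q h; exact absurd rfl h
  · intro t y q _ h; exact absurd rfl h

theorem wit_hom {A : Alph} {N : ℕ} {L : Pos → ℕ} {f : Fo} {p : Pos} (h0 : L p ≠ 0) (hf : InF L p f) :
    ∃ F : Pos → Pos, F [] = p ∧ HomC A N (fun p => L p ≠ 0) (TM A L) (fun _ _ => False) (.node (L p) f .nil) F := by
  have h1 : Emb A N (fun p => L p ≠ 0) (TM A L) (upd (fun _ _ => False) (A.peb (L p)) p) f := by
    refine in_emb f p _ ?_ hf
    intro t y h
    simp only [upd] at h
    split_ifs at h with ht
    · subst h; exact ⟨ht.symm, Or.inl rfl⟩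
  obtain ⟨Fa, hFa⟩ := emb_hom f _ h1
  refine ⟨_, ?_, hom_node (b := .nil) (Fb := fun _ => p) h0 (fun k _ => Iff.rfl) ?_ hFa homc_nil⟩
  · rfl
  · intro a ha t y h
    simp only [upd] at h
    split_ifs at h with ht
    · subst h; subst ht
      exact ⟨fun h => Or.inl ⟨Or.inl rfl, h⟩, fun h => Or.inr ⟨Or.inl rfl, h⟩⟩

theorem lsem_homc {A : Alph} {N : ℕ} {V : Type} {U : V → Prop} {M : Kripke V ℕ ℕ} {g : ℕ → V → Prop} {f : Fo}
    {F : Pos → V} (h : HomC A N U M g f F) {k : ℕ} (hk : k + 2 ≤ N) {x y : Pos} (hx : f.al x) (hy : f.al y)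
    (hl : lse A f k x y) : lsem U M (dec k) (pe (F x) (F y)) := by
  have := lsem_hom (N := N) F h.1 (fun a ha u v hu hv hr => h.2.2.1 u v hu hv a ha hr)
    (fun a ha u hu hl => (h.2.1 u hu a ha).1 hl) (dec k) (Cd.bd_mono hk _ (dec_bd k)) _ (pe_all hx hy) hl
  rwa [pe_comp] at this

theorem crit_sound {A : Alph} {m n N0 d : ℕ} (hm : ∀ s, A.peb s < m) (hd : N0 * WW m n ≤ d)
    {E : ℕ → ℕ → Prop} (hC : CritE A n N0 d E) :
    ∃ (W : Type) (M : Kripke W ℕ ℕ) (w : W), Good n M ∧ M.val n w := by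
  obtain ⟨hb, ⟨s0, hs0, hn⟩, hE, hV⟩ := hC
  have hE1 : ∀ a s, E a s → ∃ s', E s s' := fun a s h => (hE a s h).1
  have hE0 : ∀ a s, E a s → s ≠ 0 := fun a s h => (hb a s h).2.2
  have hr : ∃ s', E 0 s' := ⟨s0, hs0⟩
  set L : Pos → ℕ := fun p => KT (chE E) p 0 0 with hL
  have hok : ∀ p, ∃ a, E a (L p) := fun p => KT_ok hE1 p 0 0 hr
  have hal : ∀ p, L p ≠ 0 := fun p => by obtain ⟨a, h⟩ := hok p; exact hE0 _ _ h
  have htop : (fun p => L p ≠ 0) = fun _ => True := by funext p; simp [hal p]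
  have hW : ∀ f, Fol E 0 f → ¬ Viol A n f := by
    intro f hf hv
    obtain ⟨D, _, nl, δ, acc, hc, hQ⟩ := rec_viol A m n hm
    obtain ⟨f', h1, h2, h3⟩ := pump nl δ E N0 (fun a b h => (hb a b h).2.1) 0 (hb _ _ hs0).1 f hf
    refine hV f' (h3.trans ((Nat.mul_le_mul_left _ hc).trans hd)) h1 ?_
    rw [hQ, h2, ← hQ]; exact hv
  have hT : ∀ k ≤ n, ∀ x y, lsem (fun _ => True) (TM A L) (dec k) (pe x y) → ∃ f, Fol E 0 f ∧ f.al x ∧ f.al y ∧ f.toFun x = L x ∧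
      lse A f k x y := by
    intro k hk x y h
    obtain ⟨d0, h0⟩ := lsem_compact (N := n+2) (by omega) List.length (dec k) (Cd.bd_mono (by omega) _ (dec_bd k)) _ h
    have h1 := h0 (max d0 (max (x.length + 1) (y.length + 1))) (le_max_left _ _)
    have hx : x.length < max d0 (max (x.length + 1) (y.length + 1)) := by omega
    have hy : y.length < max d0 (max (x.length + 1) (y.length + 1)) := by omega
    generalize max d0 (max (x.length + 1) (y.length + 1)) = D at h1 hx hy
    have hfun : ∀ p : Pos, p.length < D → (trunc (chE E) D 0 0).toFun p = L p := by
      intro p hp; rw [trunc_fun, if_pos hp]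
    have halv : ∀ p : Pos, p.length < D → (trunc (chE E) D 0 0).al p := by
      intro p hp; unfold Fo.al; rw [hfun p hp]; exact hal p
    refine ⟨trunc (chE E) D 0 0, trunc_fol hE1 hE0 D 0 0 hr, halv x hx, halv y hy, hfun x hx, ?_⟩
    have := lsem_hom (N := n+2) (U := fun v : Pos => v.length < D) (M := TM A L) (U' := (trunc (chE E) D 0 0).al)
      (M' := TM A (trunc (chE E) D 0 0).toFun) id halv ?_ ?_ (dec k) (Cd.bd_mono (by omega) _ (dec_bd k)) _ 
      (pe_all (P := fun v : Pos => v.length < D) hx hy) h1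
    · exact this
    · intro a ha u v hu hv h
      rcases h with ⟨h2, h3⟩ | ⟨h2, h3⟩
      · left
        refine ⟨vis_congr (fun r hr => (hfun r (by simp only [id] at hr; omega)).symm) h2, ?_⟩
        rw [id, id, hfun u hu, hfun v hv]; exact h3
      · right
        refine ⟨vis_congr (fun r hr => (hfun r (by simp only [id] at hr; omega)).symm) h2, ?_⟩
        rw [id, id, hfun u hu, hfun v hv]; exact h3
    · intro a ha u hu h
      show A.lab _ _
      rw [id, hfun u hu]; exact h
  have hk3 : ∀ i k, Nat.pair i k ≤ n → k ≤ n := fun i k h => (Nat.right_le_pair _ _).trans h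
  refine ⟨Pos, TM A L, List.replicate s0 true, ⟨?_, ?_, ?_, ?_⟩, ?_⟩
  · intro k v hk
    obtain ⟨a, h⟩ := hok v
    exact (hE a _ h).2.1.1 k hk
  · intro k l v hk
    obtain ⟨a, h⟩ := hok v
    exact (hE a _ h).2.1.2 k l hk
  · intro k v hk
    constructor
    · intro hl
      obtain ⟨a, h⟩ := hok v
      obtain ⟨f, _, h2, h3, y, h4, h5⟩ := ((hE a _ h).2.2 k (hk3 _ _ hk)).1 hk hl
      obtain ⟨F, hF, hH⟩ := wit_hom (A := A) (N := n+2) (hal v) (fol_inf f v h2)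
      have := lsem_homc hH (by have := hk3 _ _ hk; omega) h3 h4 h5
      rw [hF, htop] at this
      exact ⟨_, this⟩
    · rintro ⟨y, hy⟩
      obtain ⟨f, h1, h2, h3, h4, h5⟩ := hT k (hk3 _ _ hk) v y hy
      by_contra hn
      exact hW f h1 ⟨v, h2, k, hk3 _ _ hk, Or.inl ⟨hk, ⟨y, h3, h5⟩, by rw [h4]; exact hn⟩⟩
  · intro k v hk
    constructor
    · intro hl
      obtain ⟨a, h⟩ := hok v
      obtain ⟨f, _, h2, h3, h5⟩ := ((hE a _ h).2.2 k (hk3 _ _ hk)).2 hk hl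
      obtain ⟨F, hF, hH⟩ := wit_hom (A := A) (N := n+2) (hal v) (fol_inf f v h2)
      have := lsem_homc hH (by have := hk3 _ _ hk; omega) h3 h3 h5
      rw [hF, htop] at this
      exact this
    · intro hy
      obtain ⟨f, h1, h2, h3, h4, h5⟩ := hT k (hk3 _ _ hk) v v hy
      by_contra hn
      exact hW f h1 ⟨v, h2, k, hk3 _ _ hk, Or.inr ⟨hk, h5, by rw [h4]; exact hn⟩⟩
  · show A.lab (KT _ _ _ _) n
    rw [KT_rep, Nat.zero_add, chE_self hs0]; exact hn

section
variable {V : Type}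

def Lett (A : Alph) (N m : ℕ) (M : Kripke V ℕ ℕ) (s : ℕ) (h : ℕ → V) (w : V) : Prop :=
  A.peb s < m ∧ (∀ k ≤ N, (A.lab s k ↔ M.val k w)) ∧
  ∀ a ≤ N, ∀ t < m, (A.inn s a t ↔ M.rel a (Function.update h (A.peb s) w t) w) ∧
    (A.out s a t ↔ M.rel a w (Function.update h (A.peb s) w t))

def Rz (A : Alph) (P : ℕ → (ℕ → V) → V → Prop) : (ℕ → V) → Fo → Prop
  | _, .nil => True
  | h, .node s a b => ∃ w, P s h w ∧ Rz A P (Function.update h (A.peb s) w) a ∧ Rz A P h b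

theorem rz_app {A : Alph} {P : ℕ → (ℕ → V) → V → Prop} {f1 f2 : Fo} {h : ℕ → V}
    (h1 : Rz A P h f1) (h2 : Rz A P h f2) : Rz A P h (f1.app f2) := by
  induction f1 with
  | nil => exact h2
  | node s a b iha ihb => obtain ⟨w, h3, h4, h5⟩ := h1; exact ⟨w, h3, h4, ihb h5⟩

theorem rz_mono {A : Alph} {P P' : ℕ → (ℕ → V) → V → Prop} (hP : ∀ s h w, P s h w → P' s h w) {f : Fo} :
    ∀ {h : ℕ → V}, Rz A P h f → Rz A P' h f := by
  induction f with
  | nil => intros; trivial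
  | node s a b iha ihb => 
    intro h hh
    obtain ⟨w, h3, h4, h5⟩ := hh; exact ⟨w, hP _ _ _ h3, iha h4, ihb h5⟩

theorem rz_emb {A : Alph} {N m : ℕ} {M : Kripke V ℕ ℕ} {f : Fo} :
    ∀ {h : ℕ → V}, Rz A (Lett A N m M) h f → Emb A N (fun _ => True) M (fun t y => t < m ∧ y = h t) f := by
  induction f with
  | nil => intros; trivial
  | node s a b iha ihb =>
    intro h hh
    obtain ⟨w, ⟨h1, h2, h3⟩, h4, h5⟩ := hh
    have key : upd (fun t y => t < m ∧ y = h t) (A.peb s) w =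
        (fun t y => t < m ∧ y = Function.update h (A.peb s) w t) := by
      funext t y
      apply propext
      by_cases ht : t = A.peb s
      · subst ht; simp [upd, h1]
      · simp [upd, ht]
    refine ⟨w, trivial, h2, ?_, ?_, ihb h5⟩
    · rw [key]
      rintro c hc t y ⟨ht, rfl⟩
      exact ⟨(h3 c hc t ht).1.1, (h3 c hc t ht).2.1⟩
    · rw [key]; exact iha h4

structure Comp {V' : Type} (N m : ℕ) (M : Kripke V ℕ ℕ) (U' : V' → Prop) (M' : Kripke V' ℕ ℕ) (h : ℕ → V)
    (g : ℕ → V' → Prop) : Prop where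
  al : ∀ t y, g t y → U' y
  fn : ∀ t y z, g t y → g t z → y = z
  rl : ∀ a ≤ N, ∀ t < m, ∀ u < m, ∀ y z, M.rel a (h t) (h u) → g t y → g u z → M'.rel a y z
  vl : ∀ k ≤ N, ∀ t < m, ∀ y, M.val k (h t) → g t y → M'.val k y

theorem upd_self {V' : Type} (g : ℕ → V' → Prop) (t : ℕ) (x : V') : upd g t x t x := by simp [upd]
theorem upd_ne {V' : Type} (g : ℕ → V' → Prop) {t t' : ℕ} (x y : V') (h : t' ≠ t) (hg : g t' y) : upd g t x t' y := by
  simp only [upd]; rw [if_neg h]; exact hg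

theorem comp_upd {V' : Type} {A : Alph} {N m : ℕ} {M : Kripke V ℕ ℕ} {U' : V' → Prop} {M' : Kripke V' ℕ ℕ} {h : ℕ → V}
    {g : ℕ → V' → Prop} (hc : Comp N m M U' M' h g) {s : ℕ} {w : V} (hL : Lett A N m M s h w) {x : V'}
    (hx : U' x) (hl : ∀ k ≤ N, (A.lab s k ↔ M'.val k x))
    (he : ∀ a ≤ N, ∀ t y, upd g (A.peb s) x t y → (A.inn s a t → M'.rel a y x) ∧ (A.out s a t → M'.rel a x y)) :
    Comp N m M U' M' (Function.update h (A.peb s) w) (upd g (A.peb s) x) := by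
  obtain ⟨hp, h2, h3⟩ := hL
  refine ⟨?_, ?_, ?_, ?_⟩
  · intro t y hy
    simp only [upd] at hy
    split_ifs at hy with ht
    · subst hy; exact hx
    · exact hc.al t y hy
  · intro t y z hy hz
    simp only [upd] at hy hz
    split_ifs at hy hz with ht
    · rw [hy, hz]
    · exact hc.fn t y z hy hz
  · intro a ha t ht u hu y z hr hy hz
    by_cases hu' : u = A.peb s
    · subst hu'
      have hz' : z = x := by simpa [upd] using hz
      subst hz'
      refine (he a ha t y hy).1 ((h3 a ha t ht).1.2 ?_)
      simpa using hr
    · by_cases ht' : t = A.peb s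
      · subst ht'
        have hy' : y = x := by simpa [upd] using hy
        subst hy'
        refine (he a ha u z hz).2 ((h3 a ha u hu).2.2 ?_)
        simpa using hr
      · simp only [upd, ht', hu', if_false] at hy hz
        rw [Function.update_of_ne ht', Function.update_of_ne hu'] at hr
        exact hc.rl a ha t ht u hu y z hr hy hz
  · intro k hk t ht y hv hy
    by_cases ht' : t = A.peb s
    · subst ht'
      have hy' : y = x := by simpa [upd] using hy
      subst hy'
      exact (hl k hk).1 ((h2 k hk).2 (by simpa using hv))
    · simp only [upd, ht', if_false] at hy
      rw [Function.update_of_ne ht'] at hv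
      exact hc.vl k hk t ht y hv hy

theorem fresh {m K : ℕ} (hK : K < m) (κ : ℕ → ℕ) : ∃ l < m, ∀ i < K, κ i ≠ l := by
  classical
  by_contra hcon
  push Not at hcon
  have : Finset.range m ⊆ (Finset.range K).image κ := by
    intro l hl
    obtain ⟨i, hi, h⟩ := hcon l (Finset.mem_range.1 hl)
    exact Finset.mem_image.2 ⟨i, Finset.mem_range.2 hi, h⟩
  have := (Finset.card_le_card this).trans Finset.card_image_le
  simp at this; omega

/-- lifting conclusion -/
def LiftC (A : Alph) (N m : ℕ) (M : Kripke V ℕ ℕ) (P : ℕ → (ℕ → V) → V → Prop) (h : ℕ → V)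
    (Q : ∀ (V' : Type) (U' : V' → Prop) (M' : Kripke V' ℕ ℕ) (g : ℕ → V' → Prop), Prop) : Prop :=
  ∃ f, Rz A P h f ∧ ∀ (V' : Type) (U' : V' → Prop) (M' : Kripke V' ℕ ℕ) (g : ℕ → V' → Prop),
    Comp N m M U' M' h g → Emb A N U' M' g f → Q V' U' M' g

theorem liftC_nil {A : Alph} {N m : ℕ} {M : Kripke V ℕ ℕ} {P : ℕ → (ℕ → V) → V → Prop} {h : ℕ → V} {Q}
    (hQ : ∀ (V' : Type) (U' : V' → Prop) (M' : Kripke V' ℕ ℕ) (g : ℕ → V' → Prop),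
    Comp N m M U' M' h g → Q V' U' M' g) : LiftC A N m M P h Q := ⟨.nil, trivial, fun V' U' M' g hc _ => hQ V' U' M' g hc⟩

theorem liftC_and {A : Alph} {N m : ℕ} {M : Kripke V ℕ ℕ} {P : ℕ → (ℕ → V) → V → Prop} {h : ℕ → V} {Q Q' Q''}
    (h1 : LiftC A N m M P h Q) (h2 : LiftC A N m M P h Q')
    (hQ : ∀ (V' : Type) (U' : V' → Prop) (M' : Kripke V' ℕ ℕ) (g : ℕ → V' → Prop),
    Comp N m M U' M' h g → Q V' U' M' g → Q' V' U' M' g → Q'' V' U' M' g) : LiftC A N m M P h Q'' := by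
  obtain ⟨f1, a1, b1⟩ := h1
  obtain ⟨f2, a2, b2⟩ := h2
  refine ⟨f1.app f2, rz_app a1 a2, fun V' U' M' g hc he => ?_⟩
  obtain ⟨e1, e2⟩ := emb_app.1 he
  exact hQ V' U' M' g hc (b1 _ _ _ _ hc e1) (b2 _ _ _ _ hc e2)

theorem liftC_mono {A : Alph} {N m : ℕ} {M : Kripke V ℕ ℕ} {P : ℕ → (ℕ → V) → V → Prop} {h : ℕ → V} {Q Q'}
    (h1 : LiftC A N m M P h Q)
    (hQ : ∀ (V' : Type) (U' : V' → Prop) (M' : Kripke V' ℕ ℕ) (g : ℕ → V' → Prop),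
    Comp N m M U' M' h g → Q V' U' M' g → Q' V' U' M' g) : LiftC A N m M P h Q' := by
  obtain ⟨f1, a1, b1⟩ := h1
  exact ⟨f1, a1, fun V' U' M' g hc he => hQ _ _ _ _ hc (b1 _ _ _ _ hc he)⟩

theorem liftC_node {A : Alph} {N m : ℕ} {M : Kripke V ℕ ℕ} {P : ℕ → (ℕ → V) → V → Prop}
    (hP1 : ∀ s h w, P s h w → Lett A N m M s h w) (hP2 : ∀ h w t, t < m → ∃ s, P s h w ∧ A.peb s = t)
    {h : ℕ → V} {Q Q'} {l : ℕ} (hl : l < m) (w : V)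
    (h1 : LiftC A N m M P (Function.update h l w) Q)
    (hQ : ∀ (V' : Type) (U' : V' → Prop) (M' : Kripke V' ℕ ℕ) (g : ℕ → V' → Prop) (x : V'),
    Comp N m M U' M' h g → U' x → Q V' U' M' (upd g l x) → Q' V' U' M' g) : LiftC A N m M P h Q' := by
  obtain ⟨f1, a1, b1⟩ := h1
  obtain ⟨s, hs, rfl⟩ := hP2 h w l hl
  refine ⟨.node s f1 .nil, ⟨w, hs, a1, trivial⟩, fun V' U' M' g hc he => ?_⟩
  obtain ⟨x, hx, e1, e2, e3, _⟩ := he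
  exact hQ _ _ _ _ x hc hx (b1 _ _ _ _ (comp_upd hc (hP1 _ _ _ hs) hx e1 e2) e3)

theorem lift {A : Alph} {N m : ℕ} (hN : 1 ≤ N) (hm : m = N + 4) {M : Kripke V ℕ ℕ} {P : ℕ → (ℕ → V) → V → Prop}
    (hP1 : ∀ s h w, P s h w → Lett A N m M s h w) (hP2 : ∀ h w t, t < m → ∃ s, P s h w ∧ A.peb s = t) :
    ∀ c : Cd, c.bd N → ∀ (h : ℕ → V) (κ : ℕ → ℕ), (∀ i, κ i < m) → (∀ i j, h (κ i) = h (κ j) → κ i = κ j) →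
    lsem (fun _ => True) M c (fun i => h (κ i)) →
    LiftC A N m M P h (fun V' U' M' g => ∀ e', (∀ i, g (κ i) (e' i)) → lsem U' M' c e') := by
  intro c
  induction c with
  | bot => intro _ h κ _ _ hl; exact hl.elim
  | tr => intro _ h κ _ _ hl; exact liftC_nil fun _ _ _ _ _ _ _ => trivial
  | ed a =>
    intro hb h κ hκ _ hl
    exact liftC_nil fun V' U' M' g hc e' he => hc.rl a hb _ (hκ 0) _ (hκ 1) _ _ hl (he 0) (he 1)
  | lb r =>
    intro hb h κ hκ _ hl
    exact liftC_nil fun V' U' M' g hc e' he => hc.vl r hb _ (hκ 0) _ hl (he 0)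
  | or c d ihc ihd =>
    intro hb h κ hκ hi hl
    rcases hl with hl | hl
    · exact liftC_mono (ihc hb.1 h κ hκ hi hl) fun V' U' M' g hc hq e' he => Or.inl (hq e' he)
    · exact liftC_mono (ihd hb.2 h κ hκ hi hl) fun V' U' M' g hc hq e' he => Or.inr (hq e' he)
  | cons c x y C ihc ihC =>
    intro hb h κ hκ hi hl
    obtain ⟨hl1, hl2⟩ := hl
    refine liftC_and (ihc hb.1 h (pe (κ x) (κ y)) (pe_all (P := fun x => x < m) (hκ x) (hκ y)) ?_ ?_) (ihC hb.2.2.2 h κ hκ hi hl2) ?_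
    · intro i j; simp only [pe]; split_ifs <;> intro hh <;> exact hi _ _ hh
    · rw [pe_comp]; exact hl1
    · intro V' U' M' g hc h1 h2 e' he
      refine ⟨h1 _ ?_, h2 e' he⟩
      intro i; simp only [pe]; split_ifs <;> exact he _
  | star c ih =>
    intro hb h κ hκ hi hl
    have key : ∀ u v, Relation.ReflTransGen (fun a b => True ∧ lsem (fun _ => True) M c (pe a b)) u v →
        ∀ (h : ℕ → V) (i j : ℕ), i < m → j < m → h i = u → h j = v → (h i = h j → i = j) →
        LiftC A N m M P h (fun V' U' M' g => ∀ y z, g i y → g j z →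
          Relation.ReflTransGen (fun a b => U' b ∧ lsem U' M' c (pe a b)) y z) := by
      intro u v hr
      induction hr using Relation.ReflTransGen.head_induction_on with
      | refl =>
        intro h i j hi hj hu hv hij
        have := hij (hu.trans hv.symm)
        subst this
        exact liftC_nil fun V' U' M' g hc y z hy hz => by rw [hc.fn _ _ _ hy hz]
      | @head u u' h1 h2 ihs =>
        intro h i j hi hj hu hv hij
        have inj2 : ∀ (h : ℕ → V) (i j : ℕ), (h i = h j → i = j) → ∀ x y, h (pe i j x) = h (pe i j y) → pe i j x = pe i j y := by
          intro h i j hij x y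
          simp only [pe]; split_ifs
          · intro _; rfl
          · exact hij
          · intro hh; exact (hij hh.symm).symm
          · intro _; rfl
        by_cases c1 : u' = h i
        · exact ihs h i j hi hj c1.symm hv hij
        by_cases c2 : u' = h j
        · refine liftC_mono (ih hb h (pe i j) (pe_all (P := fun x => x < m) hi hj) (inj2 h i j hij) ?_) ?_
          · rw [pe_comp, hu, ← c2]; exact h1.2
          · intro V' U' M' g hc hq y z hy hz
            refine Relation.ReflTransGen.single ⟨hc.al _ _ hz, hq _ ?_⟩
            intro x; simp only [pe]; split_ifs
            · exact hy
            · exact hz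
        obtain ⟨l, hl, hfr⟩ := fresh (m := m) (K := 2) (by omega) (pe i j)
        have hil : i ≠ l := hfr 0 (by norm_num)
        have hjl : j ≠ l := hfr 1 (by norm_num)
        have ei : Function.update h l u' i = h i := Function.update_of_ne hil _ _
        have ej : Function.update h l u' j = h j := Function.update_of_ne hjl _ _
        have el : Function.update h l u' l = u' := Function.update_self _ _ _
        have q1 := ih hb (Function.update h l u') (pe i l) (pe_all (P := fun x => x < m) hi hl)
          (inj2 _ i l (by rw [ei, el]; intro hh; exact absurd hh.symm c1)) (by rw [pe_comp, ei, el, hu]; exact h1.2)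
        have q2 := ihs (Function.update h l u') l j hl hj el (ej.trans hv) (by rw [ej, el]; intro hh; exact absurd hh c2)
        refine liftC_node hP1 hP2 hl u' (liftC_and (Q'' := fun V' U' M' g => ∀ x y z, g i y → g l x → U' x → g j z →
          Relation.ReflTransGen (fun a b => U' b ∧ lsem U' M' c (pe a b)) y z) q1 q2 ?_) ?_
        · intro V' U' M' g hc r1 r2 x y z hy hx hux hz
          refine Relation.ReflTransGen.head ⟨hux, r1 (pe y x) ?_⟩ (r2 x z hx hz)
          intro k; simp only [pe]; split_ifs
          · exact hy
          · exact hx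
        · intro V' U' M' g x hc hx hq y z hy hz
          exact hq x y z (upd_ne _ _ _ hil hy) (upd_self _ _ _) hx (upd_ne _ _ _ hjl hz)
    refine liftC_mono (key _ _ hl h (κ 0) (κ 1) (hκ 0) (hκ 1) rfl rfl (hi 0 1)) ?_
    intro V' U' M' g hc hq e' he
    exact hq _ _ (he 0) (he 1)
  | cpr C s t ih =>
    intro hb h κ hκ hi hl
    obtain ⟨hb, hs, ht⟩ := hb
    obtain ⟨φ, _, hφs, hφt, hφ⟩ := hl
    obtain ⟨ψ, hψ0, hψ1, hψ2⟩ : ∃ ψ : ℕ → V, ψ 0 = φ s ∧ ψ 1 = φ t ∧ ∀ i, ψ (i+2) = φ i :=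
      ⟨fun i => match i with | 0 => φ s | 1 => φ t | (i+2) => φ i, rfl, rfl, fun _ => rfl⟩
    have key : ∀ r K, K + r = N + 3 → 2 ≤ K → ∀ (h : ℕ → V) (κ : ℕ → ℕ), (∀ i < K, κ i < m ∧ h (κ i) = ψ i) →
        (∀ i < K, ∀ j < K, h (κ i) = h (κ j) → κ i = κ j) →
        LiftC A N m M P h (fun V' U' M' g => ∀ e' : ℕ → V', (∀ i < K, g (κ i) (e' i)) →
          ∃ e'' : ℕ → V', (∀ i < K, e'' i = e' i) ∧ (∀ i, U' (e'' i)) ∧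
            (∀ i < N + 3, ∀ j < N + 3, ψ i = ψ j → e'' i = e'' j) ∧ lsem U' M' C (fun i => e'' (i+2))) := by
      intro r
      induction r with
      | zero =>
        intro K hK h2 h κ hκ hi
        have hK : K = N + 3 := by omega
        subst hK
        have q := ih hb h (fun i => if i ≤ N then κ (i+2) else κ 2) (by
            intro i; split_ifs
            · exact (hκ _ (by omega)).1
            · exact (hκ _ (by omega)).1) (by
            intro i j; split_ifs <;> exact hi _ (by omega) _ (by omega)) (by
            refine lsem_congr_env hN C hb φ _ ?_ hφ
            intro i hi; rw [if_pos hi, (hκ _ (by omega)).2, hψ2])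
        refine liftC_mono q ?_
        intro V' U' M' g hc hq e' he
        refine ⟨fun i => if i < N + 3 then e' i else e' 2, fun i hi => if_pos hi, ?_, ?_, hq _ ?_⟩
        · intro i; dsimp only; split_ifs with hi'
          · exact hc.al _ _ (he i hi')
          · exact hc.al _ _ (he 2 (by omega))
        · intro i hi' j hj' hij
          dsimp only
          rw [if_pos hi', if_pos hj']
          have e1 : κ i = κ j := hi i hi' j hj' (by rw [(hκ i hi').2, (hκ j hj').2, hij])
          refine hc.fn _ _ _ (he i hi') ?_
          rw [e1]; exact he j hj'
        · intro i; dsimp only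
          by_cases hiN : i ≤ N
          · rw [if_pos hiN, if_pos (by omega)]; exact he _ (by omega)
          · rw [if_neg hiN, if_neg (by omega)]; exact he _ (by omega)
      | succ r ihr =>
        intro K hK h2 h κ hκ hi
        have un : ∀ {X : Type} (k : ℕ → X) (x : X) i, i < K → Function.update k K x i = k i := by
          intro X k x i hi; exact Function.update_of_ne (by omega) _ _
        by_cases c1 : ∃ i < K, ψ i = ψ K
        · obtain ⟨i0, hi0, hψi⟩ := c1
          refine liftC_mono (ihr (K+1) (by omega) (by omega) h (Function.update κ K (κ i0)) ?_ ?_) ?_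
          · intro i hiK
            rcases Nat.lt_succ_iff_lt_or_eq.1 hiK with h' | rfl
            · rw [un _ _ _ h']; exact hκ i h'
            · rw [Function.update_self, ← hψi]; exact hκ i0 hi0
          · intro i hiK j hjK
            rcases Nat.lt_succ_iff_lt_or_eq.1 hiK with h' | rfl <;> rcases Nat.lt_succ_iff_lt_or_eq.1 hjK with h'' | h''
            · rw [un _ _ _ h', un _ _ _ h'']; exact hi i h' j h''
            · subst h''; rw [un _ _ _ h', Function.update_self]; exact hi i h' i0 hi0
            · rw [un _ _ _ h'', Function.update_self]; exact hi i0 hi0 j h''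
            · subst h''; intro _; rfl
          · intro V' U' M' g hc hq e' he
            obtain ⟨e'', g1, g2⟩ := hq (Function.update e' K (e' i0)) (by
              intro i hiK
              rcases Nat.lt_succ_iff_lt_or_eq.1 hiK with h' | rfl
              · rw [un _ _ _ h', un _ _ _ h']; exact he i h'
              · rw [Function.update_self, Function.update_self]; exact he i0 hi0)
            exact ⟨e'', fun i hi => by rw [g1 i (by omega), un _ _ _ hi], g2⟩
        · obtain ⟨l, hl, hfr⟩ := fresh (m := m) (K := K) (by omega) κ
          have uh : ∀ i < K, Function.update h l (ψ K) (κ i) = ψ i := by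
            intro i hi; rw [Function.update_of_ne (hfr i hi)]; exact (hκ i hi).2
          refine liftC_node hP1 hP2 hl (ψ K) (ihr (K+1) (by omega) (by omega) (Function.update h l (ψ K)) (Function.update κ K l) ?_ ?_) ?_
          · intro i hiK
            rcases Nat.lt_succ_iff_lt_or_eq.1 hiK with h' | rfl
            · rw [un _ _ _ h']; exact ⟨(hκ i h').1, uh i h'⟩
            · rw [Function.update_self, Function.update_self]; exact ⟨hl, rfl⟩
          · intro i hiK j hjK
            rcases Nat.lt_succ_iff_lt_or_eq.1 hiK with h' | rfl <;> rcases Nat.lt_succ_iff_lt_or_eq.1 hjK with h'' | h''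
            · rw [un _ _ _ h', un _ _ _ h'', uh _ h', uh _ h'']
              intro hh; exact hi i h' j h'' (by rw [(hκ i h').2, (hκ j h'').2, hh])
            · subst h''; rw [un _ _ _ h', Function.update_self, uh _ h', Function.update_self]
              intro hh; exact absurd ⟨i, h', hh⟩ c1
            · rw [un _ _ _ h'', Function.update_self, uh _ h'', Function.update_self]
              intro hh; exact absurd ⟨j, h'', hh.symm⟩ c1
            · subst h''; intro _; rfl
          · intro V' U' M' g x hc hx hq e' he
            obtain ⟨e'', g1, g2⟩ := hq (Function.update e' K x) (by
              intro i hiK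
              rcases Nat.lt_succ_iff_lt_or_eq.1 hiK with h' | rfl
              · rw [un _ _ _ h', un _ _ _ h']; exact upd_ne _ _ _ (hfr i h') (he i h')
              · rw [Function.update_self, Function.update_self]; exact upd_self _ _ _)
            exact ⟨e'', fun i hi => by rw [g1 i (by omega), un _ _ _ hi], g2⟩
    refine liftC_mono (key (N+1) 2 (by omega) le_rfl h κ ?_ (fun i _ j _ => hi i j)) ?_
    · intro i hi'
      refine ⟨hκ i, ?_⟩
      interval_cases i
      · rw [hψ0, hφs]
      · rw [hψ1, hφt]
    · intro V' U' M' g hc hq e' he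
      obtain ⟨e'', g1, g2, g3, g4⟩ := hq e' (fun i _ => he i)
      refine ⟨fun i => e'' (i+2), fun i => g2 _, ?_, ?_, g4⟩
      · rw [← g1 0 (by omega)]; exact g3 _ (by omega) _ (by omega) (by rw [hψ2, hψ0])
      · rw [← g1 1 (by omega)]; exact g3 _ (by omega) _ (by omega) (by rw [hψ2, hψ1])
end

section
variable {V : Type}

theorem own {A : Alph} {N m : ℕ} {M : Kripke V ℕ ℕ} {E : ℕ → ℕ → Prop} {s : ℕ} {h : ℕ → V} {w : V}
    (hS : Lett A N m M s h w) (hs : s ≠ 0) {f : Fo} (hf : Fol E s f)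
    {Q : ∀ (V' : Type) (U' : V' → Prop) (M' : Kripke V' ℕ ℕ) (g : ℕ → V' → Prop), Prop}
    (hQ : ∀ (V' : Type) (U' : V' → Prop) (M' : Kripke V' ℕ ℕ) (g : ℕ → V' → Prop),
      Comp N m M U' M' (Function.update h (A.peb s) w) g → Emb A N U' M' g f → Q V' U' M' g) :
    Q Pos (Fo.node s f .nil).al (TM A (Fo.node s f .nil).toFun) (fun t y => t = A.peb s ∧ y = []) := by
  apply hQ
  · refine ⟨?_, ?_, ?_, ?_⟩
    · rintro t y ⟨_, rfl⟩; exact hs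
    · rintro t y z ⟨_, rfl⟩ ⟨_, rfl⟩; rfl
    · rintro a ha t ht u hu y z hr ⟨rfl, rfl⟩ ⟨rfl, rfl⟩
      refine Or.inl ⟨Or.inl rfl, ?_⟩
      refine (hS.2.2 a ha _ ht).1.2 ?_
      simpa using hr
    · rintro k hk t ht y hv ⟨rfl, rfl⟩
      refine (hS.2.1 k hk).2 ?_
      simpa using hv
  · refine in_emb f [] _ ?_ (self_in f [] 0 s hf ?_)
    · rintro t y ⟨rfl, rfl⟩; exact ⟨rfl, Or.inl rfl⟩
    · intro r; rfl

theorem crit_complete {A : Alph} {n m N0 d : ℕ} (hm : ∀ s, A.peb s < m) (hmn : m = n + 6) (hd : N0 * WW m n ≤ d)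
    (idx : ℕ → ℕ) (h00 : 0 < N0) {M : Kripke V ℕ ℕ}
    (hlet : ∀ (h : ℕ → V) w t j, t < m → 1 ≤ j → j ≤ 2 ^ WW m n →
      ∃ s, Lett A (n+2) m M s h w ∧ A.peb s = t ∧ idx s = j ∧ s < N0 ∧ s ≠ 0)
    (hG : Good n M) (v0 : V) (hv0 : M.val n v0) : ∃ E, CritE A n N0 d E := by
  classical
  have : Nonempty V := ⟨v0⟩
  obtain ⟨D, hfin, nl, δ, acc, hcard, hacc⟩ := rec_viol A m n hm
  have : Fintype D := Fintype.ofFinite D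
  obtain ⟨ι, hι, hι1⟩ : ∃ ι : Set D → ℕ, Function.Injective ι ∧ ∀ X, 1 ≤ ι X ∧ ι X ≤ 2 ^ WW m n := by
    have e := Fintype.equivFin (Set D)
    refine ⟨fun X => (e X).1 + 1, ?_, ?_⟩
    · intro X Y hXY
      exact e.injective (Fin.ext (by simpa using hXY))
    · intro X
      have h1 := (e X).2
      have h2 : Fintype.card (Set D) = 2 ^ Nat.card D := by rw [Fintype.card_set, Nat.card_eq_fintype_card]
      have h3 : 2 ^ Nat.card D ≤ 2 ^ WW m n := Nat.pow_le_pow_right (by norm_num) hcard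
      dsimp only; omega
  let Θ : (ℕ → V) → Set D := fun h => {q | ∃ f, Rz A (Lett A (n+2) m M) h f ∧ crun nl δ f = q}
  let h0 : ℕ → V := fun _ => v0
  let St : ℕ → (ℕ → V) → V → Prop := fun s h w => Lett A (n+2) m M s h w ∧ s < N0 ∧ s ≠ 0 ∧
    idx s = ι (Θ (Function.update h (A.peb s) w))
  let Th : ℕ → Set D := fun s => {q | (s = 0 ∧ q ∈ Θ h0) ∨ (s ≠ 0 ∧ ∃ X, ι X = idx s ∧ q ∈ X)}
  have Th0 : Th 0 = Θ h0 := by ext q; simp [Th]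
  have ThS : ∀ s h w, St s h w → Th s = Θ (Function.update h (A.peb s) w) := by
    rintro s h w ⟨h1, h2, h3, h4⟩
    ext q
    constructor
    · rintro (⟨h5, _⟩ | ⟨_, X, hX, hq⟩)
      · exact absurd h5 h3
      · rw [h4] at hX; rw [← hι hX]; exact hq
    · intro hq; exact Or.inr ⟨h3, _, h4.symm, hq⟩
  let Rl : ℕ → Prop := fun s => ∃ h w, St s h w
  let E : ℕ → ℕ → Prop := fun a s => Rl s ∧ (a = 0 ∨ Rl a) ∧ ∀ q1 ∈ Th s, ∀ q2 ∈ Th a, δ s q1 q2 ∈ Th a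
  have hP1 : ∀ s h w, St s h w → Lett A (n+2) m M s h w := fun s h w hs => hs.1
  have hP2 : ∀ h w t, t < m → ∃ s, St s h w ∧ A.peb s = t := by
    intro h w t ht
    obtain ⟨s, h1, h2, h3, h4, h5⟩ := hlet h w t (ι (Θ (Function.update h t w))) ht (hι1 _).1 (hι1 _).2
    subst h2
    exact ⟨s, ⟨h1, h4, h5, h3⟩, rfl⟩
  have nlΘ : ∀ h, nl ∈ Θ h := fun h => ⟨.nil, trivial, rfl⟩
  have nlT : ∀ a, (a = 0 ∨ Rl a) → nl ∈ Th a := by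
    rintro a (rfl | ⟨h, w, hh⟩)
    · rw [Th0]; exact nlΘ _
    · rw [ThS _ _ _ hh]; exact nlΘ _
  have rzfol : ∀ f a h, (a = 0 ∨ Rl a) → Th a = Θ h → Rz A St h f → Fol E a f := by
    intro f
    induction f with
    | nil => intros; trivial
    | node s f1 f2 ih1 ih2 =>
      intro a h ha hT hr
      obtain ⟨w, hS, hr1, hr2⟩ := hr
      refine ⟨⟨⟨h, w, hS⟩, ha, ?_⟩, hS.2.2.1, ih1 s _ (Or.inr ⟨h, w, hS⟩) (ThS _ _ _ hS) hr1, ih2 a h ha hT hr2⟩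
      rw [hT, ThS _ _ _ hS]
      rintro _ ⟨f1, hf1, rfl⟩ _ ⟨f2, hf2, rfl⟩
      exact ⟨.node s f1 f2, ⟨w, hS.1, hf1, hf2⟩, rfl⟩
  have folT : ∀ f a, (a = 0 ∨ Rl a) → Fol E a f → crun nl δ f ∈ Th a := by
    intro f
    induction f with
    | nil => intro a ha _; exact nlT a ha
    | node s f1 f2 ih1 ih2 =>
      rintro a ha ⟨⟨hR, _, hE⟩, _, h1, h2⟩
      exact hE _ (ih1 s (Or.inr hR) h1) _ (ih2 a ha h2)
  have hb : ∀ a b, E a b → a < N0 ∧ b < N0 ∧ b ≠ 0 := by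
    rintro a b ⟨⟨h, w, hS⟩, ha, _⟩
    refine ⟨?_, hS.2.1, hS.2.2.1⟩
    rcases ha with rfl | ⟨h, w, hS⟩
    · exact h00
    · exact hS.2.1
  have wit : ∀ s h w, St s h w → ∀ k, k ≤ n → ∀ y, lsem (fun _ => True) M (dec k) (pe w y) →
      ∃ f, Fol E s f ∧ Wit3 A k (.node s f .nil) ∧ (y = w → Wit4 A k (.node s f .nil)) := by
    intro s h w hS k hk y hl
    have hbd := Cd.bd_mono (show k + 2 ≤ n + 2 by omega) _ (dec_bd k)
    by_cases hyw : y = w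
    · subst hyw
      obtain ⟨f, hr, hq⟩ := lift (N := n+2) (by omega) (by omega) hP1 hP2 (dec k) hbd (Function.update h (A.peb s) y) (fun _ => A.peb s)
        (fun _ => hS.1.1) (fun _ _ _ => rfl) (by
          have : (fun i : ℕ => Function.update h (A.peb s) y (A.peb s)) = pe y y := by
            funext i; simp [pe]
          rw [this]; exact hl)
      have hf := rzfol f s _ (Or.inr ⟨h, y, hS⟩) (ThS _ _ _ hS) hr
      have := own hS.1 hS.2.2.1 hf hq (pe [] []) (pe_all (P := fun x => A.peb s = A.peb s ∧ x = []) ⟨rfl, rfl⟩ ⟨rfl, rfl⟩)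
      exact ⟨f, hf, ⟨hS.2.2.1, [], hS.2.2.1, this⟩, fun _ => ⟨hS.2.2.1, this⟩⟩
    · obtain ⟨l, hlm, hne⟩ := fresh (m := m) (K := 1) (by omega) (fun _ => A.peb s)
      have hne : A.peb s ≠ l := hne 0 (by omega)
      have e0 : Function.update (Function.update h (A.peb s) w) l y (A.peb s) = w := by
        rw [Function.update_of_ne hne, Function.update_self]
      have e1 : Function.update (Function.update h (A.peb s) w) l y l = y := Function.update_self ..
      have q := lift (N := n+2) (by omega) (by omega) hP1 hP2 (dec k) hbd (Function.update (Function.update h (A.peb s) w) l y) (pe (A.peb s) l)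
        (pe_all (P := fun x => x < m) hS.1.1 hlm) (by
          intro i j
          simp only [pe]
          split_ifs <;> simp only [e0, e1]
          · exact fun _ => trivial
          · exact fun hh => absurd hh.symm hyw
          · exact fun hh => absurd hh hyw
          · exact fun _ => trivial) (by
          rw [pe_comp, e0, e1]; exact hl)
      have q2 := liftC_node hP1 hP2 (h := Function.update h (A.peb s) w)
        (Q' := fun V' U' M' g => ∀ x, g (A.peb s) x → ∃ y, U' y ∧ lsem U' M' (dec k) (pe x y)) hlm y q (by
          intro V' U' M' g x hc hx hq z hz
          refine ⟨x, hx, hq _ ?_⟩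
          intro i; simp only [pe]; split_ifs
          · exact upd_ne _ _ _ hne hz
          · exact upd_self _ _ _)
      obtain ⟨f, hr, hq⟩ := q2
      have hf := rzfol f s _ (Or.inr ⟨h, w, hS⟩) (ThS _ _ _ hS) hr
      have := own hS.1 hS.2.2.1 hf hq [] ⟨rfl, rfl⟩
      exact ⟨f, hf, ⟨hS.2.2.1, this⟩, fun hh => absurd hh hyw⟩
  have pmp : ∀ s f, s < N0 → Fol E s f → ∀ Q, Rec (WW m n) Q → Q (.node s f .nil) →
      ∃ f, f.depth ≤ d ∧ Fol E s f ∧ Q (.node s f .nil) := by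
    rintro s f hs hf Q ⟨D, _, nl, δ, acc, hc, hQ⟩ hq
    obtain ⟨f', h1, h2, h3⟩ := pump nl δ E N0 (fun a b h => (hb a b h).2.1) s hs f hf
    refine ⟨f', h3.trans ((Nat.mul_le_mul_left _ hc).trans hd), h1, ?_⟩
    rw [hQ] at hq ⊢
    simp only [crun] at hq ⊢
    rw [h2]; exact hq
  refine ⟨E, hb, ?_, ?_, ?_⟩
  · obtain ⟨s, hS, _⟩ := hP2 h0 v0 0 (by omega)
    have := rzfol (.node s .nil .nil) 0 h0 (Or.inl rfl) Th0 ⟨v0, hS, trivial, trivial⟩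
    exact ⟨s, this.1, (hS.1.2.1 n (by omega)).2 hv0⟩
  · rintro a s ⟨⟨h, w, hS⟩, _, _⟩
    refine ⟨?_, ⟨?_, ?_⟩, ?_⟩
    · obtain ⟨s', hS', _⟩ := hP2 (Function.update h (A.peb s) w) w 0 (by omega)
      have := rzfol (.node s' .nil .nil) s _ (Or.inr ⟨h, w, hS⟩) (ThS _ _ _ hS) ⟨w, hS', trivial, trivial⟩
      exact ⟨s', this.1⟩
    · intro k hk
      have := Nat.add_le_pair 1 k
      rw [hS.1.2.1 _ (by omega), hS.1.2.1 _ (by omega), hG.1 k w hk]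
    · intro k l hk
      have := Nat.add_le_pair 2 (Nat.pair k l)
      have := Nat.add_le_pair k l
      rw [hS.1.2.1 _ (by omega), hS.1.2.1 _ (by omega), hS.1.2.1 _ (by omega), hG.2.1 k l w hk]
    · intro k hk
      refine ⟨fun hp hl => ?_, fun hp hl => ?_⟩
      · rw [hS.1.2.1 _ (by omega), hG.2.2.1 k w hp] at hl
        obtain ⟨y, hy⟩ := hl
        obtain ⟨f, h1, h2, _⟩ := wit s h w hS k hk y hy
        exact pmp s f hS.2.1 h1 _ (rec_wit3 A m n hm hk) h2
      · rw [hS.1.2.1 _ (by omega), hG.2.2.2 k w hp] at hl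
        obtain ⟨f, h1, _, h2⟩ := wit s h w hS k hk w hl
        exact pmp s f hS.2.1 h1 _ (rec_wit4 A m n hm hk) (h2 rfl)
  · intro f _ hf
    have h1 := folT f 0 (Or.inl rfl) hf
    rw [Th0] at h1
    obtain ⟨f', hr, hc⟩ := h1
    rw [hacc, ← hc, ← hacc]
    obtain ⟨F, hF⟩ := emb_hom f' _ (rz_emb hr)
    rintro ⟨x, hx, k, hk, ⟨hp, ⟨y, hy, hl⟩, hn⟩ | ⟨hp, hl, hn⟩⟩
    · apply hn
      rw [hF.2.1 x hx _ (by omega), hG.2.2.1 _ _ hp]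
      exact ⟨_, lsem_homc hF (by omega) hx hy hl⟩
    · apply hn
      rw [hF.2.1 x hx _ (by omega), hG.2.2.2 _ _ hp]
      exact lsem_homc hF (by omega) hx hx hl

end

/-! concrete alphabet -/
def alph (m : ℕ) : Alph where
  peb s := s % m
  lab s k := (s / m).testBit (Nat.pair 0 k)
  inn s a t := (s / m).testBit (Nat.pair 1 (Nat.pair a t))
  out s a t := (s / m).testBit (Nat.pair 2 (Nat.pair a t))

def LLf (m : ℕ) : ℕ := Nat.pair 2 (Nat.pair m m) + 1
def N0f (m n : ℕ) : ℕ := m * 2 ^ LLf m * (2 ^ WW m n + 1)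

theorem letter (m t j : ℕ) (ht : t < m) (B : ℕ → Prop) :
    ∃ s, s % m = t ∧ s / (m * 2 ^ LLf m) = j ∧ ∀ i < LLf m, ((s / m).testBit i = true ↔ B i) := by
  classical
  let b := Nat.ofBits (fun i : Fin (LLf m) => decide (B i))
  have hb : b < 2 ^ LLf m := Nat.ofBits_lt_two_pow _
  refine ⟨t + m * (b + 2 ^ LLf m * j), ?_, ?_, ?_⟩
  · rw [Nat.add_mul_mod_self_left, Nat.mod_eq_of_lt ht]
  · rw [← Nat.div_div_eq_div_mul, Nat.add_mul_div_left _ _ (by omega), Nat.div_eq_of_lt ht, zero_add,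
      Nat.add_mul_div_left _ _ (by positivity), Nat.div_eq_of_lt hb, zero_add]
  · intro i hi
    rw [Nat.add_mul_div_left _ _ (by omega), Nat.div_eq_of_lt ht, zero_add, add_comm,
      Nat.testBit_two_pow_mul_add _ hb, if_pos hi, Nat.testBit_ofBits_lt _ _ hi]
    simp

theorem lt_N0 {c s q j : ℕ} (hc : 0 < c) (h : s / c = j) (hj : j ≤ q) : s < c * (q + 1) := by
  rw [Nat.mul_comm, ← Nat.div_lt_iff_lt_mul hc]; omega

theorem crit_iff (n : ℕ) :
    (∃ (W : Type) (M : Kripke W ℕ ℕ) (w : W), Good n M ∧ M.val n w) ↔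
    ∃ E, CritE (alph (n+6)) n (N0f (n+6) n) (N0f (n+6) n * WW (n+6) n) E := by
  have hm : ∀ s, (alph (n+6)).peb s < n + 6 := fun s => Nat.mod_lt _ (by omega)
  constructor
  · rintro ⟨V, M, v0, hG, hv⟩
    refine crit_complete hm rfl le_rfl (fun s => s / ((n+6) * 2 ^ LLf (n+6))) ?_ ?_ hG v0 hv
    · unfold N0f; positivity
    · intro h w t j ht hj1 hj2
      have hpos : 0 < n + 6 := by omega
      unfold N0f
      generalize hWW : WW (n+6) n = Wn at *
      generalize hmm : n + 6 = m at *
      clear hWW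
      obtain ⟨s, h1, h2, h3⟩ := letter m t j ht (fun i =>
        (∃ k, i = Nat.pair 0 k ∧ M.val k w) ∨
        (∃ a u, i = Nat.pair 1 (Nat.pair a u) ∧ M.rel a (Function.update h t w u) w) ∨
        (∃ a u, i = Nat.pair 2 (Nat.pair a u) ∧ M.rel a w (Function.update h t w u)))
      have hp : (alph m).peb s = t := h1
      have bnd : ∀ a ≤ m, ∀ u ≤ m, ∀ c ≤ 2, Nat.pair c (Nat.pair a u) < LLf m := by
        intro a ha u hu c hc
        unfold LLf
        have p1 : ∀ {a b c d : ℕ}, a ≤ c → b ≤ d → Nat.pair a b ≤ Nat.pair c d := by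
          intro a b c d h1 h2
          rcases h1.lt_or_eq with h1 | rfl
          · rcases h2.lt_or_eq with h2 | rfl
            · exact ((Nat.pair_lt_pair_left _ h1).trans (Nat.pair_lt_pair_right _ h2)).le
            · exact (Nat.pair_lt_pair_left _ h1).le
          · rcases h2.lt_or_eq with h2 | rfl
            · exact (Nat.pair_lt_pair_right _ h2).le
            · exact le_rfl
        exact Nat.lt_succ_of_le (p1 hc (p1 ha hu))
      refine ⟨s, ⟨by rw [hp]; exact ht, ?_, ?_⟩, hp, h2, ?_, ?_⟩
      · intro k hk
        have hlt : Nat.pair 0 k < LLf m := by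
          refine lt_of_le_of_lt ?_ (bnd m le_rfl m le_rfl 2 le_rfl)
          rcases Nat.eq_zero_or_pos k with rfl | hk0
          · simp [Nat.pair]
          · have e1 : Nat.pair 0 k ≤ Nat.pair 0 m := by
              rcases (show k ≤ m by omega).lt_or_eq with h' | rfl
              · exact (Nat.pair_lt_pair_right _ h').le
              · exact le_rfl
            have e2 : Nat.pair 0 m < Nat.pair 2 m := Nat.pair_lt_pair_left _ (by omega)
            have e3 : Nat.pair 2 m ≤ Nat.pair 2 (Nat.pair m m) := by
              rcases (show m ≤ Nat.pair m m from Nat.left_le_pair _ _).lt_or_eq with h' | h'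
              · exact (Nat.pair_lt_pair_right _ h').le
              · rw [← h']
            omega
        refine (h3 _ hlt).trans ?_
        simp [Nat.pair_eq_pair]
      · intro a ha u hu
        rw [hp]
        refine ⟨(h3 _ (bnd a (by omega) u (by omega) 1 (by omega))).trans ?_, (h3 _ (bnd a (by omega) u (by omega) 2 (by omega))).trans ?_⟩
        · simp [Nat.pair_eq_pair]
        · simp [Nat.pair_eq_pair]
      · exact lt_N0 (by positivity) h2 hj2
      · rintro rfl; rw [Nat.zero_div] at h2; omega
  · rintro ⟨E, hE⟩
    exact crit_sound hm le_rfl hE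

/-! ### Part E : arithmetization -/
class PF {α β : Type} [Primcodable α] [Primcodable β] (f : α → β) : Prop where
  out : Primrec f
class PPr {α : Type} [Primcodable α] (p : α → Prop) : Prop where
  out : PrimrecPred p

section
variable {α : Type} [Primcodable α] {β : Type} [Primcodable β] {γ : Type} [Primcodable γ]

instance pfId : PF (fun a : α => a) := ⟨Primrec.id⟩
instance pfConst (c : β) : PF (fun _ : α => c) := ⟨Primrec.const c⟩
instance pfFst {f : α → β × γ} [h : PF f] : PF (fun a => (f a).1) := ⟨Primrec.fst.comp h.out⟩
instance pfSnd {f : α → β × γ} [h : PF f] : PF (fun a => (f a).2) := ⟨Primrec.snd.comp h.out⟩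
instance pfAdd {f g : α → ℕ} [hf : PF f] [hg : PF g] : PF (fun a => f a + g a) := ⟨Primrec.nat_add.comp hf.out hg.out⟩
instance pfMul {f g : α → ℕ} [hf : PF f] [hg : PF g] : PF (fun a => f a * g a) := ⟨Primrec.nat_mul.comp hf.out hg.out⟩
instance pfDiv {f g : α → ℕ} [hf : PF f] [hg : PF g] : PF (fun a => f a / g a) := ⟨Primrec.nat_div.comp hf.out hg.out⟩
instance pfMod {f g : α → ℕ} [hf : PF f] [hg : PF g] : PF (fun a => f a % g a) := ⟨Primrec.nat_mod.comp hf.out hg.out⟩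
instance pfPair {f g : α → ℕ} [hf : PF f] [hg : PF g] : PF (fun a => Nat.pair (f a) (g a)) := ⟨Primrec₂.natPair.comp hf.out hg.out⟩
instance pfUnpair {f : α → ℕ} [hf : PF f] : PF (fun a => Nat.unpair (f a)) := ⟨Primrec.unpair.comp hf.out⟩

theorem primrec_pow : Primrec₂ (fun a b : ℕ => a ^ b) := by
  have h : Primrec₂ (fun (a : ℕ) (b : ℕ) => (Nat.rec 1 (fun _ y => y * a) b : ℕ)) :=
    Primrec.nat_rec (f := fun _ : ℕ => 1) (g := fun a (p : ℕ × ℕ) => p.2 * a) (Primrec.const 1)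
      (Primrec.nat_mul.comp (Primrec.snd.comp Primrec.snd) Primrec.fst)
  refine h.of_eq fun a b => ?_
  induction b with
  | zero => rfl
  | succ b ih => simp only [pow_succ, ← ih]

instance pfPow {f g : α → ℕ} [hf : PF f] [hg : PF g] : PF (fun a => f a ^ g a) := ⟨primrec_pow.comp hf.out hg.out⟩

theorem primrec_lev : Primrec₂ lev := by
  have h : Primrec₂ (fun (a : ℕ) (b : ℕ) => (Nat.rec a (fun _ y => y * 2 ^ y) b : ℕ)) :=
    Primrec.nat_rec (f := fun a : ℕ => a) (g := fun a (p : ℕ × ℕ) => p.2 * 2 ^ p.2) Primrec.id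
      (Primrec.nat_mul.comp (Primrec.snd.comp Primrec.snd) (primrec_pow.comp (Primrec.const 2) (Primrec.snd.comp Primrec.snd)))
  refine h.of_eq fun a b => ?_
  induction b with
  | zero => rfl
  | succ b ih => simp only [lev, ← ih]

instance pfLev {f g : α → ℕ} [hf : PF f] [hg : PF g] : PF (fun a => lev (f a) (g a)) := ⟨primrec_lev.comp hf.out hg.out⟩
instance pfWW {f g : α → ℕ} [hf : PF f] [hg : PF g] : PF (fun a => WW (f a) (g a)) := by unfold WW; infer_instance
instance pfN0f {f g : α → ℕ} [hf : PF f] [hg : PF g] : PF (fun a => N0f (f a) (g a)) := by unfold N0f LLf; infer_instance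

instance ppNot {p : α → Prop} [h : PPr p] : PPr (fun a => ¬ p a) := ⟨h.out.not⟩
instance ppAnd {p q : α → Prop} [h : PPr p] [h' : PPr q] : PPr (fun a => p a ∧ q a) := ⟨h.out.and h'.out⟩
instance ppOr {p q : α → Prop} [h : PPr p] [h' : PPr q] : PPr (fun a => p a ∨ q a) := ⟨h.out.or h'.out⟩
instance ppImp {p q : α → Prop} [h : PPr p] [h' : PPr q] : PPr (fun a => p a → q a) :=
  ⟨(h.out.not.or h'.out).of_eq fun a => by tauto⟩
instance ppIff {p q : α → Prop} [h : PPr p] [h' : PPr q] : PPr (fun a => p a ↔ q a) :=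
  ⟨((h.out.and h'.out).or (h.out.not.and h'.out.not)).of_eq fun a => by tauto⟩
instance ppLt {f g : α → ℕ} [hf : PF f] [hg : PF g] : PPr (fun a => f a < g a) := ⟨Primrec.nat_lt.comp hf.out hg.out⟩
instance ppLe {f g : α → ℕ} [hf : PF f] [hg : PF g] : PPr (fun a => f a ≤ g a) := ⟨Primrec.nat_le.comp hf.out hg.out⟩
instance ppEq {f g : α → ℕ} [hf : PF f] [hg : PF g] : PPr (fun a => f a = g a) := ⟨Primrec.eq.comp hf.out hg.out⟩
instance ppNe {f g : α → ℕ} [hf : PF f] [hg : PF g] : PPr (fun a => f a ≠ g a) := ⟨(Primrec.eq.comp hf.out hg.out).not⟩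

instance ppEx {t : α → ℕ} {P : α → ℕ → Prop} [ht : PF t] [h : PPr (fun p : α × ℕ => P p.1 p.2)] :
    PPr (fun a => ∃ x, x < t a ∧ P a x) := by
  have h1 : PrimrecRel (fun (x : ℕ) (a : α) => P a x) := h.out.comp (Primrec.pair Primrec.snd Primrec.fst)
  exact ⟨(h1.exists_mem_list.comp (Primrec.list_range.comp ht.out) Primrec.id).of_eq (by simp)⟩
instance ppAll {t : α → ℕ} {P : α → ℕ → Prop} [ht : PF t] [h : PPr (fun p : α × ℕ => P p.1 p.2)] :
    PPr (fun a => ∀ x, x < t a → P a x) := by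
  have h1 : PrimrecRel (fun (x : ℕ) (a : α) => P a x) := h.out.comp (Primrec.pair Primrec.snd Primrec.fst)
  exact ⟨(h1.forall_mem_list.comp (Primrec.list_range.comp ht.out) Primrec.id).of_eq (by simp)⟩
end

/-- digits -/
def dg (b w i : ℕ) : ℕ := w / b ^ i % b

section
variable {α : Type} [Primcodable α]
instance pfDg {f g h : α → ℕ} [PF f] [PF g] [PF h] : PF (fun a => dg (f a) (g a) (h a)) := by unfold dg; infer_instance

end

def bt (c i : ℕ) : Prop := dg 2 c i = 1
def labN (n s k : ℕ) : Prop := bt (s / (n+6)) (Nat.pair 0 k)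
def AncN (p q : ℕ) : Prop := ∃ j, j < q + 1 ∧ q / 2 ^ j = 2 * p
def VisN (n N0 w p q : ℕ) : Prop := p = q ∨ (AncN p q ∧ ∀ p', p' < q + 1 → 1 ≤ p' → AncN p p' →
  (AncN p' q ∨ p' = q) → dg N0 w p' % (n+6) ≠ dg N0 w p % (n+6))
def RN (n N0 w a p q : ℕ) : Prop :=
  (VisN n N0 w p q ∧ bt (dg N0 w q / (n+6)) (Nat.pair 1 (Nat.pair a (dg N0 w p % (n+6))))) ∨
  (VisN n N0 w q p ∧ bt (dg N0 w p / (n+6)) (Nat.pair 2 (Nat.pair a (dg N0 w q % (n+6)))))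
def UN (N0 w i : ℕ) : Prop := 1 ≤ i ∧ dg N0 w i ≠ 0
def EU (n N0 w V e : ℕ) : Prop := ∀ i, i < n + 3 → UN N0 w (dg V e i)
def Tb (n V T k e : ℕ) : Prop := bt T (k * V ^ (n+3) + e)
def TP (n V T k x y : ℕ) : Prop := ∃ z, z < V ^ (n+3) ∧ dg V z 0 = x ∧ (∀ i, i < n + 3 → 1 ≤ i → dg V z i = y) ∧ Tb n V T k z
def StA (n N0 w V T t r e : ℕ) : Prop :=
  (t = 5 ∧ dg V e 0 = dg V e 1) ∨ (t = 6 ∧ RN n N0 w r (dg V e 0) (dg V e 1)) ∨ (t = 7 ∧ RN n N0 w r (dg V e 1) (dg V e 0)) ∨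
  (t = 8 ∧ (Tb n V T r.unpair.1 e ∨ Tb n V T r.unpair.2 e)) ∨
  (t = 9 ∧ ∃ z, z < V ∧ UN N0 w z ∧ TP n V T r.unpair.1 (dg V e 0) z ∧ TP n V T r.unpair.2 z (dg V e 1))
def StB (n N0 w V T t r e : ℕ) : Prop :=
  (t = 10 ∧ ¬ ∃ Z, Z < 2 ^ V ∧ (bt Z (dg V e 0) ∧ ¬ bt Z (dg V e 1)) ∧
    ¬ ∃ a, a < V ∧ ∃ b, b < V ∧ bt Z a ∧ ¬ bt Z b ∧ UN N0 w a ∧ UN N0 w b ∧ TP n V T r a b) ∨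
  (t = 11 ∧ dg V e 0 = dg V e 1 ∧ labN n (dg N0 w (dg V e 0)) r) ∨
  (t = 12 ∧ TP n V T r.unpair.1 (dg V e 0) (dg V e 1) ∧ TP n V T r.unpair.2 (dg V e 0) (dg V e 1)) ∨
  (t = 13 ∧ ∃ z, z < V ^ (n+3) ∧ EU n N0 w V z ∧ dg V z r.unpair.2.unpair.1 = dg V e 0 ∧ dg V z r.unpair.2.unpair.2 = dg V e 1 ∧ Tb n V T r.unpair.1 z) ∨
  t = 14 ∨
  (t = 15 ∧ TP n V T r.unpair.1 (dg V e r.unpair.2.unpair.1) (dg V e r.unpair.2.unpair.2.unpair.1) ∧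
    Tb n V T r.unpair.2.unpair.2.unpair.2 e)
def StN (n N0 w V T k e : ℕ) : Prop := StA n N0 w V T k.unpair.1 k.unpair.2 e ∨ StB n N0 w V T k.unpair.1 k.unpair.2 e
def TabN (n N0 w V T : ℕ) : Prop := ∀ k, k < n + 1 → ∀ e, e < V ^ (n+3) → EU n N0 w V e → (Tb n V T k e ↔ StN n N0 w V T k e)
def LS (n N0 w V k x y : ℕ) : Prop := ∃ T, T < 2 ^ ((n+1) * V ^ (n+3)) ∧ TabN n N0 w V T ∧ TP n V T k x y
def W3N (n N0 w V k : ℕ) : Prop := UN N0 w 1 ∧ ∃ y, y < V ∧ UN N0 w y ∧ LS n N0 w V k 1 y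
def W4N (n N0 w V k : ℕ) : Prop := UN N0 w 1 ∧ LS n N0 w V k 1 1
def VioN (n N0 w V : ℕ) : Prop := ∃ x, x < V ∧ UN N0 w x ∧ ∃ k, k < n + 1 ∧
  ((Nat.pair 3 k ≤ n ∧ (∃ y, y < V ∧ UN N0 w y ∧ LS n N0 w V k x y) ∧ ¬ labN n (dg N0 w x) (Nat.pair 3 k)) ∨
  (Nat.pair 4 k ≤ n ∧ LS n N0 w V k x x ∧ ¬ labN n (dg N0 w x) (Nat.pair 4 k)))
def EN (N0 c a b : ℕ) : Prop := a < N0 ∧ b < N0 ∧ bt c (a * N0 + b)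
def FF (N0 V c a w v : ℕ) : Prop := dg N0 v 1 = a ∧ (∀ i, i < V → 1 ≤ i → dg N0 w i ≠ 0 → EN N0 c (dg N0 v i) (dg N0 w i)) ∧
  ∀ i, i < V → 1 ≤ i → 2 * i + 1 < V →
    (dg N0 w i ≠ 0 → dg N0 v (2*i) = dg N0 w i ∧ dg N0 v (2*i+1) = dg N0 v i) ∧
    (dg N0 w (2*i) ≠ 0 ∨ dg N0 w (2*i+1) ≠ 0 → dg N0 w i ≠ 0)
def LokN (n s : ℕ) : Prop := (∀ k, k < n + 1 → Nat.pair 1 k ≤ n → (labN n s (Nat.pair 1 k) ↔ ¬ labN n s k)) ∧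
  ∀ k, k < n + 1 → ∀ l, l < n + 1 → Nat.pair 2 (Nat.pair k l) ≤ n →
    (labN n s (Nat.pair 2 (Nat.pair k l)) ↔ (labN n s k ∧ labN n s l))
def CritN (n N0 d c : ℕ) : Prop :=
  (∀ a, a < N0 → ∀ b, b < N0 → EN N0 c a b → b ≠ 0) ∧ (∃ s, s < N0 ∧ EN N0 c 0 s ∧ labN n s n) ∧
  (∀ a, a < N0 → ∀ s, s < N0 → EN N0 c a s → (∃ s', s' < N0 ∧ EN N0 c s s') ∧ LokN n s ∧ ∀ k, k < n + 1 →
    (Nat.pair 3 k ≤ n → labN n s (Nat.pair 3 k) → ∃ w, w < N0 ^ (2^(d+1)) ∧ ∃ v, v < N0 ^ (2^(d+1)) ∧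
      FF N0 (2^(d+1)) c a w v ∧ dg N0 w 1 = s ∧ dg N0 w 3 = 0 ∧ W3N n N0 w (2^(d+1)) k) ∧
    (Nat.pair 4 k ≤ n → labN n s (Nat.pair 4 k) → ∃ w, w < N0 ^ (2^(d+1)) ∧ ∃ v, v < N0 ^ (2^(d+1)) ∧
      FF N0 (2^(d+1)) c a w v ∧ dg N0 w 1 = s ∧ dg N0 w 3 = 0 ∧ W4N n N0 w (2^(d+1)) k)) ∧
  ∀ w, w < N0 ^ (2^d) → ∀ v, v < N0 ^ (2^d) → FF N0 (2^d) c 0 w v → ¬ VioN n N0 w (2^d)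
def CC (n : ℕ) : Prop := ∃ c, c < 2 ^ (N0f (n+6) n * N0f (n+6) n) ∧ CritN n (N0f (n+6) n) (N0f (n+6) n * WW (n+6) n) c

section
variable {α : Type} [Primcodable α] {β : Type} [Primcodable β] {γ : Type} [Primcodable γ]
instance pfPr {f : α → β} {g : α → γ} [hf : PF f] [hg : PF g] : PF (fun a => (f a, g a)) := ⟨Primrec.pair hf.out hg.out⟩
theorem PPr.cmp {p : β → Prop} (h : PPr p) {g : α → β} (hg : PF g) : PPr (fun a => p (g a)) := ⟨h.out.comp hg.out⟩
variable {f1 f2 f3 f4 f5 f6 f7 f8 : α → ℕ} [PF f1] [PF f2] [PF f3] [PF f4] [PF f5] [PF f6] [PF f7] [PF f8]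
set_option synthInstance.maxSize 1000000000
set_option synthInstance.maxHeartbeats 2000000
set_option maxHeartbeats 4000000
theorem pq1 : PPr (fun p : ℕ × ℕ => bt p.1 p.2) := by unfold bt; infer_instance
instance pp1 : PPr (fun a => bt (f1 a) (f2 a)) := pq1.cmp (g := fun a => (f1 a, f2 a)) inferInstance
theorem pq2 : PPr (fun p : ℕ × ℕ × ℕ => labN p.1 p.2.1 p.2.2) := by unfold labN; infer_instance
instance pp2 : PPr (fun a => labN (f1 a) (f2 a) (f3 a)) := pq2.cmp (g := fun a => (f1 a, f2 a, f3 a)) inferInstance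
theorem pq3 : PPr (fun p : ℕ × ℕ => AncN p.1 p.2) := by unfold AncN; infer_instance
instance pp3 : PPr (fun a => AncN (f1 a) (f2 a)) := pq3.cmp (g := fun a => (f1 a, f2 a)) inferInstance
theorem pq4 : PPr (fun p : ℕ × ℕ × ℕ × ℕ × ℕ => VisN p.1 p.2.1 p.2.2.1 p.2.2.2.1 p.2.2.2.2) := by unfold VisN; infer_instance
instance pp4 : PPr (fun a => VisN (f1 a) (f2 a) (f3 a) (f4 a) (f5 a)) := pq4.cmp (g := fun a => (f1 a, f2 a, f3 a, f4 a, f5 a)) inferInstance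
theorem pq5 : PPr (fun p : ℕ × ℕ × ℕ × ℕ × ℕ × ℕ => RN p.1 p.2.1 p.2.2.1 p.2.2.2.1 p.2.2.2.2.1 p.2.2.2.2.2) := by unfold RN; infer_instance
instance pp5 : PPr (fun a => RN (f1 a) (f2 a) (f3 a) (f4 a) (f5 a) (f6 a)) := pq5.cmp (g := fun a => (f1 a, f2 a, f3 a, f4 a, f5 a, f6 a)) inferInstance
theorem pq6 : PPr (fun p : ℕ × ℕ × ℕ => UN p.1 p.2.1 p.2.2) := by unfold UN; infer_instance
instance pp6 : PPr (fun a => UN (f1 a) (f2 a) (f3 a)) := pq6.cmp (g := fun a => (f1 a, f2 a, f3 a)) inferInstance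
theorem pq7 : PPr (fun p : ℕ × ℕ × ℕ × ℕ × ℕ => EU p.1 p.2.1 p.2.2.1 p.2.2.2.1 p.2.2.2.2) := by unfold EU; infer_instance
instance pp7 : PPr (fun a => EU (f1 a) (f2 a) (f3 a) (f4 a) (f5 a)) := pq7.cmp (g := fun a => (f1 a, f2 a, f3 a, f4 a, f5 a)) inferInstance
theorem pq8 : PPr (fun p : ℕ × ℕ × ℕ × ℕ × ℕ => Tb p.1 p.2.1 p.2.2.1 p.2.2.2.1 p.2.2.2.2) := by unfold Tb; infer_instance
instance pp8 : PPr (fun a => Tb (f1 a) (f2 a) (f3 a) (f4 a) (f5 a)) := pq8.cmp (g := fun a => (f1 a, f2 a, f3 a, f4 a, f5 a)) inferInstance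
theorem pq9 : PPr (fun p : ℕ × ℕ × ℕ × ℕ × ℕ × ℕ => TP p.1 p.2.1 p.2.2.1 p.2.2.2.1 p.2.2.2.2.1 p.2.2.2.2.2) := by unfold TP; infer_instance
instance pp9 : PPr (fun a => TP (f1 a) (f2 a) (f3 a) (f4 a) (f5 a) (f6 a)) := pq9.cmp (g := fun a => (f1 a, f2 a, f3 a, f4 a, f5 a, f6 a)) inferInstance
theorem pq10 : PPr (fun p : ℕ × ℕ × ℕ × ℕ × ℕ × ℕ × ℕ × ℕ => StA p.1 p.2.1 p.2.2.1 p.2.2.2.1 p.2.2.2.2.1 p.2.2.2.2.2.1 p.2.2.2.2.2.2.1 p.2.2.2.2.2.2.2) := by unfold StA; infer_instance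
instance pp10 : PPr (fun a => StA (f1 a) (f2 a) (f3 a) (f4 a) (f5 a) (f6 a) (f7 a) (f8 a)) := pq10.cmp (g := fun a => (f1 a, f2 a, f3 a, f4 a, f5 a, f6 a, f7 a, f8 a)) inferInstance
theorem pq11 : PPr (fun p : ℕ × ℕ × ℕ × ℕ × ℕ × ℕ × ℕ × ℕ => StB p.1 p.2.1 p.2.2.1 p.2.2.2.1 p.2.2.2.2.1 p.2.2.2.2.2.1 p.2.2.2.2.2.2.1 p.2.2.2.2.2.2.2) := by unfold StB; infer_instance
instance pp11 : PPr (fun a => StB (f1 a) (f2 a) (f3 a) (f4 a) (f5 a) (f6 a) (f7 a) (f8 a)) := pq11.cmp (g := fun a => (f1 a, f2 a, f3 a, f4 a, f5 a, f6 a, f7 a, f8 a)) inferInstance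
theorem pq12 : PPr (fun p : ℕ × ℕ × ℕ × ℕ × ℕ × ℕ × ℕ => StN p.1 p.2.1 p.2.2.1 p.2.2.2.1 p.2.2.2.2.1 p.2.2.2.2.2.1 p.2.2.2.2.2.2) := by unfold StN; infer_instance
instance pp12 : PPr (fun a => StN (f1 a) (f2 a) (f3 a) (f4 a) (f5 a) (f6 a) (f7 a)) := pq12.cmp (g := fun a => (f1 a, f2 a, f3 a, f4 a, f5 a, f6 a, f7 a)) inferInstance
theorem pq13 : PPr (fun p : ℕ × ℕ × ℕ × ℕ × ℕ => TabN p.1 p.2.1 p.2.2.1 p.2.2.2.1 p.2.2.2.2) := by unfold TabN; infer_instance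
instance pp13 : PPr (fun a => TabN (f1 a) (f2 a) (f3 a) (f4 a) (f5 a)) := pq13.cmp (g := fun a => (f1 a, f2 a, f3 a, f4 a, f5 a)) inferInstance
theorem pq14 : PPr (fun p : ℕ × ℕ × ℕ × ℕ × ℕ × ℕ × ℕ => LS p.1 p.2.1 p.2.2.1 p.2.2.2.1 p.2.2.2.2.1 p.2.2.2.2.2.1 p.2.2.2.2.2.2) := by unfold LS; infer_instance
instance pp14 : PPr (fun a => LS (f1 a) (f2 a) (f3 a) (f4 a) (f5 a) (f6 a) (f7 a)) := pq14.cmp (g := fun a => (f1 a, f2 a, f3 a, f4 a, f5 a, f6 a, f7 a)) inferInstance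
theorem pq15 : PPr (fun p : ℕ × ℕ × ℕ × ℕ × ℕ => W3N p.1 p.2.1 p.2.2.1 p.2.2.2.1 p.2.2.2.2) := by unfold W3N; infer_instance
instance pp15 : PPr (fun a => W3N (f1 a) (f2 a) (f3 a) (f4 a) (f5 a)) := pq15.cmp (g := fun a => (f1 a, f2 a, f3 a, f4 a, f5 a)) inferInstance
theorem pq16 : PPr (fun p : ℕ × ℕ × ℕ × ℕ × ℕ => W4N p.1 p.2.1 p.2.2.1 p.2.2.2.1 p.2.2.2.2) := by unfold W4N; infer_instance
instance pp16 : PPr (fun a => W4N (f1 a) (f2 a) (f3 a) (f4 a) (f5 a)) := pq16.cmp (g := fun a => (f1 a, f2 a, f3 a, f4 a, f5 a)) inferInstance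
theorem pq17 : PPr (fun p : ℕ × ℕ × ℕ × ℕ => VioN p.1 p.2.1 p.2.2.1 p.2.2.2) := by unfold VioN; infer_instance
instance pp17 : PPr (fun a => VioN (f1 a) (f2 a) (f3 a) (f4 a)) := pq17.cmp (g := fun a => (f1 a, f2 a, f3 a, f4 a)) inferInstance
theorem pq18 : PPr (fun p : ℕ × ℕ × ℕ × ℕ => EN p.1 p.2.1 p.2.2.1 p.2.2.2) := by unfold EN; infer_instance
instance pp18 : PPr (fun a => EN (f1 a) (f2 a) (f3 a) (f4 a)) := pq18.cmp (g := fun a => (f1 a, f2 a, f3 a, f4 a)) inferInstance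
theorem pq19 : PPr (fun p : ℕ × ℕ × ℕ × ℕ × ℕ × ℕ => FF p.1 p.2.1 p.2.2.1 p.2.2.2.1 p.2.2.2.2.1 p.2.2.2.2.2) := by unfold FF; infer_instance
instance pp19 : PPr (fun a => FF (f1 a) (f2 a) (f3 a) (f4 a) (f5 a) (f6 a)) := pq19.cmp (g := fun a => (f1 a, f2 a, f3 a, f4 a, f5 a, f6 a)) inferInstance
theorem pq20 : PPr (fun p : ℕ × ℕ => LokN p.1 p.2) := by unfold LokN; infer_instance
instance pp20 : PPr (fun a => LokN (f1 a) (f2 a)) := pq20.cmp (g := fun a => (f1 a, f2 a)) inferInstance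
theorem pq21 : PPr (fun p : ℕ × ℕ × ℕ × ℕ => CritN p.1 p.2.1 p.2.2.1 p.2.2.2) := by unfold CritN; infer_instance
instance pp21 : PPr (fun a => CritN (f1 a) (f2 a) (f3 a) (f4 a)) := pq21.cmp (g := fun a => (f1 a, f2 a, f3 a, f4 a)) inferInstance
theorem pp22 : PPr CC := by unfold CC; infer_instance
end

/-! ### Part F : correctness of the arithmetization -/
theorem dg_zero (b w : ℕ) : dg b w 0 = w % b := by simp [dg]
theorem dg_succ (b w i : ℕ) : dg b w (i+1) = dg b (w / b) i := by
  simp [dg, pow_succ', Nat.div_div_eq_div_mul]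
theorem dg_lt {b : ℕ} (hb : 0 < b) (w i : ℕ) : dg b w i < b := Nat.mod_lt _ hb
theorem dg_out {b w L i : ℕ} (h : w < b ^ L) (hi : L ≤ i) : dg b w i = 0 := by
  rcases Nat.eq_zero_or_pos b with rfl | hb
  · rcases L with _ | L
    · simp at h; subst h; simp [dg]
    · simp at h
  · rw [dg, Nat.div_eq_of_lt, Nat.zero_mod]
    exact h.trans_le (Nat.pow_le_pow_right hb hi)

theorem dig_ex (b : ℕ) (L : ℕ) : ∀ (g : ℕ → ℕ), (∀ i < L, g i < b) → ∃ w < b ^ L, ∀ i < L, dg b w i = g i := by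
  induction L with
  | zero => intro g _; exact ⟨0, by simp, by simp⟩
  | succ L ih =>
    intro g hg
    obtain ⟨w, hw, h⟩ := ih (fun i => g (i+1)) (fun i hi => hg _ (by omega))
    have h0 := hg 0 (by omega)
    refine ⟨g 0 + b * w, ?_, ?_⟩
    · rw [pow_succ']
      calc g 0 + b * w < b + b * w := by omega
        _ = b * (w + 1) := by ring
        _ ≤ b * b ^ L := Nat.mul_le_mul_left _ hw
    · intro i hi
      cases i with
      | zero => rw [dg_zero, Nat.add_mul_mod_self_left, Nat.mod_eq_of_lt h0]
      | succ i =>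
        rw [dg_succ, Nat.add_mul_div_left _ _ (by omega), Nat.div_eq_of_lt h0, zero_add, h i (by omega)]

theorem bits_ex (L : ℕ) (P : ℕ → Prop) : ∃ T < 2 ^ L, ∀ i < L, (bt T i ↔ P i) := by
  classical
  obtain ⟨T, hT, h⟩ := dig_ex 2 L (fun i => if P i then 1 else 0) (fun i _ => by split <;> omega)
  refine ⟨T, hT, fun i hi => ?_⟩
  rw [bt, h i hi]; split <;> simp [*]

def MN (n N0 w : ℕ) : Kripke ℕ ℕ ℕ where
  rel a p q := RN n N0 w a p q
  val k p := labN n (dg N0 w p) k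

def env (n V e : ℕ) : ℕ → ℕ := fun i => if i < n + 3 then dg V e i else dg V e 0

def Tr (n N0 w V k e : ℕ) : Prop := lsem (UN N0 w) (MN n N0 w) (dec k) (env n V e)
def TOk (n N0 w V T k : ℕ) : Prop := ∀ e < V ^ (n+3), EU n N0 w V e → (Tb n V T k e ↔ Tr n N0 w V k e)

theorem lsem_env {n k : ℕ} {V : Type} {U : V → Prop} {M : Kripke V ℕ ℕ} {e e' : ℕ → V} (hk : k ≤ n)
    (h : ∀ i < n + 3, e i = e' i) : lsem U M (dec k) e ↔ lsem U M (dec k) e' :=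
  ⟨lsem_congr_env (N := n + 2) (by omega) _ (Cd.bd_mono (by omega) _ (dec_bd k)) _ _ (fun i hi => h i (by omega)),
   lsem_congr_env (N := n + 2) (by omega) _ (Cd.bd_mono (by omega) _ (dec_bd k)) _ _ (fun i hi => (h i (by omega)).symm)⟩

section
variable {n N0 w V : ℕ} (hU : ∀ i, UN N0 w i → i < V)

theorem env_all {e : ℕ} (he : EU n N0 w V e) (i : ℕ) : UN N0 w (env n V e i) := by
  unfold env; split
  · exact he _ ‹_›
  · exact he 0 (by omega)
theorem env_lt {e i : ℕ} (hi : i < n + 3) : env n V e i = dg V e i := by simp [env, hi]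

theorem env_ex (hU : ∀ i, UN N0 w i → i < V) (f : ℕ → ℕ) (hf : ∀ i, UN N0 w (f i)) :
    ∃ e < V ^ (n+3), EU n N0 w V e ∧ ∀ i < n + 3, dg V e i = f i := by
  obtain ⟨e, he, h⟩ := dig_ex V (n+3) f (fun i _ => hU _ (hf i))
  exact ⟨e, he, fun i hi => by rw [h i hi]; exact hf i, h⟩

theorem tp_iff (hU : ∀ i, UN N0 w i → i < V) {T k x y : ℕ} (hk : k ≤ n) (h : TOk n N0 w V T k) (hx : UN N0 w x) (hy : UN N0 w y) :
    TP n V T k x y ↔ lsem (UN N0 w) (MN n N0 w) (dec k) (pe x y) := by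
  constructor
  · rintro ⟨z, hz, h0, h1, hT⟩
    have hd : ∀ i < n + 3, dg V z i = pe x y i := by
      intro i hi; unfold pe; split
      · rename_i h; rw [h]; exact h0
      · exact h1 i hi (by omega)
    refine (lsem_env hk ?_).1 ((h z hz (fun i hi => ?_)).1 hT)
    · intro i hi; rw [env_lt hi, hd i hi]
    · rw [hd i hi]; exact pe_all (P := UN N0 w) hx hy i
  · intro hl
    obtain ⟨z, hz, hE, hd⟩ := env_ex (n := n) hU (pe x y) (pe_all (P := UN N0 w) hx hy)
    refine ⟨z, hz, hd 0 (by omega), fun i hi h1 => ?_, (h z hz hE).2 ((lsem_env hk ?_).1 hl)⟩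
    · rw [hd i hi]; unfold pe; rw [if_neg (by omega)]
    · intro i hi; rw [env_lt hi, hd i hi]

theorem st_step (hU : ∀ i, UN N0 w i → i < V) {T : ℕ} (k : ℕ) : k ≤ n → (∀ j < k, TOk n N0 w V T j) → ∀ e < V ^ (n+3), EU n N0 w V e →
    (StN n N0 w V T k e ↔ Tr n N0 w V k e) := by
  have key : ∀ r t, t ≠ 0 → ∀ k, k = Nat.pair t r → r < k := fun r t ht k hk => by
    have := Nat.add_le_pair t r; omega
  have hp := Nat.add_le_pair
  induction k using code_ind with
  | h0 k h =>
    intro hk hj e he hE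
    rw [Tr, ls0 h]
    simp only [StN, StA, StB, iff_false]
    generalize k.unpair.1 = t at h
    have hh : ∀ s, 5 ≤ s → s ≤ 15 → t ≠ s := by intros; omega
    simp [hh]
  | h5 r =>
    intro hk hj e he hE
    rw [Tr, ls5 r (env_all hE 0), env_lt (by omega), env_lt (by omega)]
    simp [StN, StA, StB]
  | h6 r =>
    intro hk hj e he hE
    rw [Tr, ls6 r, env_lt (by omega), env_lt (by omega)]
    simp [StN, StA, StB, MN]
  | h7 r =>
    intro hk hj e he hE
    rw [Tr, ls7 r (env_all hE), env_lt (by omega), env_lt (by omega)]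
    simp [StN, StA, StB, MN]
  | h8 r s _ _ =>
    intro hk hj e he hE
    have := hp 8 (Nat.pair r s); have := hp r s
    rw [Tr, ls8 r s]
    simp [StN, StA, StB, hj r (by omega) e he hE, hj s (by omega) e he hE, Tr]
  | h9 r s _ _ =>
    intro hk hj e he hE
    have := hp 9 (Nat.pair r s); have := hp r s
    have u0 := hE 0 (by omega); have u1 := hE 1 (by omega)
    rw [Tr, ls9 r s (env_all hE), env_lt (by omega), env_lt (by omega)]
    simp only [StN, StA, StB, Nat.unpair_pair]
    simp
    constructor
    · rintro ⟨z, hz, h1, h2, h3⟩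
      exact ⟨z, h1, (tp_iff hU (by omega) (hj r (by omega)) u0 h1).1 h2, (tp_iff hU (by omega) (hj s (by omega)) h1 u1).1 h3⟩
    · rintro ⟨z, h1, h2, h3⟩
      exact ⟨z, hU z h1, h1, (tp_iff hU (by omega) (hj r (by omega)) u0 h1).2 h2, (tp_iff hU (by omega) (hj s (by omega)) h1 u1).2 h3⟩
  | h10 r _ =>
    intro hk hj e he hE
    have := hp 10 r
    have u0 := hE 0 (by omega); have u1 := hE 1 (by omega)
    rw [Tr, ls10 r, rtg_al (env_all hE 0), rtg_closed, env_lt (by omega), env_lt (by omega)]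
    simp only [StN, StA, StB, Nat.unpair_pair]
    have l0 := hU _ u0; have l1 := hU _ u1
    generalize dg V e 0 = x at *
    generalize dg V e 1 = y at *
    simp only [false_and, false_or, true_and, or_false, Nat.reduceEqDiff]
    refine not_congr ?_
    constructor
    · rintro ⟨Z, hZ, h1, h2⟩
      refine ⟨bt Z, h1, fun ⟨a, b, h3, h4, h5, h6, h7⟩ => h2 ⟨a, hU a h5, b, hU b h6, h3, h4, h5, h6, ?_⟩⟩
      exact (tp_iff hU (by omega) (hj r (by omega)) h5 h6).2 h7
    · rintro ⟨P, ⟨h1, h2⟩, h3⟩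
      obtain ⟨Z, hZ, hb⟩ := bits_ex V P
      refine ⟨Z, hZ, ⟨(hb _ l0).2 h1, fun h => h2 ((hb _ l1).1 h)⟩, ?_⟩
      rintro ⟨a, ha, b, hb', h4, h5, h6, h7, h8⟩
      refine h3 ⟨a, b, (hb _ ha).1 h4, fun h => h5 ((hb _ hb').2 h), h6, h7, ?_⟩
      exact (tp_iff hU (by omega) (hj r (by omega)) h6 h7).1 h8
  | h11 r =>
    intro hk hj e he hE
    rw [Tr, ls11 r (env_all hE 0), env_lt (by omega), env_lt (by omega)]
    simp [StN, StA, StB, MN]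
  | h12 r s _ _ =>
    intro hk hj e he hE
    have := hp 12 (Nat.pair r s); have := hp r s
    have u0 := hE 0 (by omega); have u1 := hE 1 (by omega)
    rw [Tr, ls12 r s (env_all hE), env_lt (by omega), env_lt (by omega),
      ← tp_iff hU (by omega) (hj r (by omega)) u0 u1, ← tp_iff hU (by omega) (hj s (by omega)) u0 u1]
    simp [StN, StA, StB]
  | h13 C s t _ =>
    intro hk hj e he hE
    have := hp 13 (Nat.pair C (Nat.pair s t)); have := hp C (Nat.pair s t); have := hp s t
    rw [Tr, ls13 C s t, env_lt (by omega), env_lt (by omega)]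
    simp only [StN, StA, StB, Nat.unpair_pair]
    simp
    constructor
    · rintro ⟨z, hz, h1, h2, h3, h4⟩
      refine ⟨env n V z, env_all h1, ?_, ?_, (hj C (by omega) z hz h1).1 h4⟩
      · rw [env_lt (by omega), h2]
      · rw [env_lt (by omega), h3]
    · rintro ⟨f, h1, h2, h3, h4⟩
      obtain ⟨z, hz, h5, h6⟩ := env_ex (n := n) hU f h1
      refine ⟨z, hz, h5, by rw [h6 s (by omega), h2], by rw [h6 t (by omega), h3], (hj C (by omega) z hz h5).2 ?_⟩
      refine (lsem_env (n := n) (by omega) ?_).1 h4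
      intro i hi; rw [env_lt hi, h6 i hi]
  | h14 r =>
    intro hk hj e he hE
    rw [Tr, ls14 r]
    simp [StN, StA, StB, MN]
  | h15 c x y C _ _ =>
    intro hk hj e he hE
    have := hp 15 (Nat.pair c (Nat.pair x (Nat.pair y C))); have := hp c (Nat.pair x (Nat.pair y C)); have := hp x (Nat.pair y C)
    have := hp y C
    rw [Tr, ls15 c x y C, env_lt (by omega), env_lt (by omega),
      ← tp_iff hU (by omega) (hj c (by omega)) (hE x (by omega)) (hE y (by omega))]
    have := hj C (by omega) e he hE
    rw [Tr] at this
    rw [← this]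
    simp [StN, StA, StB]

theorem tab_ok (hU : ∀ i, UN N0 w i → i < V) {T : ℕ} (h : TabN n N0 w V T) (k : ℕ) : k ≤ n → TOk n N0 w V T k := by
  induction k using Nat.strong_induction_on with
  | _ k ih =>
    intro hk e he hE
    rw [h k (by omega) e he hE, st_step hU k hk (fun j hj => ih j hj (by omega)) e he hE]

theorem tab_ex (hU : ∀ i, UN N0 w i → i < V) : ∃ T < 2 ^ ((n+1) * V ^ (n+3)), TabN n N0 w V T := by
  obtain ⟨T, hT, hb⟩ := bits_ex ((n+1) * V ^ (n+3)) (fun j => Tr n N0 w V (j / V ^ (n+3)) (j % V ^ (n+3)))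
  have hok : ∀ k ≤ n, TOk n N0 w V T k := by
    intro k hk e he hE
    have hB : 0 < V ^ (n+3) := by omega
    rw [Tb, hb]
    · rw [Nat.add_comm, Nat.add_mul_div_right _ _ hB, Nat.add_mul_mod_self_right, Nat.mod_eq_of_lt he, Nat.div_eq_of_lt he, zero_add]
    · have : (k + 1) * V ^ (n+3) ≤ (n+1) * V ^ (n+3) := Nat.mul_le_mul_right _ (by omega)
      rw [add_mul] at this; omega
  refine ⟨T, hT, fun k hk e he hE => ?_⟩
  rw [hok k (by omega) e he hE, st_step hU k (by omega) (fun j hj => hok j (by omega)) e he hE]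

theorem LS_iff (hU : ∀ i, UN N0 w i → i < V) {k x y : ℕ} (hk : k ≤ n) (hx : UN N0 w x) (hy : UN N0 w y) :
    LS n N0 w V k x y ↔ lsem (UN N0 w) (MN n N0 w) (dec k) (pe x y) := by
  constructor
  · rintro ⟨T, _, h1, h2⟩
    exact (tp_iff hU hk (tab_ok hU h1 k hk) hx hy).1 h2
  · intro h
    obtain ⟨T, hT, h1⟩ := tab_ex (n := n) hU
    exact ⟨T, hT, h1, (tp_iff hU hk (tab_ok hU h1 k hk) hx hy).2 h⟩
end

def numA (p : Pos) (i : ℕ) : ℕ := p.foldl (fun i b => 2 * i + b.toNat) i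
def num (p : Pos) : ℕ := numA p 1
theorem numA_app (p q : Pos) (i : ℕ) : numA (p ++ q) i = numA q (numA p i) := by simp [numA]
theorem num_snoc (p : Pos) (b : Bool) : num (p ++ [b]) = 2 * num p + b.toNat := by simp [num, numA]
theorem numA_cons (b : Bool) (p : Pos) (i : ℕ) : numA (b :: p) i = numA p (2 * i + b.toNat) := rfl
theorem toNat_le (b : Bool) : b.toNat ≤ 1 := by cases b <;> simp
theorem numA_div (p : Pos) : ∀ i, numA p i / 2 ^ p.length = i := by
  induction p with
  | nil => intro i; simp [numA]
  | cons b p ih =>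
    intro i
    have := toNat_le b
    rw [numA_cons, List.length_cons, pow_succ, ← Nat.div_div_eq_div_mul, ih]; omega
theorem num_pos1 (p : Pos) : 1 ≤ num p := by
  have := numA_div p 1
  by_contra h
  have h0 : numA p 1 = 0 := by unfold num at h; omega
  rw [h0] at this; simp at this
theorem num_lt (p : Pos) : num p < 2 ^ (p.length + 1) := by
  have := numA_div p 1
  rw [pow_succ, num]
  have h2 := Nat.lt_mul_div_succ (numA p 1) (b := 2 ^ p.length) (by positivity)
  rw [this] at h2; omega

def pos (i : ℕ) : Pos := if h : i ≤ 1 then [] else pos (i / 2) ++ [decide (i % 2 = 1)]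
decreasing_by omega

theorem num_pos (i : ℕ) (hi : 1 ≤ i) : num (pos i) = i := by
  induction i using Nat.strong_induction_on with
  | _ i ih =>
    rw [pos]
    split
    · simp [num, numA]; omega
    · rw [num_snoc, ih _ (by omega) (by omega)]
      by_cases h : i % 2 = 1 <;> simp [h] <;> omega

theorem pos_num (p : Pos) : pos (num p) = p := by
  induction p using List.reverseRecOn with
  | nil => rw [pos]; simp [num, numA]
  | append_singleton p b ih =>
    have := num_pos1 p
    have hb := toNat_le b
    rw [num_snoc, pos, dif_neg (by omega), show (2 * num p + b.toNat) / 2 = num p by omega, ih]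
    congr 2
    cases b <;> simp

theorem num_inj {p q : Pos} : num p = num q ↔ p = q :=
  ⟨fun h => by rw [← pos_num p, h, pos_num], fun h => by rw [h]⟩

theorem anc_iff_app (p q : Pos) : Anc p q ↔ ∃ r, q = p ++ false :: r := by
  induction p generalizing q with
  | nil => rcases q with _ | ⟨_ | _, q⟩ <;> simp
  | cons b p ih =>
    rcases q with _ | ⟨c, q⟩
    · simp
    · simp [ih]; intro r _; exact eq_comm

theorem ancN_iff (p q : Pos) : Anc p q ↔ AncN (num p) (num q) := by
  rw [anc_iff_app]
  constructor
  · rintro ⟨r, rfl⟩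
    have h : num (p ++ false :: r) = numA r (2 * num p) := by
      rw [num, numA_app, numA_cons]; simp [num]
    have h2 := numA_div r (2 * num p)
    rw [← h] at h2
    refine ⟨r.length, ?_, h2⟩
    have h3 := num_pos1 p
    have h4 : 2 ^ r.length ≤ num (p ++ false :: r) := by
      by_contra hc
      rw [Nat.div_eq_of_lt (by omega)] at h2; omega
    have := Nat.lt_two_pow_self (n := r.length)
    omega
  · rintro ⟨j, _, hj⟩
    have h3 := num_pos1 p
    have hjl : j ≤ q.length := by
      by_contra hc
      have := num_lt q
      have h5 : 2 ^ (q.length + 1) ≤ 2 ^ j := Nat.pow_le_pow_right (by norm_num) (by omega)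
      rw [Nat.div_eq_of_lt (by omega)] at hj; omega
    have h6 : q = q.take (q.length - j) ++ q.drop (q.length - j) := (List.take_append_drop _ _).symm
    have h7 : num q / 2 ^ j = num (q.take (q.length - j)) := by
      have := numA_div (q.drop (q.length - j)) (num (q.take (q.length - j)))
      rw [num, ← numA_app, List.take_append_drop, List.length_drop, show q.length - (q.length - j) = j by omega] at this
      exact this
    have h8 : num (q.take (q.length - j)) = num (p ++ [false]) := by
      rw [num_snoc, ← h7, hj]; simp
    rw [num_inj] at h8
    refine ⟨q.drop (q.length - j), ?_⟩
    rw [h8] at h6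
    simpa using h6

theorem bt_iff (c i : ℕ) : bt c i ↔ c.testBit i = true := by
  rw [Nat.testBit_eq_decide_div_mod_eq]; simp [bt, dg]

theorem labN_iff (n s k : ℕ) : labN n s k ↔ (alph (n+6)).lab s k := bt_iff _ _

section
variable {n N0 w V : ℕ} {f : Fo}

theorem al_iff (hf : ∀ p, f.toFun p = dg N0 w (num p)) (p : Pos) : f.al p ↔ UN N0 w (num p) := by
  have := num_pos1 p
  simp [Fo.al, UN, hf p]; omega

theorem visN_iff (hf : ∀ p, f.toFun p = dg N0 w (num p)) (p q : Pos) :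
    Vis (alph (n+6)) f.toFun p q ↔ VisN n N0 w (num p) (num q) := by
  unfold Vis VisN
  rw [num_inj, ancN_iff]
  refine or_congr Iff.rfl (and_congr Iff.rfl ?_)
  simp only [hf, alph]
  constructor
  · intro h p' h1 h2 h3 h4
    have := h (pos p')
    rw [ancN_iff, ancN_iff, ← num_inj, num_pos p' h2] at this
    exact this h3 h4
  · intro h p' h3 h4
    rw [ancN_iff] at h3
    rw [ancN_iff, ← num_inj] at h4
    refine h (num p') ?_ (num_pos1 p') h3 h4
    rcases h4 with ⟨j, hj, h5⟩ | h4
    · have := Nat.div_le_self (num q) (2 ^ j); omega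
    · omega

theorem relN_iff (hf : ∀ p, f.toFun p = dg N0 w (num p)) (a : ℕ) (p q : Pos) :
    (TM (alph (n+6)) f.toFun).rel a p q ↔ RN n N0 w a (num p) (num q) := by
  simp only [TM, RN, visN_iff hf, bt_iff]
  simp only [hf]; rfl

theorem lse_iff (hf : ∀ p, f.toFun p = dg N0 w (num p)) {k : ℕ} {x y : Pos} (hx : f.al x) (hy : f.al y) :
    lse (alph (n+6)) f k x y ↔ lsem (UN N0 w) (MN n N0 w) (dec k) (pe (num x) (num y)) := by
  constructor
  · intro h
    have := lsem_hom (N := k + 2) (U' := UN N0 w) (M' := MN n N0 w) num (fun v hv => (al_iff hf v).1 hv)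
      (fun a _ u v _ _ h => (relN_iff hf a u v).1 h)
      (fun a _ u _ h => by
        change labN n (dg N0 w (num u)) a
        rw [labN_iff, ← hf]; exact h) (dec k) (dec_bd k) (pe x y) (pe_all (P := f.al) hx hy) h
    rwa [pe_comp] at this
  · intro h
    have := lsem_hom (N := k + 2) (U' := f.al) (M' := TM (alph (n+6)) f.toFun) pos
      (fun v hv => by rw [al_iff hf, num_pos v hv.1]; exact hv)
      (fun a _ u v hu hv h => by rw [relN_iff hf, num_pos u hu.1, num_pos v hv.1]; exact h)
      (fun a _ u hu h => by
        change (alph (n+6)).lab (f.toFun (pos u)) a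
        rw [← labN_iff, hf, num_pos u hu.1]; exact h) (dec k) (dec_bd k) _
        (pe_all (P := UN N0 w) ((al_iff hf x).1 hx) ((al_iff hf y).1 hy)) h
    rw [pe_comp, pos_num, pos_num] at this
    exact this

theorem lseN (hf : ∀ p, f.toFun p = dg N0 w (num p)) (hU : ∀ i, UN N0 w i → i < V) {k : ℕ} (hk : k ≤ n) {x y : Pos} (hx : f.al x) (hy : f.al y) :
    lse (alph (n+6)) f k x y ↔ LS n N0 w V k (num x) (num y) := by
  rw [lse_iff hf hx hy, LS_iff hU hk ((al_iff hf x).1 hx) ((al_iff hf y).1 hy)]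

theorem lseE (hf : ∀ p, f.toFun p = dg N0 w (num p)) (hU : ∀ i, UN N0 w i → i < V) {k : ℕ} (hk : k ≤ n) {x : Pos} (hx : f.al x) :
    (∃ y, f.al y ∧ lse (alph (n+6)) f k x y) ↔ ∃ y, y < V ∧ UN N0 w y ∧ LS n N0 w V k (num x) y := by
  constructor
  · rintro ⟨y, hy, h⟩
    have hy' := (al_iff hf y).1 hy
    exact ⟨num y, hU _ hy', hy', (lseN hf hU hk hx hy).1 h⟩
  · rintro ⟨y, _, hy, h⟩
    have h2 : f.al (pos y) := by rw [al_iff hf, num_pos y hy.1]; exact hy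
    refine ⟨pos y, h2, (lseN hf hU hk hx h2).2 ?_⟩
    rwa [num_pos y hy.1]

theorem viol_iff (hf : ∀ p, f.toFun p = dg N0 w (num p)) (hU : ∀ i, UN N0 w i → i < V) :
    Viol (alph (n+6)) n f ↔ VioN n N0 w V := by
  constructor
  · rintro ⟨x, hx, k, hk, h⟩
    have hx' := (al_iff hf x).1 hx
    refine ⟨num x, hU _ hx', hx', k, by omega, ?_⟩
    rw [lseE hf hU hk hx, lseN hf hU hk hx hx, hf, ← labN_iff, ← labN_iff] at h
    exact h
  · rintro ⟨y, _, hy, k, hk, h⟩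
    have h2 : f.al (pos y) := by rw [al_iff hf, num_pos y hy.1]; exact hy
    refine ⟨pos y, h2, k, by omega, ?_⟩
    rw [lseE hf hU (by omega) h2, lseN hf hU (by omega) h2 h2, hf, ← labN_iff, ← labN_iff, num_pos y hy.1]
    exact h

theorem wit3_iff (hf : ∀ p, f.toFun p = dg N0 w (num p)) (hU : ∀ i, UN N0 w i → i < V) {k : ℕ} (hk : k ≤ n) :
    Wit3 (alph (n+6)) k f ↔ W3N n N0 w V k := by
  unfold Wit3 W3N
  have e1 : num [] = 1 := rfl
  by_cases h : f.al []
  · rw [lseE hf hU hk h, al_iff hf, e1]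
  · have h2 := h
    rw [al_iff hf, e1] at h2
    simp [h, h2]

theorem wit4_iff (hf : ∀ p, f.toFun p = dg N0 w (num p)) (hU : ∀ i, UN N0 w i → i < V) {k : ℕ} (hk : k ≤ n) :
    Wit4 (alph (n+6)) k f ↔ W4N n N0 w V k := by
  unfold Wit4 W4N
  have e1 : num [] = 1 := rfl
  by_cases h : f.al []
  · rw [lseN hf hU hk h h, al_iff hf, e1]
  · have h2 := h
    rw [al_iff hf, e1] at h2
    simp [h, h2]

theorem lok_iff (s : ℕ) : LabOK (alph (n+6)) n s ↔ LokN n s := by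
  unfold LabOK LokN
  simp only [← labN_iff]
  have hp := Nat.add_le_pair
  constructor
  · rintro ⟨h1, h2⟩
    exact ⟨fun k _ h => h1 k h, fun k _ l _ h => h2 k l h⟩
  · rintro ⟨h1, h2⟩
    refine ⟨fun k h => h1 k ?_ h, fun k l h => h2 k ?_ l ?_ h⟩
    · have := hp 1 k; omega
    · have := hp 2 (Nat.pair k l); have := hp k l; omega
    · have := hp 2 (Nat.pair k l); have := hp k l; omega
end

def Fo.par : Fo → ℕ → Pos → ℕ
  | .nil, a, _ => a
  | .node s _ _, a, [] => a
  | .node s x _, a, false :: p => x.par s p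
  | .node s _ y, a, true :: p => y.par a p

theorem Fo.par_nil (f : Fo) (a : ℕ) : f.par a [] = a := by cases f <;> rfl

theorem fo_facts (E : ℕ → ℕ → Prop) (N0 : ℕ) (hE : ∀ a b, E a b → a < N0 ∧ b < N0 ∧ b ≠ 0) (f : Fo) : ∀ (a : ℕ), a < N0 → Fol E a f → ∀ p : Pos,
    f.par a p < N0 ∧ f.toFun p < N0 ∧ (f.toFun p ≠ 0 → E (f.par a p) (f.toFun p)) ∧
    (f.toFun p ≠ 0 → f.par a (p ++ [false]) = f.toFun p ∧ f.par a (p ++ [true]) = f.par a p) ∧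
    (∀ b, f.toFun (p ++ [b]) ≠ 0 → f.toFun p ≠ 0) ∧ (f.toFun p ≠ 0 → p.length < f.depth) := by
  induction f with
  | nil => intro a ha _ p; simp [Fo.par, Fo.toFun]; omega
  | node s x y ihx ihy =>
    intro a ha ⟨h1, h2, h3, h4⟩ p
    have h5 := hE _ _ h1
    rcases p with _ | ⟨_ | _, p⟩
    · simp [Fo.par, Fo.toFun, Fo.depth, Fo.par_nil, h1, h2, ha, h5]
    · obtain ⟨i1, i2, i3, i4, i5, i6⟩ := ihx s h5.2.1 h3 p
      simp only [Fo.par, Fo.toFun, List.cons_append, Fo.depth, List.length_cons]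
      exact ⟨i1, i2, i3, i4, i5, fun h => by have := i6 h; omega⟩
    · obtain ⟨i1, i2, i3, i4, i5, i6⟩ := ihy a ha h4 p
      simp only [Fo.par, Fo.toFun, List.cons_append, Fo.depth, List.length_cons]
      exact ⟨i1, i2, i3, i4, i5, fun h => by have := i6 h; omega⟩

theorem ff_of {N0 c D a : ℕ} (hD : 1 ≤ D) (hE : ∀ a b, EN N0 c a b → a < N0 ∧ b < N0 ∧ b ≠ 0) (f : Fo) (ha : a < N0)
    (hf : Fol (EN N0 c) a f) (hd : f.depth ≤ D) : ∃ w < N0 ^ (2 ^ D), ∃ v < N0 ^ (2 ^ D), FF N0 (2 ^ D) c a w v ∧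
      ∀ p, f.toFun p = dg N0 w (num p) := by
  have F := fo_facts _ N0 hE f a ha hf
  obtain ⟨w, hw, h1⟩ := dig_ex N0 (2 ^ D) (fun i => f.toFun (pos i)) (fun i _ => (F _).2.1)
  obtain ⟨v, hv, h2⟩ := dig_ex N0 (2 ^ D) (fun i => f.par a (pos i)) (fun i _ => (F _).1)
  have hV : 2 ^ 1 ≤ 2 ^ D := Nat.pow_le_pow_right (by norm_num) hD
  have e1 : ∀ i, 1 ≤ i → pos (2 * i) = pos i ++ [false] := fun i hi => by
    rw [← pos_num (pos i ++ [false]), num_snoc, num_pos i hi]; rfl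
  have e2 : ∀ i, 1 ≤ i → pos (2 * i + 1) = pos i ++ [true] := fun i hi => by
    rw [← pos_num (pos i ++ [true]), num_snoc, num_pos i hi]; rfl
  refine ⟨w, hw, v, hv, ⟨?_, ?_, ?_⟩, ?_⟩
  · rw [h2 1 (by omega), show pos 1 = [] from pos_num [], Fo.par_nil]
  · intro i hi _; rw [h1 i hi, h2 i hi]; exact (F _).2.2.1
  · intro i hi h3 h4
    rw [h1 i hi, h2 i hi, h1 _ h4, h2 _ h4, h1 (2 * i) (by omega), h2 (2 * i) (by omega), e1 i h3, e2 i h3]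
    exact ⟨(F _).2.2.2.1, fun h => h.elim ((F _).2.2.2.2.1 _) ((F _).2.2.2.2.1 _)⟩
  · intro p
    by_cases hp : num p < 2 ^ D
    · rw [h1 _ hp, pos_num]
    · rw [dg_out hw (by omega)]
      by_contra h
      have h3 := (F p).2.2.2.2.2 h
      have h4 := num_lt p
      have : 2 ^ (p.length + 1) ≤ 2 ^ D := Nat.pow_le_pow_right (by norm_num) (by omega)
      omega

def mkF (L : ℕ → ℕ) : ℕ → ℕ → Fo
  | 0, _ => .nil
  | t+1, i => if L i = 0 then .nil else .node (L i) (mkF L t (2 * i)) (mkF L t (2 * i + 1))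

theorem mkF_depth (L : ℕ → ℕ) (t : ℕ) : ∀ i, (mkF L t i).depth ≤ t := by
  induction t with
  | zero => intro i; simp [mkF, Fo.depth]
  | succ t ih =>
    intro i; unfold mkF; split
    · simp [Fo.depth]
    · simp only [Fo.depth]; have := ih (2 * i); have := ih (2 * i + 1); omega

theorem numA_dead (L : ℕ → ℕ) (hL : ∀ i, 1 ≤ i → L i = 0 → L (2 * i) = 0 ∧ L (2 * i + 1) = 0) (p : Pos) :
    ∀ i, 1 ≤ i → L i = 0 → L (numA p i) = 0 := by
  induction p with
  | nil => intro i _ h; exact h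
  | cons b p ih =>
    intro i hi h
    rw [numA_cons]
    refine ih _ (by omega) ?_
    cases b
    · exact (hL i hi h).1
    · exact (hL i hi h).2

theorem mkF_fun (L : ℕ → ℕ) (V : ℕ) (hV : ∀ i, V ≤ i → L i = 0)
    (hL : ∀ i, 1 ≤ i → L i = 0 → L (2 * i) = 0 ∧ L (2 * i + 1) = 0) (t : ℕ) :
    ∀ i, 1 ≤ i → V ≤ i * 2 ^ t → ∀ p, (mkF L t i).toFun p = L (numA p i) := by
  induction t with
  | zero =>
    intro i hi h p
    rw [numA_dead L hL p i hi (hV i (by simpa using h))]; rfl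
  | succ t ih =>
    intro i hi h p
    rw [pow_succ] at h
    unfold mkF; split
    · rename_i h0; rw [numA_dead L hL p i hi h0]; rfl
    · rcases p with _ | ⟨_ | _, p⟩
      · rfl
      · exact ih (2 * i) (by omega) (by nlinarith) p
      · refine ih (2 * i + 1) (by omega) ?_ p
        nlinarith [Nat.zero_le (2 ^ t)]

theorem ff_to {N0 c D a w v : ℕ} (hw : w < N0 ^ (2 ^ D)) (hD : 1 ≤ D) (h : FF N0 (2 ^ D) c a w v) :
    ∃ f : Fo, f.depth ≤ D ∧ Fol (EN N0 c) a f ∧ ∀ p, f.toFun p = dg N0 w (num p) := by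
  obtain ⟨h1, h2, h3⟩ := h
  obtain ⟨D', rfl⟩ : ∃ D', D = D' + 1 := ⟨D - 1, by omega⟩
  have hV : ∀ i, 2 ^ (D'+1) ≤ i → dg N0 w i = 0 := fun i hi => dg_out hw hi
  have hV2 : 2 ^ (D'+1) = 2 * 2 ^ D' := by rw [pow_succ]; ring
  have hL : ∀ i, 1 ≤ i → dg N0 w i = 0 → dg N0 w (2 * i) = 0 ∧ dg N0 w (2 * i + 1) = 0 := by
    intro i hi h0
    by_cases hb : 2 * i + 1 < 2 ^ (D'+1)
    · have := (h3 i (by omega) hi hb).2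
      by_contra hc
      exact this (by tauto) h0
    · exact ⟨hV _ (by omega), hV _ (by omega)⟩
  refine ⟨mkF (dg N0 w) (D'+1) 1, mkF_depth _ _ _, ?_, fun p => mkF_fun _ _ hV hL _ 1 le_rfl (by simp) p⟩
  have key : ∀ t i, 1 ≤ i → Fol (EN N0 c) (dg N0 v i) (mkF (dg N0 w) t i) := by
    intro t
    induction t with
    | zero => intro i _; trivial
    | succ t ih =>
      intro i hi
      unfold mkF; split
      · trivial
      · rename_i h0
        have hi2 : i < 2 ^ (D'+1) := by
          by_contra hc; exact h0 (hV i (by omega))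
        have triv : ∀ j s, 2 ^ (D'+1) ≤ j → Fol (EN N0 c) s (mkF (dg N0 w) t j) := by
          intro j s hj
          cases t with
          | zero => trivial
          | succ t => unfold mkF; rw [if_pos (hV j hj)]; trivial
        refine ⟨h2 i hi2 hi h0, h0, ?_⟩
        by_cases hb : 2 * i + 1 < 2 ^ (D'+1)
        · have h4 := (h3 i (by omega) hi hb).1 h0
          have i1 := ih (2 * i) (by omega)
          have i2 := ih (2 * i + 1) (by omega)
          rw [h4.1] at i1; rw [h4.2] at i2
          exact ⟨i1, i2⟩
        · exact ⟨triv _ _ (by omega), triv _ _ (by omega)⟩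
  have := key (D'+1) 1 le_rfl
  rwa [h1] at this

theorem un_lt {N0 w V : ℕ} (hw : w < N0 ^ V) (i : ℕ) (h : UN N0 w i) : i < V := by
  by_contra hc; exact h.2 (dg_out hw (by omega))

theorem wit_iff {n N0 d c a s : ℕ} {P : Fo → Prop} {Q : ℕ → Prop} (hE : ∀ a b, EN N0 c a b → a < N0 ∧ b < N0 ∧ b ≠ 0)
    (has : EN N0 c a s) (hPQ : ∀ f w, w < N0 ^ (2 ^ (d+1)) → (∀ p, f.toFun p = dg N0 w (num p)) → (P f ↔ Q w)) :
    (∃ f : Fo, f.depth ≤ d ∧ Fol (EN N0 c) s f ∧ P (.node s f .nil)) ↔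
    (∃ w, w < N0 ^ (2^(d+1)) ∧ ∃ v, v < N0 ^ (2^(d+1)) ∧
      FF N0 (2^(d+1)) c a w v ∧ dg N0 w 1 = s ∧ dg N0 w 3 = 0 ∧ Q w) := by
  have hs := hE _ _ has
  constructor
  · rintro ⟨f, h1, h2, h3⟩
    obtain ⟨w, hw, v, hv, h4, h5⟩ := ff_of (D := d + 1) (by omega) hE (.node s f .nil) hs.1 ⟨has, hs.2.2, h2, trivial⟩
      (by simp only [Fo.depth]; omega)
    exact ⟨w, hw, v, hv, h4, (h5 []).symm, (h5 [true]).symm, (hPQ _ _ hw h5).1 h3⟩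
  · rintro ⟨w, hw, v, hv, h4, h5, h6, h7⟩
    obtain ⟨f, h8, h9, h10⟩ := ff_to hw (by omega) h4
    have h11 := (hPQ _ _ hw h10).2 h7
    have h12 : f.toFun [] = s := (h10 []).trans h5
    have h13 : f.toFun [true] = 0 := (h10 [true]).trans h6
    rcases f with _ | ⟨s', x, y⟩
    · exact absurd h12.symm hs.2.2
    · change s' = s at h12
      subst h12
      rcases y with _ | ⟨s2, y1, y2⟩
      · refine ⟨x, ?_, h9.2.2.1, h11⟩
        simp only [Fo.depth] at h8; omega
      · exact absurd h13 h9.2.2.2.2.1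

theorem critN_iff {n N0 d c : ℕ} (hN : 0 < N0) (hd : 1 ≤ d) : CritN n N0 d c ↔ CritE (alph (n+6)) n N0 d (EN N0 c) := by
  unfold CritN CritE
  have hA : (∀ a, a < N0 → ∀ b, b < N0 → EN N0 c a b → b ≠ 0) ↔ ∀ a b, EN N0 c a b → a < N0 ∧ b < N0 ∧ b ≠ 0 :=
    ⟨fun h a b hab => ⟨hab.1, hab.2.1, h a hab.1 b hab.2.1 hab⟩, fun h a _ b _ hab => (h a b hab).2.2⟩
  rw [hA]
  refine and_congr_right fun hE => and_congr ?_ (and_congr ?_ ?_)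
  · simp only [← labN_iff]
    exact ⟨fun ⟨s, _, h⟩ => ⟨s, h⟩, fun ⟨s, h⟩ => ⟨s, h.1.2.1, h⟩⟩
  · have : ∀ a s, EN N0 c a s → (((∃ s', s' < N0 ∧ EN N0 c s s') ∧ LokN n s ∧ ∀ k, k < n + 1 →
    (Nat.pair 3 k ≤ n → labN n s (Nat.pair 3 k) → ∃ w, w < N0 ^ (2^(d+1)) ∧ ∃ v, v < N0 ^ (2^(d+1)) ∧
      FF N0 (2^(d+1)) c a w v ∧ dg N0 w 1 = s ∧ dg N0 w 3 = 0 ∧ W3N n N0 w (2^(d+1)) k) ∧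
    (Nat.pair 4 k ≤ n → labN n s (Nat.pair 4 k) → ∃ w, w < N0 ^ (2^(d+1)) ∧ ∃ v, v < N0 ^ (2^(d+1)) ∧
      FF N0 (2^(d+1)) c a w v ∧ dg N0 w 1 = s ∧ dg N0 w 3 = 0 ∧ W4N n N0 w (2^(d+1)) k)) ↔
      ((∃ s', EN N0 c s s') ∧ LabOK (alph (n+6)) n s ∧ ∀ k ≤ n,
    (Nat.pair 3 k ≤ n → (alph (n+6)).lab s (Nat.pair 3 k) → ∃ f : Fo, f.depth ≤ d ∧ Fol (EN N0 c) s f ∧ Wit3 (alph (n+6)) k (.node s f .nil)) ∧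
    (Nat.pair 4 k ≤ n → (alph (n+6)).lab s (Nat.pair 4 k) → ∃ f : Fo, f.depth ≤ d ∧ Fol (EN N0 c) s f ∧ Wit4 (alph (n+6)) k (.node s f .nil)))) := by
      intro a s has
      refine and_congr ⟨fun ⟨s, _, h⟩ => ⟨s, h⟩, fun ⟨s, h⟩ => ⟨s, h.2.1, h⟩⟩ (and_congr (lok_iff s).symm ?_)
      refine forall_congr' fun k => ?_
      rw [Nat.lt_succ_iff]
      refine imp_congr_right fun hk => ?_
      rw [← labN_iff, ← labN_iff]
      rw [wit_iff (n := n) (P := Wit3 (alph (n+6)) k) (Q := fun w => W3N n N0 w (2^(d+1)) k) hE has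
          (fun f w hw hf => wit3_iff hf (un_lt hw) hk),
        wit_iff (n := n) (P := Wit4 (alph (n+6)) k) (Q := fun w => W4N n N0 w (2^(d+1)) k) hE has
          (fun f w hw hf => wit4_iff hf (un_lt hw) hk)]
    constructor
    · intro h a s has
      exact (this a s has).1 (h a has.1 s has.2.1 has)
    · intro h a _ s _ has
      exact (this a s has).2 (h a s has)
  · constructor
    · intro h f h1 h2 h3
      obtain ⟨w, hw, v, hv, h4, h5⟩ := ff_of hd hE f hN h2 h1
      exact h w hw v hv h4 ((viol_iff h5 (un_lt hw)).1 h3)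
    · intro h w hw v hv h1 h2
      obtain ⟨f, h3, h4, h5⟩ := ff_to hw hd h1
      exact h f h3 h4 ((viol_iff h5 (un_lt hw)).2 h2)

theorem code_E {N0 : ℕ} {E : ℕ → ℕ → Prop} (hE : ∀ a b, E a b → a < N0 ∧ b < N0) :
    ∃ c < 2 ^ (N0 * N0), EN N0 c = E := by
  obtain ⟨c, hc, h⟩ := bits_ex (N0 * N0) (fun j => E (j / N0) (j % N0))
  refine ⟨c, hc, ?_⟩
  funext a b
  refine propext ?_
  have key : a < N0 → b < N0 → (bt c (a * N0 + b) ↔ E a b) := by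
    intro ha hb
    rw [h, Nat.add_comm, Nat.add_mul_div_right _ _ (by omega), Nat.add_mul_mod_self_right, Nat.mod_eq_of_lt hb, Nat.div_eq_of_lt hb, zero_add]
    have : (a + 1) * N0 ≤ N0 * N0 := Nat.mul_le_mul_right _ ha
    rw [add_mul] at this; omega
  constructor
  · rintro ⟨h1, h2, h3⟩; exact (key h1 h2).1 h3
  · intro h1
    have := hE a b h1
    exact ⟨this.1, this.2, (key this.1 this.2).2 h1⟩

theorem cc_iff (n : ℕ) : CC n ↔ ∃ E, CritE (alph (n+6)) n (N0f (n+6) n) (N0f (n+6) n * WW (n+6) n) E := by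
  have hN : 0 < N0f (n+6) n := by unfold N0f; positivity
  have hW : 0 < WW (n+6) n := lev_pos (Nat.one_le_two_pow) _
  have hd : 1 ≤ N0f (n+6) n * WW (n+6) n := Nat.mul_pos hN hW
  unfold CC
  generalize N0f (n+6) n * WW (n+6) n = d at *
  generalize N0f (n+6) n = N0 at *
  constructor
  · rintro ⟨c, _, h⟩; exact ⟨_, (critN_iff hN hd).1 h⟩
  · rintro ⟨E, h⟩
    obtain ⟨c, hc, rfl⟩ := code_E (fun a b hab => ⟨(h.1 a b hab).1, (h.1 a b hab).2.1⟩)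
    exact ⟨c, hc, (critN_iff hN hd).2 h⟩

theorem cc_sat (φ : PDLFormula) : CC φ.enc ↔ ∃ (W : Type) (K : Kripke W ℕ ℕ) (w : W), φ.sat K w := by
  rw [cc_iff, ← crit_iff, ← sat_iff_good]

/-- the satisfiability problem for `CPDL⁺` is decidable: there is a
computable function deciding, given (the encoding of) a `CPDL⁺` formula `φ`, whether there
exist a Kripke structure `K` and a world `w` with `K, w ⊨ φ`. -/
theorem cpdlPlus_satisfiability_decidable :
    ∃ g : ℕ → Bool, Computable g ∧
      ∀ φ : PDLFormula, IsCPDLPlusFormula φ →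
        (g φ.enc = true ↔ ∃ (W : Type) (K : Kripke W ℕ ℕ) (w : W), φ.sat K w) := by
  classical
  obtain ⟨_, h⟩ := PrimrecPred.computablePred pp22.out
  exact ⟨_, h, fun φ _ => by rw [decide_eq_true_iff, cc_sat]⟩
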